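/- Let m, n ∈ ℕ with 1 ≤ m ≤ n, let B be an open ball in ℝ^m, let 𝓕 be a finite family of analytic nondegenerate maps f : B → ℝⁿ, and let W be a finite or countable subset of R_n satisfying inf{τ(r) : r ∈ W} > 0. Then the Hausdorff dimension of ⋂_{f ∈ 𝓕} ⋂_{r ∈ W} f⁻¹(Bad(r)) is equal to m. -/

import Mathlib

open MeasureTheory ENNReal

/-- Distance from a real number to the nearest integer. -/
noncomputable def distNearestInt (x : ℝ) : ℝ := ⨅ p : ℤ, |x - (p : ℝ)|

/-- `badPow ρ x = x ^ (1/ρ)`, with the convention `x ^ (1/0) = 0`. -/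
noncomputable def badPow (ρ x : ℝ) : ℝ := if ρ = 0 then 0 else x ^ (1 / ρ)

/-- The set `R_n` of weight vectors: nonnegative components summing to `1`. -/
def Weights (n : ℕ) : Set (Fin n → ℝ) := {r | (∑ i, r i) = 1 ∧ ∀ i, 0 ≤ r i}

/-- `τ(r)`: the smallest strictly positive component of `r`. -/
noncomputable def tauW {n : ℕ} (r : Fin n → ℝ) : ℝ := sInf {t | 0 < t ∧ ∃ i, r i = t}

/-- The set `Bad(r)` of `r`-badly approximable points of `ℝⁿ`. -/
def BadSet {n : ℕ} (r : Fin n → ℝ) : Set (EuclideanSpace ℝ (Fin n)) :=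
  {y | ∃ c > 0, ∀ q : ℕ, 1 ≤ q →
    ∃ i, c * (q : ℝ)⁻¹ ≤ badPow (r i) (distNearestInt (q * y i))}

/-- A map `f : B → ℝⁿ` is nondegenerate if `1, f₁, …, fₙ` are linearly
independent over `ℝ` (as functions on `B`). -/
def NondegOn {m n : ℕ} (f : EuclideanSpace ℝ (Fin m) → EuclideanSpace ℝ (Fin n))
    (B : Set (EuclideanSpace ℝ (Fin m))) : Prop :=
  ∀ (c : ℝ) (a : Fin n → ℝ), (∀ x ∈ B, c + ∑ i, a i * f x i = 0) → c = 0 ∧ (∀ i, a i = 0)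

set_option autoImplicit false

section Part1
open MeasureTheory Set Polynomial

lemma rolle_chain (a b : ℝ) : ∀ (i : ℕ) (G : ℕ → ℝ → ℝ) (p : ℕ → ℝ),
    (∀ l, ∀ x ∈ Icc a b, HasDerivAt (G l) (G (l+1) x) x) →
    (∀ k ≤ i, p k ∈ Icc a b) → (∀ k < i, p k < p (k+1)) → (∀ k ≤ i, G 0 (p k) = 0) →
    ∃ z ∈ Icc a b, G i z = 0 := by
  intro i
  induction i with
  | zero => intro G p _ hp _ h0; exact ⟨p 0, hp 0 le_rfl, h0 0 le_rfl⟩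
  | succ i ih =>
    intro G p hG hp hlt h0
    have key : ∀ k, ∃ z, k ≤ i → (z ∈ Ioo (p k) (p (k+1)) ∧ G 1 z = 0) := by
      intro k
      by_cases hk : k ≤ i
      · have hsub : Icc (p k) (p (k+1)) ⊆ Icc a b :=
          Icc_subset_Icc (hp k (by omega)).1 (hp (k+1) (by omega)).2
        obtain ⟨c, hc, hc'⟩ := exists_hasDerivAt_eq_zero (f := G 0) (f' := G 1) (hlt k (by omega))
          (fun x hx => (hG 0 x (hsub hx)).continuousAt.continuousWithinAt)
          (by rw [h0 k (by omega), h0 (k+1) (by omega)])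
          (fun x hx => hG 0 x (hsub (Ioo_subset_Icc_self hx)))
        exact ⟨c, fun _ => ⟨hc, hc'⟩⟩
      · exact ⟨0, fun h => absurd h hk⟩
    choose z hz using key
    obtain ⟨w, hw, hw'⟩ := ih (fun l => G (l+1)) z (fun l => hG (l+1))
      (fun k hk => ⟨(hp k (by omega)).1.trans (hz k hk).1.1.le,
        (hz k hk).1.2.le.trans (hp (k+1) (by omega)).2⟩)
      (fun k hk => (hz k hk.le).1.2.trans (hz (k+1) hk).1.1)
      (fun k hk => (hz k hk).2)
    exact ⟨w, hw, hw'⟩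

lemma sep_points (a : ℝ) {δ : ℝ} (hδ : 0 < δ) : ∀ (i : ℕ) (E : Set ℝ), E ⊆ Ici a →
    ENNReal.ofReal (2 * i * δ) < volume E →
    ∃ p : ℕ → ℝ, (∀ k ≤ i, p k ∈ E) ∧ ∀ k < i, p k + δ ≤ p (k+1) := by
  intro i
  induction i with
  | zero =>
    intro E hE h
    have : E.Nonempty := by
      rw [nonempty_iff_ne_empty]; rintro rfl; simp at h
    obtain ⟨x, hx⟩ := this
    exact ⟨fun _ => x, fun _ _ => hx, fun k hk => absurd hk (by omega)⟩
  | succ i ih =>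
    intro E hE h
    have hne : E.Nonempty := by
      rw [nonempty_iff_ne_empty]; rintro rfl; simp at h
    have hbdd : BddBelow E := ⟨a, fun x hx => hE hx⟩
    obtain ⟨x, hx, hxlt⟩ := Real.lt_sInf_add_pos hne hδ
    set E' := E ∩ Ici (x + δ) with hE'
    have hsub : E ⊆ E' ∪ Icc (sInf E) (sInf E + 2 * δ) := by
      intro y hy
      by_cases hyx : x + δ ≤ y
      · exact Or.inl ⟨hy, hyx⟩
      · exact Or.inr ⟨csInf_le hbdd hy, by linarith [not_le.1 hyx]⟩
    have hvol : volume E ≤ volume E' + ENNReal.ofReal (2 * δ) := by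
      refine (measure_mono hsub).trans ((measure_union_le _ _).trans ?_)
      rw [Real.volume_Icc]; gcongr; linarith
    have : ENNReal.ofReal (2 * i * δ) < volume E' := by
      by_contra hcon
      push Not at hcon
      have h1 : volume E ≤ ENNReal.ofReal (2 * i * δ) + ENNReal.ofReal (2 * δ) := by
        refine hvol.trans (by gcongr)
      rw [← ENNReal.ofReal_add (by positivity) (by positivity)] at h1
      have h2 := h.trans_le h1
      push_cast at h2
      rw [show 2 * ((i:ℝ) + 1) * δ = 2 * i * δ + 2 * δ by ring] at h2
      exact lt_irrefl _ h2
    obtain ⟨p, hp1, hp2⟩ := ih E' (fun y hy => hE hy.1) this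
    refine ⟨fun k => if k = 0 then x else p (k-1), ?_, ?_⟩
    · intro k hk
      rcases k with _ | k
      · simpa using hx
      · simpa using (hp1 k (by omega)).1
    · intro k hk
      rcases k with _ | k
      · simpa using (hp1 0 (by omega)).2
      · simpa using hp2 k (by omega)

lemma gap_lower {δ : ℝ} (hδ : 0 < δ) {i : ℕ} {p : ℕ → ℝ} (hp : ∀ k < i, p k + δ ≤ p (k+1)) :
    ∀ j k, j < k → k ≤ i → p j + δ ≤ p k := by
  intro j k hjk
  induction k, hjk using Nat.le_induction with
  | base => intro h; exact hp j (by omega)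
  | succ k hk ih => intro h; have := ih (by omega); have := hp k (by omega); linarith

lemma good_core (a b : ℝ) (hab : a < b) (i : ℕ) (G : ℕ → ℝ → ℝ)
    (hG : ∀ l, ∀ x ∈ Icc a b, HasDerivAt (G l) (G (l+1) x) x)
    (lam L : ℝ) (hlow : ∀ x ∈ Icc a b, lam ≤ |G i x|) (hL : 0 ≤ L)
    (hup : ∀ x ∈ Icc a b, |G i x| ≤ L * lam) (S η : ℝ) (hS : 0 < S) (hη : 0 < η)
    (hx : ∃ x ∈ Icc a b, S ≤ |G 0 x|)
    (hmpos : 0 < (volume {x ∈ Icc a b | |G 0 x| < η * S}).toReal) :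
    ((volume {x ∈ Icc a b | |G 0 x| < η * S}).toReal / (b - a)) ^ i ≤
      (i+1) * (2*(i+1))^i * ((L+1) * i.factorial + 1) * η := by
  set E := {x ∈ Icc a b | |G 0 x| < η * S} with hE
  set mm := (volume E).toReal with hm
  have hEsub : E ⊆ Icc a b := fun x hx => hx.1
  have hfin : volume E ≠ ⊤ := ((measure_mono hEsub).trans_lt (by simp)).ne
  have hD : 0 < b - a := by linarith
  set δ := mm / (2 * (i+1)) with hδ
  have hδpos : 0 < δ := by positivity
  obtain ⟨p, hp1, hp2⟩ := sep_points a hδpos i E (fun x hx => hx.1.1) (by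
    rw [← ENNReal.ofReal_toReal hfin]
    refine (ENNReal.ofReal_lt_ofReal_iff hmpos).2 ?_
    rw [hδ]; field_simp; linarith)
  have hgap := gap_lower hδpos hp2
  have hinj : Set.InjOn p (Finset.range (i+1)) := by
    intro j hj k hk hjk
    simp only [Finset.coe_range, mem_Iio] at hj hk
    rcases lt_trichotomy j k with h | h | h
    · have := hgap j k h (by omega); linarith
    · exact h
    · have := hgap k j h (by omega); linarith
  have habs : ∀ j ≤ i, ∀ k ≤ i, j ≠ k → δ ≤ |p j - p k| := by
    intro j hj k hk hjk
    rcases lt_or_gt_of_ne hjk with h | h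
    · have := hgap j k h hk; rw [abs_sub_comm]; exact (by linarith : δ ≤ p k - p j).trans (le_abs_self _)
    · have := hgap k j h hj; exact (by linarith : δ ≤ p j - p k).trans (le_abs_self _)
  set P := Lagrange.interpolate (Finset.range (i+1)) p (fun k => G 0 (p k)) with hP
  have hcoef : ∀ k ∈ Finset.range (i+1),
      |G 0 (p k) / ∏ j ∈ (Finset.range (i+1)).erase k, (p k - p j)| ≤ η * S / δ ^ i := by
    intro k hk
    rw [abs_div, Finset.abs_prod]
    have h1 : δ ^ i ≤ ∏ j ∈ (Finset.range (i+1)).erase k, |p k - p j| := by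
      have : ∏ j ∈ (Finset.range (i+1)).erase k, δ = δ ^ i := by
        rw [Finset.prod_const, Finset.card_erase_of_mem hk]; simp
      rw [← this]
      apply Finset.prod_le_prod
      · intros; positivity
      · intro j hj
        simp only [Finset.mem_erase, Finset.mem_range] at hj hk
        exact habs k (by omega) j (by omega) (Ne.symm hj.1)
    have h2 := (hp1 k (by simpa [Nat.lt_succ_iff] using hk)).2
    exact div_le_div₀ (by positivity) h2.le (by positivity) h1
  have hPi : ∀ x, |(derivative^[i] P).eval x| ≤ i.factorial * ((i+1) * (η * S / δ ^ i)) := by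
    intro x
    rw [hP, Lagrange.iterate_derivative_interpolate _ hinj (by simp)]
    simp only [Finset.card_range, Nat.sub_self, Finset.powersetCard_zero, Finset.sum_singleton,
      Finset.prod_empty, mul_one, eval_mul, eval_natCast, eval_finsetSum, eval_C]
    rw [abs_mul, Nat.abs_cast]
    gcongr
    refine (Finset.abs_sum_le_sum_abs _ _).trans ((Finset.sum_le_sum hcoef).trans ?_)
    simp
  have hP0 : ∀ x ∈ Icc a b, |P.eval x| ≤ (i+1) * (η * S / δ ^ i * (b-a)^i) := by
    intro x hx
    rw [hP, Lagrange.interpolate_eq_sum]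
    simp only [eval_finsetSum, eval_mul, eval_C, eval_prod, eval_sub, eval_X]
    refine (Finset.abs_sum_le_sum_abs _ _).trans
      ((Finset.sum_le_sum (g := fun _ => η * S / δ ^ i * (b-a)^i) ?_).trans (by simp))
    intro k hk
    rw [abs_mul]
    gcongr
    · exact hcoef k hk
    · rw [Finset.abs_prod]
      have : ∏ j ∈ (Finset.range (i+1)).erase k, (b-a) = (b-a) ^ i := by
        rw [Finset.prod_const, Finset.card_erase_of_mem hk]; simp
      rw [← this]
      apply Finset.prod_le_prod
      · intros; positivity
      · intro j hj
        simp only [Finset.mem_erase, Finset.mem_range] at hj hk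
        have := hEsub (hp1 j (by omega))
        rw [abs_le]; constructor <;> linarith [this.1, this.2, hx.1, hx.2]
  have hPd : ∀ l x, HasDerivAt (fun y => (derivative^[l] P).eval y) ((derivative^[l+1] P).eval x) x := by
    intro l x
    rw [Function.iterate_succ_apply']
    exact Polynomial.hasDerivAt _ x
  set e : ℕ → ℝ → ℝ := fun l x => G l x - (derivative^[l] P).eval x with he
  have hed : ∀ l, ∀ x ∈ Icc a b, HasDerivAt (e l) (e (l+1) x) x := fun l x hx =>
    (hG l x hx).sub (hPd l x)
  have hzero : ∀ l ≤ i, ∃ z ∈ Icc a b, e l z = 0 := by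
    intro l hl
    refine rolle_chain a b l e p hed (fun k hk => hEsub (hp1 k (by omega)))
      (fun k hk => by linarith [hp2 k (by omega)]) (fun k hk => ?_)
    simp only [he, Function.iterate_zero, id]
    rw [hP, Lagrange.eval_interpolate_at_node _ hinj (by simp; omega), sub_self]
  set Bd := i.factorial * ((i+1) * (η * S / δ ^ i)) with hBd
  have hBd0 : 0 ≤ Bd := by positivity
  have hlamB : lam ≤ Bd := by
    obtain ⟨z, hz, hz0⟩ := hzero i le_rfl
    have h1 : G i z = (derivative^[i] P).eval z := by simpa [he, sub_eq_zero] using hz0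
    have := hlow z hz
    rw [h1] at this
    exact this.trans (hPi z)
  have hei : ∀ x ∈ Icc a b, |e i x| ≤ (L+1) * Bd := by
    intro x hx
    have h1 := hup x hx
    have h2 := hPi x
    have h3 : |e i x| ≤ |G i x| + |(derivative^[i] P).eval x| := abs_sub _ _
    have : L * lam ≤ L * Bd := by gcongr
    linarith
  have hel : ∀ r ≤ i, ∀ x ∈ Icc a b, |e (i - r) x| ≤ (b-a)^r * ((L+1) * Bd) := by
    intro r
    induction r with
    | zero => intro _ x hx; simpa using hei x hx
    | succ r ih =>
      intro hr x hx
      obtain ⟨z, hz, hz0⟩ := hzero (i - (r+1)) (by omega)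
      have h1 := Convex.norm_image_sub_le_of_norm_hasDerivWithin_le (f := e (i-(r+1)))
        (f' := fun x => e (i - r) x) (s := Icc a b) (C := (b-a)^r * ((L+1) * Bd))
        (fun y hy => by
          have := hed (i-(r+1)) y hy
          rw [show i - (r+1) + 1 = i - r by omega] at this
          exact this.hasDerivWithinAt)
        (fun y hy => ih (by omega) y hy) (convex_Icc a b) hz hx
      rw [hz0, sub_zero, Real.norm_eq_abs, Real.norm_eq_abs] at h1
      refine h1.trans ?_
      rw [pow_succ]
      have h2 : |x - z| ≤ b - a := by
        rw [abs_le]; constructor <;> linarith [hx.1, hx.2, hz.1, hz.2]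
      calc _ ≤ (b-a)^r * ((L+1) * Bd) * (b-a) := by gcongr
        _ = _ := by ring
  obtain ⟨x, hx, hSx⟩ := hx
  have h1 := hel i le_rfl x hx
  rw [Nat.sub_self] at h1
  have h2 := hP0 x hx
  have h3 : |G 0 x| ≤ |e 0 x| + |P.eval x| := by
    have : G 0 x = e 0 x + P.eval x := by simp [he]
    rw [this]; exact abs_add_le _ _
  have h4 : S ≤ S * ((i+1) * ((L+1) * i.factorial + 1) * η * ((b-a)/δ)^i) := by
    refine hSx.trans (h3.trans ((add_le_add h1 h2).trans (le_of_eq ?_)))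
    rw [hBd, div_pow (b-a) δ i]; clear_value δ; ring
  have h5 : 1 ≤ (i+1) * ((L+1) * i.factorial + 1) * η * ((b-a)/δ)^i := by
    by_contra hc; push Not at hc; nlinarith
  have h6 : (b-a)/δ = 2*(i+1) * (mm/(b-a))⁻¹ := by
    rw [hδ]; field_simp
  rw [h6, mul_pow, inv_pow] at h5
  have h7 : 0 < (mm/(b-a))^i := by positivity
  calc (mm/(b-a))^i ≤ (mm/(b-a))^i * ((i+1) * ((L+1) * i.factorial + 1) * η * ((2*(i+1))^i * ((mm/(b-a))^i)⁻¹)) := by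
        nlinarith
    _ = _ := by field_simp

/-- uniform goodness for the span of finitely many analytic functions near a point -/
lemma good_span {κ : Type} [Fintype κ] (v : κ → ℝ → ℝ) (xs : ℝ)
    (hv : ∀ j, AnalyticAt ℝ (v j) xs) :
    ∃ r > (0:ℝ), ∃ C > (0:ℝ), ∃ α > (0:ℝ), ∀ c : κ → ℝ, ∀ a b, a < b → Icc a b ⊆ Icc (xs - r) (xs + r) →
      ∀ S η, 0 < S → 0 < η → (∃ x ∈ Icc a b, S ≤ |∑ j, c j * v j x|) →
      volume {x ∈ Icc a b | |∑ j, c j * v j x| < η * S} ≤ ENNReal.ofReal (C * η ^ α * (b - a)) := by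
  classical
  -- common neighbourhood of analyticity
  have hev : ∀ᶠ x in nhds xs, ∀ j, AnalyticAt ℝ (v j) x := by
    rw [Filter.eventually_all]; exact fun j => (hv j).eventually_analyticAt
  let g : (κ → ℝ) → ℕ → ℝ → ℝ := fun c l x => ∑ j, c j * iteratedDeriv l (v j) x
  have hgd : ∀ c l x, (∀ j, AnalyticAt ℝ (v j) x) → HasDerivAt (g c l) (g c (l+1) x) x := by
    intro c l x hx
    refine HasDerivAt.fun_sum fun j _ => HasDerivAt.const_mul (c j) ?_
    rw [iteratedDeriv_succ]
    have : AnalyticAt ℝ (iteratedDeriv l (v j)) x := by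
      rw [iteratedDeriv_eq_iterate]; exact (hx j).iterated_deriv l
    exact this.differentiableAt.hasDerivAt
  -- jets
  let Jet : ∀ l : ℕ, (κ → ℝ) →ₗ[ℝ] ℝ := fun l =>
    ∑ j, (iteratedDeriv l (v j) xs) • LinearMap.proj j
  have hJet : ∀ l c, Jet l c = g c l xs := by
    intro l c; simp [Jet, g, mul_comm]
  let KS : ℕ → Submodule ℝ (κ → ℝ) := fun l => ⨅ l' ∈ Finset.range (l+1), LinearMap.ker (Jet l')
  have hKS : ∀ l c, c ∈ KS l ↔ ∀ l' ≤ l, g c l' xs = 0 := by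
    intro l c
    simp [KS, Submodule.mem_iInf, hJet, Nat.lt_succ_iff]
  let Ker : ℕ →o (Submodule ℝ (κ → ℝ))ᵒᵈ :=
    { toFun := fun l => OrderDual.toDual (KS l)
      monotone' := by
        intro l1 l2 h
        change KS l2 ≤ KS l1
        intro c hc
        rw [hKS] at hc ⊢
        exact fun l' hl' => hc l' (hl'.trans h) }
  obtain ⟨k, hk⟩ := IsArtinian.monotone_stabilizes Ker
  have hker : ∀ c, (∀ l ≤ k, g c l xs = 0) → ∀ l, g c l xs = 0 := by
    intro c hc l
    have h1 : c ∈ KS k := (hKS k c).2 hc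
    rcases le_total l k with h | h
    · exact hc l h
    · have h2 : KS k = KS l := hk l h
      rw [h2] at h1
      exact (hKS l c).1 h1 l le_rfl
  have hzero : ∀ c, (∀ l ≤ k, g c l xs = 0) → ∀ᶠ x in nhds xs, g c 0 x = 0 := by
    intro c hc
    have han : AnalyticAt ℝ (g c 0) xs := by
      simp only [g, iteratedDeriv_zero]
      exact Finset.analyticAt_fun_sum _ (fun j _ => analyticAt_const.mul (hv j))
    have hit : ∀ l, iteratedDeriv l (g c 0) xs = g c l xs := by
      intro l
      simp only [g, iteratedDeriv_zero]
      rw [iteratedDeriv_fun_sum (f := fun j x => c j * v j x)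
        (fun j _ => (analyticAt_const.mul (hv j)).contDiffAt)]
      refine Finset.sum_congr rfl fun j _ => ?_
      rw [iteratedDeriv_const_mul (c j) ((hv j).contDiffAt)]
    have hall := hker c hc
    rw [← analyticOrderAt_eq_top]
    rw [ENat.eq_top_iff_forall_ge]
    intro N
    rw [natCast_le_analyticOrderAt_iff_iteratedDeriv_eq_zero han]
    intro l _; rw [hit, hall]
  -- bounded right inverse
  let Lm : (κ → ℝ) →ₗ[ℝ] (Fin (k+1) → ℝ) := LinearMap.pi (fun l => Jet l)
  obtain ⟨K, hK0, hK⟩ : ∃ K > 0, ∀ c, ∃ c', Lm c' = Lm c ∧ ‖c'‖ ≤ K * ‖Lm c‖ := by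
    let LR := Lm.rangeRestrict
    have hsurj : Function.Surjective LR := Lm.surjective_rangeRestrict
    obtain ⟨K, hK0, hK⟩ := ContinuousLinearMap.exists_preimage_norm_le
      (LinearMap.toContinuousLinearMap LR) hsurj
    refine ⟨K, hK0, fun c => ?_⟩
    obtain ⟨c', h1, h2⟩ := hK (LR c)
    refine ⟨c', ?_, ?_⟩
    · exact congrArg Subtype.val h1
    · exact h2
  obtain ⟨r0, hr0, hball⟩ := Metric.eventually_nhds_iff_ball.1 hev
  have hzero' : ∀ c, (∀ l ≤ k, g c l xs = 0) → ∀ x ∈ Metric.ball xs r0, g c 0 x = 0 := by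
    intro c hc
    have han : AnalyticOnNhd ℝ (g c 0) (Metric.ball xs r0) := by
      intro x hx
      simp only [g, iteratedDeriv_zero]
      exact Finset.analyticAt_fun_sum _ (fun j _ => analyticAt_const.mul (hball x hx j))
    exact AnalyticOnNhd.eqOn_of_preconnected_of_eventuallyEq han analyticOnNhd_const
      (convex_ball _ _).isPreconnected (Metric.mem_ball_self hr0) (hzero c hc)
  -- continuity
  set ε : ℝ := 1 / (2 * K * (Fintype.card κ + 1)) with hε
  have hε0 : 0 < ε := by positivity
  have hcont : ∀ᶠ x in nhds xs, ∀ l : Fin (k+1), ∀ j,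
      |iteratedDeriv l (v j) x - iteratedDeriv l (v j) xs| < ε := by
    rw [Filter.eventually_all]; intro l
    rw [Filter.eventually_all]; intro j
    have : AnalyticAt ℝ (iteratedDeriv l (v j)) xs := by
      rw [iteratedDeriv_eq_iterate]; exact (hv j).iterated_deriv l
    exact (Metric.tendsto_nhds.1 this.continuousAt.tendsto ε hε0)
  obtain ⟨r1, hr1, hball1⟩ := Metric.eventually_nhds_iff_ball.1 hcont
  set r := min r0 r1 / 2 with hr
  have hrpos : 0 < r := by positivity
  have hmem : ∀ x ∈ Icc (xs - r) (xs + r), x ∈ Metric.ball xs r0 ∧ x ∈ Metric.ball xs r1 := by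
    intro x hx
    have h1 : |x - xs| ≤ r := by rw [abs_le]; constructor <;> linarith [hx.1, hx.2]
    have : r < min r0 r1 := half_lt_self (by positivity)
    simp only [Metric.mem_ball, Real.dist_eq]
    exact ⟨h1.trans_lt (this.trans_le (min_le_left _ _)), h1.trans_lt (this.trans_le (min_le_right _ _))⟩
  set C' : ℝ := (k+1) * (2*(k+1))^k * ((3+1) * k.factorial + 1) with hC'
  have hC'pos : 0 < C' := by positivity
  refine ⟨r, hrpos, C' ^ ((1:ℝ)/(k+1)) + 1, by positivity, 1/(k+1), by positivity, ?_⟩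
  intro c a b hab hsub S η hS hη ⟨x0, hx0, hSx0⟩
  obtain ⟨c', hc'1, hc'2⟩ := hK c
  have hgeq : ∀ x ∈ Icc a b, g c' 0 x = ∑ j, c j * v j x := by
    intro x hx
    have h1 : ∀ l ≤ k, g (c' - c) l xs = 0 := by
      intro l hl
      rw [← hJet, map_sub, sub_eq_zero]
      exact congrFun hc'1 ⟨l, Nat.lt_succ_of_le hl⟩
    have h2 := hzero' _ h1 x (hmem x (hsub hx)).1
    simp only [g, Pi.sub_apply, sub_mul, Finset.sum_sub_distrib, iteratedDeriv_zero] at h2 ⊢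
    linarith
  -- maximal index
  obtain ⟨i, -, hi⟩ := Finset.exists_max_image (Finset.univ : Finset (Fin (k+1)))
    (fun l => |Lm c l|) ⟨0, Finset.mem_univ _⟩
  set M := |Lm c i| with hM
  have hnorm : ‖Lm c‖ ≤ M := by
    rw [pi_norm_le_iff_of_nonneg (abs_nonneg _)]
    intro l; exact hi l (Finset.mem_univ _)
  have hM0 : 0 < M := by
    rcases (abs_nonneg (Lm c i)).eq_or_lt with h | h
    · exfalso
      have hM0 : M = 0 := h.symm
      have h1 : ∀ l ≤ k, g c l xs = 0 := by
        intro l hl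
        have := hi ⟨l, Nat.lt_succ_of_le hl⟩ (Finset.mem_univ _)
        rw [hM0] at this
        have := abs_eq_zero.1 (le_antisymm this (abs_nonneg _))
        rw [← hJet]; exact this
      have h2 := hzero' c h1 x0 (hmem x0 (hsub hx0)).1
      simp only [g, iteratedDeriv_zero] at h2
      rw [h2] at hSx0; simp at hSx0; linarith
    · exact h
  have hgi : |g c' i xs| = M := by
    rw [hM, ← hJet]; congr 1; exact congrFun hc'1 i
  have hosc : ∀ x ∈ Icc a b, |g c' i x - g c' i xs| ≤ M / 2 := by
    intro x hx
    have h1 := hball1 x (hmem x (hsub hx)).2 i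
    simp only [g]
    rw [← Finset.sum_sub_distrib]
    have hterm : ∀ j ∈ (Finset.univ : Finset κ),
        |c' j * iteratedDeriv i (v j) x - c' j * iteratedDeriv i (v j) xs| ≤ K * M * ε := by
      intro j _
      rw [← mul_sub, abs_mul]
      have h2 : |c' j| ≤ K * M := (norm_le_pi_norm c' j).trans (hc'2.trans (by gcongr))
      exact mul_le_mul h2 (h1 j).le (abs_nonneg _) (by positivity)
    refine (Finset.abs_sum_le_sum_abs _ _).trans ((Finset.sum_le_sum hterm).trans ?_)
    rw [Finset.sum_const, Finset.card_univ, nsmul_eq_mul, hε]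
    have : (Fintype.card κ : ℝ) * (K * M * (1 / (2 * K * (Fintype.card κ + 1)))) =
      (M/2) * ((Fintype.card κ : ℝ) / (Fintype.card κ + 1)) := by field_simp
    rw [this]
    have h3 : (Fintype.card κ : ℝ) / (Fintype.card κ + 1) ≤ 1 := by
      rw [div_le_one (by positivity)]; linarith
    nlinarith
  have hset : {x ∈ Icc a b | |∑ j, c j * v j x| < η * S} = {x ∈ Icc a b | |g c' 0 x| < η * S} := by
    ext x; simp only [mem_ofPred_eq]
    exact and_congr_right fun hx => by rw [hgeq x hx]
  rw [hset]
  have hfin : volume {x ∈ Icc a b | |g c' 0 x| < η * S} ≠ ⊤ :=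
    ((measure_mono (fun x hx => hx.1)).trans_lt (by simp : volume (Icc a b) < ⊤)).ne
  rw [← ENNReal.ofReal_toReal hfin]
  apply ENNReal.ofReal_le_ofReal
  set mm := (volume {x ∈ Icc a b | |g c' 0 x| < η * S}).toReal with hmm
  have hba : 0 < b - a := by linarith
  rcases (ENNReal.toReal_nonneg : 0 ≤ mm).eq_or_lt with h0 | hpos
  · rw [hmm, ← h0]; positivity
  have hcore := good_core a b hab i (g c') (fun l x hx => hgd c' l x (hball x (hmem x (hsub hx)).1))
    (M/2) 3 (fun x hx => by
      have h1 := hosc x hx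
      have h2 := abs_sub_abs_le_abs_sub (g c' i xs) (g c' i x)
      rw [abs_sub_comm] at h2; linarith) (by norm_num)
    (fun x hx => by
      have h1 := hosc x hx
      have h2 := abs_sub_abs_le_abs_sub (g c' i x) (g c' i xs)
      linarith) S η hS hη ⟨x0, hx0, by rw [hgeq x0 hx0]; exact hSx0⟩ hpos
  have hle1 : mm / (b - a) ≤ 1 := by
    rw [div_le_one hba]
    have : mm ≤ (volume (Icc a b)).toReal :=
      ENNReal.toReal_mono (by simp) (measure_mono (fun x hx => hx.1))
    rwa [Real.volume_Icc, ENNReal.toReal_ofReal hba.le] at this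
  have hik : (i : ℕ) ≤ k := Nat.lt_succ_iff.1 i.2
  have h5 : (mm/(b-a))^(k+1) ≤ C' * η := by
    refine (pow_le_pow_of_le_one (by positivity) hle1 (by omega : (i:ℕ) ≤ k+1)).trans (hcore.trans ?_)
    rw [hC']
    have hc : ((i:ℕ):ℝ) ≤ k := by exact_mod_cast hik
    have hc2 : (2 * ((i:ℕ):ℝ) + 2)^(i:ℕ) ≤ (2*((k:ℝ)+1))^k := by
      refine (pow_le_pow_left₀ (by positivity) (by linarith : 2 * ((i:ℕ):ℝ) + 2 ≤ 2*((k:ℝ)+1)) _).trans ?_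
      exact pow_le_pow_right₀ (by nlinarith [Nat.cast_nonneg (α := ℝ) k]) hik
    rw [show 2 * (((i:ℕ):ℝ) + 1) = 2 * ((i:ℕ):ℝ) + 2 by ring]
    gcongr
  have h6 : mm/(b-a) ≤ (C' * η) ^ ((1:ℝ)/(k+1)) := by
    have := Real.rpow_le_rpow (by positivity) h5 (by positivity : (0:ℝ) ≤ 1/((k:ℝ)+1))
    rwa [← Real.rpow_natCast, ← Real.rpow_mul (by positivity),
      show (((k+1 : ℕ) : ℝ)) * (1/((k:ℝ)+1)) = 1 by push_cast; field_simp, Real.rpow_one] at this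
  rw [Real.mul_rpow hC'pos.le hη.le, div_le_iff₀ hba] at h6
  refine h6.trans ?_
  gcongr
  linarith
end Part1

section Part2
open MeasureTheory Set

section tuples
variable {κ : Type} [Fintype κ]

/-- apply a real matrix to an integer vector -/
noncomputable def hvec (h : Matrix κ κ ℝ) (v : κ → ℤ) : κ → ℝ := h.mulVec (fun k => (v k : ℝ))

/-- minors of `h A` -/
noncomputable def tmin (h : Matrix κ κ ℝ) {j : ℕ} (A : Fin j → κ → ℤ) (I : Fin j → κ) : ℝ :=
  Matrix.det (Matrix.of fun a b => hvec h (A b) (I a))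

/-- maximal minor -/
noncomputable def tmax (h : Matrix κ κ ℝ) {j : ℕ} (A : Fin j → κ → ℤ) : ℝ := ⨆ I, |tmin h A I|

/-- rational version of an integer vector -/
def qv (v : κ → ℤ) : κ → ℚ := fun k => (v k : ℚ)

/-- independent tuple in V -/
def TupIn (V : Submodule ℚ (κ → ℚ)) {j : ℕ} (A : Fin j → κ → ℤ) : Prop :=
  (∀ b, qv (A b) ∈ V) ∧ LinearIndependent ℚ (fun b => qv (A b))

lemma tmin_le_tmax (h : Matrix κ κ ℝ) {j : ℕ} (A : Fin j → κ → ℤ) (I : Fin j → κ) :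
    |tmin h A I| ≤ tmax h A := le_ciSup (f := fun I => |tmin h A I|) (Finite.bddAbove_range _) I

lemma tmax_le [Nonempty κ] (h : Matrix κ κ ℝ) {j : ℕ} (A : Fin j → κ → ℤ) (M : ℝ)
    (hM : ∀ I, |tmin h A I| ≤ M) : tmax h A ≤ M := ciSup_le hM

lemma tmax_exists [Nonempty κ] (h : Matrix κ κ ℝ) {j : ℕ} (A : Fin j → κ → ℤ) :
    ∃ I, tmax h A = |tmin h A I| := by
  obtain ⟨I, hI⟩ := exists_eq_ciSup_of_finite (f := fun I => |tmin h A I|)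
  exact ⟨I, hI.symm⟩

lemma tmin_comb (h : Matrix κ κ ℝ) {j : ℕ} (A A' : Fin j → κ → ℤ) (T : Matrix (Fin j) (Fin j) ℚ)
    (hT : ∀ c, qv (A' c) = ∑ b, T b c • qv (A b)) (I : Fin j → κ) :
    tmin h A' I = tmin h A I * ((T.det : ℚ) : ℝ) := by
  have hTd : ((T.det : ℚ) : ℝ) = (T.map (fun q : ℚ => (q:ℝ))).det := by
    have := RingHom.map_det (algebraMap ℚ ℝ) T
    simp only [eq_ratCast] at this
    rw [this]; rfl
  rw [tmin, tmin, hTd, ← Matrix.det_mul]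
  congr 1
  ext a c
  simp only [Matrix.of_apply, Matrix.mul_apply, Matrix.map_apply, hvec, Matrix.mulVec, dotProduct]
  have : ∀ k, (A' c k : ℝ) = ∑ b, (T b c : ℝ) * (A b k : ℝ) := by
    intro k
    have := congrFun (hT c) k
    simp only [qv, Finset.sum_apply, Pi.smul_apply, smul_eq_mul] at this
    have h2 : ((A' c k : ℚ) : ℝ) = ((∑ b, T b c * (A b k : ℚ) : ℚ) : ℝ) := by rw [this]
    push_cast at h2; exact h2
  simp_rw [this, Finset.sum_mul, Finset.mul_sum]
  rw [Finset.sum_comm]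
  refine Finset.sum_congr rfl fun b _ => Finset.sum_congr rfl fun k _ => by ring

lemma exists_T {V : Submodule ℚ (κ → ℚ)} {j : ℕ} (hj : j = Module.finrank ℚ V)
    {A : Fin j → κ → ℤ} (hA : TupIn V A) {v : κ → ℤ} (hv : qv v ∈ V) :
    ∃ T : Fin j → ℚ, qv v = ∑ b, T b • qv (A b) := by
  have hspan : Submodule.span ℚ (range fun b => qv (A b)) = V := by
    apply Submodule.eq_of_le_of_finrank_eq
    · rw [Submodule.span_le]; rintro _ ⟨b, rfl⟩; exact hA.1 b
    · rw [finrank_span_eq_card hA.2]; simpa using hj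
  rw [← hspan, Submodule.mem_span_range_iff_exists_fun] at hv
  obtain ⟨c, hc⟩ := hv
  exact ⟨c, hc.symm⟩

lemma exists_int_multiple (v : κ → ℚ) : ∃ d : ℕ, d ≠ 0 ∧ ∃ w : κ → ℤ, qv w = (d:ℚ) • v := by
  refine ⟨∏ k, (v k).den, Finset.prod_ne_zero_iff.2 fun k _ => (v k).den_nz, ?_⟩
  classical
  refine ⟨fun k => (v k).num * ∏ k' ∈ Finset.univ.erase k, ((v k').den : ℤ), ?_⟩
  ext k
  simp only [qv, Pi.smul_apply, smul_eq_mul]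
  rw [← Finset.mul_prod_erase Finset.univ (fun k => (v k).den) (Finset.mem_univ k)]
  push_cast
  have : ((v k).num : ℚ) = (v k).den * v k := by rw [mul_comm, Rat.mul_den_eq_num]
  rw [this]; ring

lemma exists_tupIn (V : Submodule ℚ (κ → ℚ)) :
    ∃ A : Fin (Module.finrank ℚ V) → κ → ℤ, TupIn V A := by
  let b := Module.finBasis ℚ V
  choose d hd w hw using fun i => exists_int_multiple (b i : κ → ℚ)
  refine ⟨w, fun i => ?_, ?_⟩
  · rw [hw]; exact V.smul_mem _ (b i).2
  · have h1 : LinearIndependent ℚ (fun i => (b i : κ → ℚ)) :=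
      b.linearIndependent.map' V.subtype (Submodule.ker_subtype V)
    have h2 := h1.units_smul (fun i => Units.mk0 (d i : ℚ) (by exact_mod_cast hd i))
    convert h2 using 1
    ext i k
    rw [hw]; rfl

/-- a nonzero minor -/
lemma exists_tmin_one_ne {V : Submodule ℚ (κ → ℚ)} [DecidableEq κ] {j : ℕ}
    {A : Fin j → κ → ℤ} (hA : TupIn V A) :
    ∃ I : Fin j → κ, tmin (1 : Matrix κ κ ℝ) A I ≠ 0 := by
  classical
  -- matrix over ℚ with columns A b
  let M : Matrix (Fin j) κ ℚ := Matrix.of fun b k => (A b k : ℚ)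
  have hrank : M.rank = j := by
    have := LinearIndependent.rank_matrix (M := M) (by exact hA.2)
    simpa using this
  have hcol : Module.finrank ℚ (Submodule.span ℚ (range M.col)) = j := by
    exact (Matrix.rank_eq_finrank_span_cols M).symm.trans hrank
  obtain ⟨I, hIinj, hI⟩ : ∃ I : Fin j → κ, Function.Injective I ∧
      LinearIndependent ℚ (fun a => M.col (I a)) := by
    obtain ⟨s, hs1, hs2, hs3⟩ := exists_linearIndependent ℚ (range M.col)
    have hsf : s.Finite := (Set.finite_range _).subset hs1
    haveI := hsf.fintype
    have hcard : Fintype.card s = j := by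
      refine Eq.trans ?_ hcol
      rw [← hs2]
      exact (finrank_span_set_eq_card hs3 |>.trans (by simp)).symm
    let e : Fin j ≃ s := (Fintype.equivFinOfCardEq hcard).symm
    choose I hI using fun a => hs1 (e a).2
    have hcomp : LinearIndependent ℚ (fun a => ((e a : s) : Fin j → ℚ)) := hs3.comp e e.injective
    have heq : (fun a => M.col (I a)) = fun a => ((e a : s) : Fin j → ℚ) := funext hI
    refine ⟨I, fun a a' h => ?_, heq ▸ hcomp⟩
    apply hcomp.injective
    simp only; rw [← hI a, ← hI a', h]
  refine ⟨I, ?_⟩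
  have hdet : (Matrix.of fun a b => (A b (I a) : ℚ)).det ≠ 0 := by
    have : LinearIndependent ℚ (Matrix.of fun a b => (A b (I a) : ℚ)).row := hI
    rw [Matrix.linearIndependent_rows_iff_isUnit, Matrix.isUnit_iff_isUnit_det] at this
    exact this.ne_zero
  have heq : tmin (1 : Matrix κ κ ℝ) A I =
      (((Matrix.of fun a b => (A b (I a) : ℚ)).det : ℚ) : ℝ) := by
    have := RingHom.map_det (algebraMap ℚ ℝ) (Matrix.of fun a b => (A b (I a) : ℚ))
    simp only [eq_ratCast] at this
    rw [this, tmin]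
    congr 1
    ext a b
    simp [hvec]
  rw [heq]
  exact_mod_cast hdet

lemma tmin_one_int [DecidableEq κ] {j : ℕ} (A : Fin j → κ → ℤ) (I : Fin j → κ) :
    tmin (1 : Matrix κ κ ℝ) A I = (((Matrix.of fun a b => A b (I a)).det : ℤ) : ℝ) := by
  have := RingHom.map_det (Int.castRingHom ℝ) (Matrix.of fun a b => (A b (I a) : ℤ))
  simp only [eq_intCast] at this
  rw [this, tmin]
  congr 1
  ext a b
  simp [hvec]

/-- minimal tuple -/
lemma exists_min_tuple (V : Submodule ℚ (κ → ℚ)) :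
    ∃ A : Fin (Module.finrank ℚ V) → κ → ℤ, TupIn V A ∧
      ∀ A' : Fin (Module.finrank ℚ V) → κ → ℤ, TupIn V A' → ∀ (h : Matrix κ κ ℝ) I,
        |tmin h A I| ≤ |tmin h A' I| := by
  classical
  let size : (Fin (Module.finrank ℚ V) → κ → ℤ) → ℕ :=
    fun A => ∑ I : Fin (Module.finrank ℚ V) → κ, ((Matrix.of fun a b => A b (I a)).det).natAbs
  have hsize : ∀ A, (size A : ℝ) = ∑ I, |tmin (1 : Matrix κ κ ℝ) A I| := by
    intro A
    simp only [size, tmin_one_int]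
    rw [Nat.cast_sum]
    refine Finset.sum_congr rfl fun I _ => ?_
    rw [← Int.cast_abs, Int.abs_eq_natAbs, Int.cast_natCast]
  have hne : {A : Fin (Module.finrank ℚ V) → κ → ℤ | TupIn V A}.Nonempty := exists_tupIn V
  obtain ⟨A, hA, hmin⟩ : ∃ A, TupIn V A ∧ ∀ A', TupIn V A' → size A ≤ size A' := by
    let A := Function.argminOn size {A | TupIn V A} hne
    exact ⟨A, Function.argminOn_mem size _ hne, fun A' h => Function.argminOn_le size _ h⟩
  refine ⟨A, hA, fun A' hA' h I => ?_⟩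
  choose T hT using fun c => exists_T rfl hA (hA'.1 c)
  have hcomb := fun h I => tmin_comb h A A' (Matrix.of fun b c => T c b) hT I
  set t := (((Matrix.of fun b c => T c b).det : ℚ) : ℝ) with ht
  have h1 : (size A' : ℝ) = size A * |t| := by
    rw [hsize, hsize, Finset.sum_mul]
    refine Finset.sum_congr rfl fun I _ => ?_
    rw [hcomb, abs_mul]
  have hpos : 0 < (size A : ℝ) := by
    rw [hsize]
    obtain ⟨I, hI⟩ := exists_tmin_one_ne hA
    exact Finset.sum_pos' (fun _ _ => abs_nonneg _) ⟨I, Finset.mem_univ _, abs_pos.2 hI⟩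
  have h2 : (size A : ℝ) ≤ size A' := by exact_mod_cast hmin A' hA'
  have h3 : 1 ≤ |t| := by
    rw [h1] at h2; by_contra hc; push Not at hc; nlinarith
  rw [hcomb, abs_mul]
  nlinarith [abs_nonneg (tmin h A I)]

noncomputable def AV (V : Submodule ℚ (κ → ℚ)) : Fin (Module.finrank ℚ V) → κ → ℤ :=
  (exists_min_tuple V).choose

lemma AV_tup (V : Submodule ℚ (κ → ℚ)) : TupIn V (AV V) := (exists_min_tuple V).choose_spec.1

/-- covolume function -/
noncomputable def psi (h : Matrix κ κ ℝ) (V : Submodule ℚ (κ → ℚ)) : ℝ := tmax h (AV V)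

lemma psi_le [Nonempty κ] (h : Matrix κ κ ℝ) (V : Submodule ℚ (κ → ℚ)) {j : ℕ}
    (hj : j = Module.finrank ℚ V) (A' : Fin j → κ → ℤ) (hA' : TupIn V A') :
    psi h V ≤ tmax h A' := by
  subst hj
  exact tmax_le _ _ _ fun I =>
    ((exists_min_tuple V).choose_spec.2 A' hA' h I).trans (tmin_le_tmax h A' I)

lemma psi_bot [Nonempty κ] (h : Matrix κ κ ℝ) : psi h (⊥ : Submodule ℚ (κ → ℚ)) = 1 := by
  obtain ⟨I, hI⟩ := tmax_exists h (AV (⊥ : Submodule ℚ (κ → ℚ)))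
  rw [psi, hI, tmin]
  haveI : IsEmpty (Fin (Module.finrank ℚ (⊥ : Submodule ℚ (κ → ℚ)))) := by
    rw [finrank_bot]; infer_instance
  rw [Matrix.det_isEmpty, abs_one]

lemma psi_nonneg (h : Matrix κ κ ℝ) (V : Submodule ℚ (κ → ℚ)) : 0 ≤ psi h V :=
  Real.iSup_nonneg fun _ => abs_nonneg _

lemma psi_sup [Nonempty κ] (h : Matrix κ κ ℝ) (V : Submodule ℚ (κ → ℚ)) (v : κ → ℤ)
    (hv : qv v ∉ V) (M : ℝ) (hM : ∀ k, |hvec h v k| ≤ M) :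
    psi h (V ⊔ Submodule.span ℚ {qv v}) ≤ Fintype.card κ * M * psi h V := by
  set W := V ⊔ Submodule.span ℚ {qv v} with hW
  have hv0 : qv v ≠ 0 := fun h0 => hv (h0 ▸ V.zero_mem)
  have hVW : V ≤ W := le_sup_left
  have hvW : qv v ∈ W := (le_sup_right : Submodule.span ℚ {qv v} ≤ W)
    (Submodule.mem_span_singleton_self _)
  let A' : Fin (Module.finrank ℚ V + 1) → κ → ℤ := Fin.cons v (AV V)
  have hA' : TupIn W A' := by
    constructor
    · intro b
      refine Fin.cases ?_ (fun b => ?_) b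
      · simpa [A'] using hvW
      · simpa [A'] using hVW ((AV_tup V).1 b)
    · have : (fun b => qv (A' b)) = Fin.cons (qv v) (fun b => qv (AV V b)) := by
        funext b
        refine Fin.cases ?_ (fun b => ?_) b <;> simp [A']
      rw [this, linearIndependent_finCons]
      refine ⟨(AV_tup V).2, fun hmem => hv ?_⟩
      have : Submodule.span ℚ (range fun b => qv (AV V b)) ≤ V := by
        rw [Submodule.span_le]; rintro _ ⟨b, rfl⟩; exact (AV_tup V).1 b
      exact this hmem
  have hfin : Module.finrank ℚ V + 1 = Module.finrank ℚ W := by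
    apply le_antisymm
    · have : V < W := lt_of_le_of_ne hVW fun heq => hv (heq ▸ hvW)
      exact Submodule.finrank_lt_finrank_of_lt this
    · have := Submodule.finrank_add_le_finrank_add_finrank V (Submodule.span ℚ {qv v})
      rw [finrank_span_singleton hv0] at this
      exact this
  have hcard : Module.finrank ℚ V + 1 ≤ Fintype.card κ := by
    rw [hfin]
    have := Submodule.finrank_le W
    simpa using this
  refine (psi_le h W hfin A' hA').trans (tmax_le _ _ _ fun I => ?_)
  have hM0 : 0 ≤ M := (abs_nonneg _).trans (hM (Classical.arbitrary κ))
  rw [tmin, Matrix.det_succ_column_zero]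
  refine (Finset.abs_sum_le_sum_abs _ _).trans ?_
  have hterm : ∀ i ∈ (Finset.univ : Finset (Fin (Module.finrank ℚ V + 1))),
      |(-1) ^ (i:ℕ) * (Matrix.of fun a b => hvec h (A' b) (I a)) i 0 *
        ((Matrix.of fun a b => hvec h (A' b) (I a)).submatrix i.succAbove Fin.succ).det| ≤
        M * psi h V := by
    intro i _
    rw [abs_mul, abs_mul, abs_pow, abs_neg, abs_one, one_pow, one_mul]
    refine mul_le_mul ?_ ?_ (abs_nonneg _) hM0
    · simpa [A'] using hM (I i)
    · have := tmin_le_tmax h (AV V) (fun a => I (i.succAbove a))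
      exact this
  refine (Finset.sum_le_sum hterm).trans ?_
  rw [Finset.sum_const, Finset.card_univ, Fintype.card_fin, nsmul_eq_mul, mul_assoc]
  have := psi_nonneg h V
  have h2 : ((Module.finrank ℚ V + 1 : ℕ) : ℝ) ≤ Fintype.card κ := by exact_mod_cast hcard
  gcongr

end tuples
end Part2

section Part3
open MeasureTheory Set ENNReal

/-- dyadic interval -/
def dy (g i : ℕ) : Set ℝ := Ico ((i:ℝ) / 2^g) (((i:ℝ)+1) / 2^g)

lemma mem_dy_iff {g i : ℕ} {x : ℝ} (hx : 0 ≤ x) : x ∈ dy g i ↔ ⌊x * 2^g⌋₊ = i := by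
  rw [Nat.floor_eq_iff (by positivity), dy, mem_Ico, div_le_iff₀ (by positivity),
    lt_div_iff₀ (by positivity)]

lemma dy_nonneg {g i : ℕ} {x : ℝ} (hx : x ∈ dy g i) : 0 ≤ x :=
  le_trans (by positivity) hx.1

lemma vol_dy (g i : ℕ) : volume (dy g i) = ENNReal.ofReal (1/2^g) := by
  rw [dy, Real.volume_Ico]; congr 1; ring

lemma meas_dy (g i : ℕ) : MeasurableSet (dy g i) := measurableSet_Ico

lemma floor_anc (x : ℝ) (hx : 0 ≤ x) (g m : ℕ) : ⌊x * 2^(g+m)⌋₊ / 2^m = ⌊x * 2^g⌋₊ := by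
  rw [← Nat.floor_div_natCast]
  congr 1
  push_cast
  rw [pow_add]; field_simp

/-- children lie in ancestors -/
lemma dy_sub_anc (g m i : ℕ) : dy (g+m) i ⊆ dy g (i / 2^m) := by
  intro x hx
  have h0 := dy_nonneg hx
  rw [mem_dy_iff h0] at hx ⊢
  rw [← hx, floor_anc x h0]

lemma dy_anc_unique {g m i i' : ℕ} {x : ℝ} (h1 : x ∈ dy (g+m) i') (h2 : x ∈ dy g i) : i' / 2^m = i := by
  have h0 := dy_nonneg h1
  rw [mem_dy_iff h0] at h1 h2
  rw [← h1, ← h2, floor_anc x h0]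

section qnd
variable {P : Type} [PartialOrder P]

def Comp (F : Finset P) (s : P) : Prop := s ∉ F ∧ ∀ t ∈ F, s ≤ t ∨ t ≤ s

def Marked (ψ : ℝ → P → ℝ) (η : ℝ) (F : Finset P) (x : ℝ) : Prop :=
  ∃ F' : Finset P, F ⊆ F' ∧ IsChain (· ≤ ·) (F' : Set P) ∧ (∀ s ∈ F', s ∉ F → η ≤ ψ x s ∧ ψ x s ≤ 1) ∧
    ∀ s, Comp F' s → 1 ≤ ψ x s

lemma chain_card (rk : P → ℕ) (hrk : StrictMono rk) (N : ℕ) (hN : ∀ s, 1 ≤ rk s ∧ rk s ≤ N)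
    (F : Finset P) (hF : IsChain (· ≤ ·) (F : Set P)) : F.card ≤ N := by
  classical
  have hinj : Set.InjOn rk (F : Set P) := by
    intro s hs t ht hst
    by_contra hne
    rcases hF hs ht hne with h | h
    · exact absurd hst (hrk (lt_of_le_of_ne h hne)).ne
    · exact absurd hst (hrk (lt_of_le_of_ne h (Ne.symm hne))).ne'
  rw [← Finset.card_image_of_injOn hinj]
  have : F.image rk ⊆ Finset.Icc 1 N := by
    intro r hr
    obtain ⟨s, _, rfl⟩ := Finset.mem_image.1 hr
    exact Finset.mem_Icc.2 (hN s)
  simpa using Finset.card_le_card this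

lemma chain_insert [DecidableEq P] {F : Finset P} (hF : IsChain (· ≤ ·) (F : Set P)) {s : P}
    (hs : Comp F s) : IsChain (· ≤ ·) ((insert s F : Finset P) : Set P) := by
  rw [Finset.coe_insert]
  exact hF.insert fun t ht _ => hs.2 t ht

theorem qnd (rk : P → ℕ) (hrk : StrictMono rk) (N : ℕ) (hN : ∀ s, 1 ≤ rk s ∧ rk s ≤ N)
    (ψ : ℝ → P → ℝ) (hcont : ∀ s, ContinuousOn (fun x => ψ x s) (Icc 0 1)) (η : ℝ)
    (ε : ℝ≥0∞)
    (hgood : ∀ s g i, dy g i ⊆ Icc 0 1 → (∃ x ∈ dy g i, 1 ≤ ψ x s) →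
      volume {x ∈ dy g i | ψ x s < η} ≤ ε * volume (dy g i)) :
    ∀ (k : ℕ) (F : Finset P), IsChain (· ≤ ·) (F : Set P) → N ≤ F.card + k → ∀ g i, dy g i ⊆ Icc 0 1 →
      (∀ s, Comp F s → ∃ x ∈ dy g i, 1 ≤ ψ x s) →
      volume {x ∈ dy g i | ¬ Marked ψ η F x} ≤ ((4^k : ℕ) : ℝ≥0∞) * ε * volume (dy g i) := by
  classical
  intro k
  induction k with
  | zero =>
    intro F hF hcard g i _ _
    have : ∀ s, ¬ Comp F s := by
      intro s hs
      have := chain_card rk hrk N hN _ (chain_insert hF hs)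
      rw [Finset.card_insert_of_notMem hs.1] at this
      omega
    have hm : {x ∈ dy g i | ¬ Marked ψ η F x} = ∅ := by
      ext x
      simp only [mem_ofPred_eq, mem_empty_iff_false, iff_false, not_and, not_not]
      intro _
      exact ⟨F, subset_rfl, hF, fun s h1 h2 => absurd h1 h2, fun s hs => absurd hs (this s)⟩
    rw [hm]; simp
  | succ k ih =>
    intro F hF hcard g i hJ hJs
    let Pd : ℕ → ℕ → Prop := fun g' i' => ∃ s, Comp F s ∧ ∀ y ∈ dy g' i', ψ y s < 1
    let Stop : ℕ × ℕ → Prop := fun p => p.2 / 2^p.1 = i ∧ Pd (g + p.1) p.2 ∧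
      ∀ m' < p.1, ¬ Pd (g + m') (p.2 / 2^(p.1 - m'))
    -- every unmarked point is in a stopping interval
    have hcov : {x ∈ dy g i | ¬ Marked ψ η F x} ⊆
        ⋃ p : {p // Stop p}, {x ∈ dy (g + p.1.1) p.1.2 | ¬ Marked ψ η F x} := by
      rintro x ⟨hxJ, hxM⟩
      have hx0 := dy_nonneg hxJ
      have hx1 := (mem_dy_iff hx0).1 hxJ
      have hex : ∃ s, Comp F s ∧ ψ x s < 1 := by
        by_contra hcon
        push Not at hcon
        exact hxM ⟨F, subset_rfl, hF, fun s h1 h2 => absurd h1 h2, hcon⟩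
      have hexm : ∃ m, Pd (g + m) ⌊x * 2^(g+m)⌋₊ := by
        obtain ⟨s, hs, hsx⟩ := hex
        have hc := hcont s x (hJ hxJ)
        have hev := hc.tendsto.eventually (gt_mem_nhds hsx)
        rw [eventually_nhdsWithin_iff, Metric.eventually_nhds_iff] at hev
        obtain ⟨δ, hδ, hδ'⟩ := hev
        obtain ⟨m, hm⟩ := exists_pow_lt_of_lt_one hδ (by norm_num : (1/2:ℝ) < 1)
        refine ⟨m, s, hs, fun y hy => ?_⟩
        have hym : y ∈ dy g i := by
          have := dy_sub_anc g m _ hy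
          rwa [floor_anc x hx0, hx1] at this
        refine hδ' ?_ (hJ hym)
        have hxm : x ∈ dy (g+m) ⌊x * 2^(g+m)⌋₊ := (mem_dy_iff hx0).2 rfl
        rw [dy] at hy hxm
        have hlen : (1:ℝ)/2^(g+m) < δ := by
          refine lt_of_le_of_lt ?_ hm
          rw [one_div, one_div, inv_pow]
          gcongr
          · norm_num
          · omega
        have e1 : ((⌊x * 2^(g+m)⌋₊:ℝ)+1) / 2^(g+m) = (⌊x * 2^(g+m)⌋₊:ℝ) / 2^(g+m) + 1/2^(g+m) := by ring
        rw [e1] at hy hxm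
        rw [Real.dist_eq, abs_lt]
        constructor <;> linarith [hy.1, hy.2, hxm.1, hxm.2]
      have hmin := Nat.find_spec hexm
      set m := Nat.find hexm with hm
      refine mem_iUnion.2 ⟨⟨(m, ⌊x * 2^(g+m)⌋₊), ?_, hmin, ?_⟩, (mem_dy_iff hx0).2 rfl, hxM⟩
      · simp only; rw [floor_anc x hx0, hx1]
      · intro m' hm'
        have h1 := Nat.find_min hexm hm'
        simp only at hm' ⊢
        have h2 := floor_anc x hx0 (g+m') (m-m')
        rw [show g + m' + (m-m') = g + m by omega] at h2
        rwa [h2]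
    -- bound on each stopping interval
    have hbd : ∀ p : {p // Stop p}, volume {x ∈ dy (g + p.1.1) p.1.2 | ¬ Marked ψ η F x} ≤
        ((4^(k+1) : ℕ) : ℝ≥0∞) * ε * volume (dy (g + p.1.1) p.1.2) := by
      rintro ⟨⟨m, i'⟩, hanc, ⟨s, hs, hsD⟩, hmin⟩
      simp only at hanc hsD hmin ⊢
      have hm : m ≠ 0 := by
        rintro rfl
        simp only [pow_zero, Nat.div_one] at hanc
        subst hanc
        obtain ⟨x, hx, hx'⟩ := hJs s hs
        exact absurd (hsD x hx) (not_lt.2 hx')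
      obtain ⟨m, rfl⟩ := Nat.exists_eq_succ_of_ne_zero hm
      have hpar := hmin m (Nat.lt_succ_self m)
      rw [show m + 1 - m = 1 by omega, pow_one] at hpar
      set ip := i' / 2 with hip
      have hDp : dy (g + (m+1)) i' ⊆ dy (g+m) ip := by
        have := dy_sub_anc (g+m) 1 i'
        rwa [pow_one] at this
      have hipi : ip / 2^m = i := by
        rw [hip, Nat.div_div_eq_div_mul, ← hanc, pow_succ, mul_comm]
      have hpJ : dy (g+m) ip ⊆ dy g i := by
        have := dy_sub_anc g m ip
        rwa [hipi] at this
      have hparent : ∀ t, Comp F t → ∃ x ∈ dy (g+m) ip, 1 ≤ ψ x t := by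
        intro t ht
        by_contra hcon
        push Not at hcon
        exact hpar ⟨t, ht, hcon⟩
      have hsub : {x ∈ dy (g + (m+1)) i' | ¬ Marked ψ η F x} ⊆
          {x ∈ dy (g+m) ip | ¬ Marked ψ η (insert s F) x} ∪ {x ∈ dy (g+m) ip | ψ x s < η} := by
        rintro x ⟨hxD, hxM⟩
        by_cases hη : ψ x s < η
        · exact Or.inr ⟨hDp hxD, hη⟩
        · refine Or.inl ⟨hDp hxD, fun hM => hxM ?_⟩
          obtain ⟨F', hFF', hch, hnew, hcomp⟩ := hM
          refine ⟨F', (Finset.subset_insert _ _).trans hFF', hch, fun t ht htF => ?_, hcomp⟩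
          by_cases hts : t = s
          · subst hts; exact ⟨not_lt.1 hη, (hsD x hxD).le⟩
          · exact hnew t ht (by simp [hts, htF])
      have h1 := ih (insert s F) (chain_insert hF hs)
        (by rw [Finset.card_insert_of_notMem hs.1]; omega) (g+m) ip (hpJ.trans hJ) (by
          intro t ht
          refine hparent t ⟨fun h => ht.1 (Finset.mem_insert_of_mem h), fun u hu => ht.2 u (Finset.mem_insert_of_mem hu)⟩)
      have h2 := hgood s (g+m) ip (hpJ.trans hJ) (hparent s hs)
      have hv : volume (dy (g+m) ip) = 2 * volume (dy (g+(m+1)) i') := by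
        rw [vol_dy, vol_dy, show (2:ℝ≥0∞) = ENNReal.ofReal 2 by simp,
          ← ENNReal.ofReal_mul (by norm_num)]
        congr 1
        rw [← add_assoc, pow_succ]; field_simp
      calc _ ≤ _ := measure_mono hsub
        _ ≤ _ := measure_union_le _ _
        _ ≤ _ := add_le_add h1 h2
        _ = ((4^k : ℕ) + 1 : ℝ≥0∞) * 2 * ε * volume (dy (g+(m+1)) i') := by rw [hv]; ring
        _ ≤ _ := by
          gcongr
          have h41 : 1 ≤ 4^k := Nat.one_le_pow _ _ (by norm_num)
          have : (4^k + 1) * 2 ≤ 4^(k+1) := by rw [pow_succ]; omega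
          exact_mod_cast this
    have hdisj : Pairwise (Function.onFun Disjoint fun p : {p // Stop p} => dy (g + p.1.1) p.1.2) := by
      have key : ∀ p q : ℕ × ℕ, Stop p → Stop q → p.1 ≤ q.1 → p ≠ q →
          Disjoint (dy (g + p.1) p.2) (dy (g + q.1) q.2) := by
        rintro ⟨m, i1⟩ ⟨m2, i2⟩ hp hq hle hne
        rw [Set.disjoint_left]
        intro y hy1 hy2
        simp only at hle hy1 hy2
        obtain ⟨m', rfl⟩ := Nat.exists_eq_add_of_le hle
        rw [← add_assoc] at hy2
        have h1 := dy_anc_unique hy2 hy1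
        rcases Nat.eq_zero_or_pos m' with rfl | hpos
        · simp at h1; subst h1; simp at hne
        · have := hq.2.2 m (by simpa using hpos)
          simp only [Nat.add_sub_cancel_left, h1] at this
          exact this hp.2.1
      intro p q hpq
      have hne : p.1 ≠ q.1 := fun h => hpq (Subtype.ext h)
      rcases le_total p.1.1 q.1.1 with h | h
      · exact key _ _ p.2 q.2 h hne
      · exact (key _ _ q.2 p.2 h hne.symm).symm
    calc _ ≤ _ := measure_mono hcov
      _ ≤ _ := measure_iUnion_le _
      _ ≤ _ := ENNReal.tsum_le_tsum hbd
      _ = ((4^(k+1) : ℕ) : ℝ≥0∞) * ε * ∑' p : {p // Stop p}, volume (dy (g + p.1.1) p.1.2) := ENNReal.tsum_mul_left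
      _ = ((4^(k+1) : ℕ) : ℝ≥0∞) * ε * volume (⋃ p : {p // Stop p}, dy (g + p.1.1) p.1.2) := by
          rw [measure_iUnion hdisj (fun p => meas_dy _ _)]
      _ ≤ _ := by
          gcongr
          refine iUnion_subset fun p => ?_
          have := dy_sub_anc g p.1.1 p.1.2
          rwa [p.2.1] at this
end qnd

section qnd2
variable {κ : Type} [Fintype κ] [Nonempty κ]

/-- marked points have no short vectors -/
lemma marked_no_short (h : ℝ → Matrix κ κ ℝ) (η : ℝ) (hη1 : η ≤ 1) (x : ℝ)
    (hM : Marked (P := {V : Submodule ℚ (κ → ℚ) // V ≠ ⊥}) (fun x V => psi (h x) V.1) η ∅ x)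
    (v : κ → ℤ) (hv : v ≠ 0) (M : ℝ) (hvM : ∀ k, |hvec (h x) v k| ≤ M) :
    η ≤ Fintype.card κ * M := by
  classical
  obtain ⟨F, -, hch, hnew, hcomp⟩ := hM
  have hqv : qv v ≠ 0 := by
    intro h0; apply hv; funext k
    have := congrFun h0 k
    simpa [qv] using this
  -- the largest element not containing v
  obtain ⟨V, hV1, hVv, hVmax⟩ : ∃ V : Submodule ℚ (κ → ℚ), psi (h x) V ≤ 1 ∧ qv v ∉ V ∧
      ∀ s ∈ F, (s.1 ≤ V ∨ (qv v ∈ s.1 ∧ V ≤ s.1)) := by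
    by_cases hne : (F.filter fun s => qv v ∉ s.1).Nonempty
    · obtain ⟨s, hs, hsmax⟩ := Finset.exists_max_image (F.filter fun s => qv v ∉ s.1)
        (fun s : {V : Submodule ℚ (κ → ℚ) // V ≠ ⊥} => Module.finrank ℚ s.1) hne
      rw [Finset.mem_filter] at hs
      refine ⟨s.1, (hnew s hs.1 (by simp)).2, hs.2, fun t ht => ?_⟩
      by_cases hvt : qv v ∈ t.1
      · refine Or.inr ⟨hvt, ?_⟩
        rcases eq_or_ne s t with rfl | hst
        · exact le_rfl
        rcases hch hs.1 ht hst with h1 | h1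
        · exact h1
        · exact absurd (h1 hvt) hs.2
      · left
        rcases eq_or_ne t s with rfl | hst
        · exact le_rfl
        rcases hch ht hs.1 hst with h1 | h1
        · exact h1
        · have h2 := hsmax t (Finset.mem_filter.2 ⟨ht, hvt⟩)
          have := Submodule.eq_of_le_of_finrank_le h1 h2
          exact this.ge
    · refine ⟨⊥, (psi_bot (h x)).le, by simpa using hqv, fun t ht => Or.inr ⟨?_, bot_le⟩⟩
      by_contra hvt
      exact hne ⟨t, Finset.mem_filter.2 ⟨ht, hvt⟩⟩
  have hD0 : V ⊔ Submodule.span ℚ {qv v} ≠ ⊥ := by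
    intro h0
    have : qv v ∈ V ⊔ Submodule.span ℚ {qv v} :=
      (le_sup_right : Submodule.span ℚ {qv v} ≤ _) (Submodule.mem_span_singleton_self _)
    rw [h0] at this
    exact hqv (by simpa using this)
  have hcmp : ∀ t ∈ F, (⟨_, hD0⟩ : {V : Submodule ℚ (κ → ℚ) // V ≠ ⊥}) ≤ t ∨ t ≤ ⟨_, hD0⟩ := by
    intro t ht
    rcases hVmax t ht with h1 | ⟨h1, h2⟩
    · right; exact h1.trans le_sup_left
    · left
      refine sup_le h2 ?_
      rw [Submodule.span_le]; simpa using h1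
  have hψ : η ≤ psi (h x) (V ⊔ Submodule.span ℚ {qv v}) := by
    by_cases hmem : (⟨_, hD0⟩ : {V : Submodule ℚ (κ → ℚ) // V ≠ ⊥}) ∈ F
    · exact (hnew _ hmem (by simp)).1
    · exact hη1.trans (hcomp ⟨_, hD0⟩ ⟨hmem, hcmp⟩)
  have hM0 : 0 ≤ M := (abs_nonneg _).trans (hvM (Classical.arbitrary κ))
  refine hψ.trans ((psi_sup (h x) V v hVv M hvM).trans ?_)
  have : 0 ≤ (Fintype.card κ : ℝ) * M := by positivity
  nlinarith

theorem qnd_final (h : ℝ → Matrix κ κ ℝ) (η : ℝ) (hη1 : η ≤ 1)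
    (hcont : ∀ k l, ContinuousOn (fun x => h x k l) (Icc 0 1)) (ε : ℝ≥0∞)
    (hgood : ∀ V : Submodule ℚ (κ → ℚ), V ≠ ⊥ → ∀ g i, dy g i ⊆ Icc 0 1 → (∃ x ∈ dy g i, 1 ≤ psi (h x) V) →
      volume {x ∈ dy g i | psi (h x) V < η} ≤ ε * volume (dy g i))
    (g i : ℕ) (hJ : dy g i ⊆ Icc 0 1)
    (hsup : ∀ V : Submodule ℚ (κ → ℚ), V ≠ ⊥ → ∃ x ∈ dy g i, 1 ≤ psi (h x) V) :
    volume {x ∈ dy g i | ∃ v : κ → ℤ, v ≠ 0 ∧ ∃ M, Fintype.card κ * M < η ∧ ∀ k, |hvec (h x) v k| ≤ M} ≤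
      ((4^(Fintype.card κ) : ℕ) : ℝ≥0∞) * ε * volume (dy g i) := by
  have hpc : ∀ V : Submodule ℚ (κ → ℚ), ContinuousOn (fun x => psi (h x) V) (Icc 0 1) := by
    intro V
    have h1 : ∀ I, ContinuousOn (fun x => |tmin (h x) (AV V) I|) (Icc 0 1) := by
      intro I
      apply ContinuousOn.abs
      simp only [tmin, Matrix.det_apply, hvec, Matrix.mulVec, dotProduct, Matrix.of_apply]
      fun_prop
    have h2 : ∀ x, psi (h x) V = Finset.univ.sup' Finset.univ_nonempty
        (fun I => |tmin (h x) (AV V) I|) := by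
      intro x; rw [Finset.sup'_univ_eq_ciSup]; rfl
    simp only [h2]
    exact ContinuousOn.finset_sup'_apply _ (fun I _ => h1 I)
  refine le_trans (measure_mono ?_) (qnd (P := {V : Submodule ℚ (κ → ℚ) // V ≠ ⊥})
    (fun V => Module.finrank ℚ V.1) ?_ (Fintype.card κ) ?_ (fun x V => psi (h x) V.1)
    (fun s => hpc s.1) η ε (fun s => hgood s.1 s.2) (Fintype.card κ) ∅ (by simp) (by simp) g i hJ
    (fun s _ => hsup s.1 s.2))
  · rintro x ⟨hx, v, hv, M, hMη, hvM⟩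
    refine ⟨hx, fun hmk => ?_⟩
    exact absurd (marked_no_short h η hη1 x hmk v hv M hvM) (not_le.2 hMη)
  · intro s t hst
    exact Submodule.finrank_lt_finrank_of_lt hst
  · intro s
    refine ⟨Nat.one_le_iff_ne_zero.2 fun h0 => s.2 (Submodule.finrank_eq_zero.1 h0), ?_⟩
    have := Submodule.finrank_le s.1
    simpa using this
end qnd2
end Part3

section Part4
open MeasureTheory Set

section minors
variable {κ : Type} [Fintype κ]

/-- minors of a family of rows -/
noncomputable def mi {j : ℕ} (R : κ → Fin j → ℝ) (I : Fin j → κ) : ℝ :=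
  Matrix.det (Matrix.of fun a b => R (I a) b)

lemma mi_update [DecidableEq κ] {j : ℕ} (R : κ → Fin j → ℝ) (I : Fin j → κ) (a : Fin j) (k : κ) :
    mi R (Function.update I a k) = ((Matrix.of fun a b => R (I a) b).updateRow a (R k)).det := by
  rw [mi]; congr 1
  ext a' b
  by_cases h : a' = a
  · subst h; simp
  · simp [Matrix.updateRow_ne h, Function.update_of_ne h]

lemma mi_cramer [DecidableEq κ] {j : ℕ} (R : κ → Fin j → ℝ) (I : Fin j → κ) (k : κ) (b : Fin j) :
    ∑ a, mi R (Function.update I a k) * R (I a) b = mi R I * R k b := by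
  have h := congrFun (Matrix.mulVec_cramer (Matrix.of fun a b => R (I a) b).transpose (R k)) b
  rw [Matrix.det_transpose, Pi.smul_apply, smul_eq_mul] at h
  rw [mi, ← h, Matrix.mulVec, dotProduct]
  refine Finset.sum_congr rfl fun a _ => ?_
  rw [Matrix.cramer_transpose_apply, ← mi_update, mul_comm]; rfl

lemma mi_of_not_inj {j : ℕ} (R : κ → Fin j → ℝ) (I : Fin j → κ) (hI : ¬ Function.Injective I) :
    mi R I = 0 := by
  simp only [Function.Injective, not_forall] at hI
  obtain ⟨a, a', h, hne⟩ := hI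
  exact Matrix.det_zero_of_row_eq hne (by ext b; simp [h])

lemma exists_mi_ne {j : ℕ} (R : κ → Fin j → ℝ)
    (hR : ∀ z : Fin j → ℝ, (∀ k, ∑ b, z b * R k b = 0) → z = 0) :
    ∃ I : Fin j → κ, mi R I ≠ 0 := by
  classical
  let M : Matrix (Fin j) κ ℝ := Matrix.of fun b k => R k b
  have hli : LinearIndependent ℝ (fun b => (M b : κ → ℝ)) := by
    rw [Fintype.linearIndependent_iff]
    intro g hg
    have := hR g (fun k => by
      have := congrFun hg k
      simpa [M] using this)
    intro i; rw [this]; rfl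
  have hrank : M.rank = j := by
    have := LinearIndependent.rank_matrix (M := M) hli
    simpa using this
  have hcol : Module.finrank ℝ (Submodule.span ℝ (range M.col)) = j := by
    exact (Matrix.rank_eq_finrank_span_cols M).symm.trans hrank
  obtain ⟨I, hI⟩ : ∃ I : Fin j → κ, LinearIndependent ℝ (fun a => M.col (I a)) := by
    obtain ⟨s, hs1, hs2, hs3⟩ := exists_linearIndependent ℝ (range M.col)
    have hsf : s.Finite := (Set.finite_range _).subset hs1
    haveI := hsf.fintype
    have hcard : Fintype.card s = j := by
      refine Eq.trans ?_ hcol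
      rw [← hs2]
      exact (finrank_span_set_eq_card hs3 |>.trans (by simp)).symm
    let e : Fin j ≃ s := (Fintype.equivFinOfCardEq hcard).symm
    choose I hI using fun a => hs1 (e a).2
    have hcomp : LinearIndependent ℝ (fun a => ((e a : s) : Fin j → ℝ)) := hs3.comp e e.injective
    have heq : (fun a => M.col (I a)) = fun a => ((e a : s) : Fin j → ℝ) := funext hI
    exact ⟨I, heq ▸ hcomp⟩
  refine ⟨I, ?_⟩
  have : LinearIndependent ℝ (Matrix.of fun a b => R (I a) b).row := hI
  rw [Matrix.linearIndependent_rows_iff_isUnit, Matrix.isUnit_iff_isUnit_det] at this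
  exact this.ne_zero

/-- Minkowski for a square matrix. -/
lemma minkowski_sq {j : ℕ} (hj : 1 ≤ j) (B : Matrix (Fin j) (Fin j) ℝ) (c : ℝ) (hc : 0 < c)
    (hB : B.det ≠ 0) (hcB : |B.det| ≤ c ^ j) :
    ∃ z : Fin j → ℤ, z ≠ 0 ∧ ∀ a, |∑ b, B a b * z b| ≤ c := by
  haveI : Nonempty (Fin j) := ⟨⟨0, hj⟩⟩
  have hli : LinearIndependent ℝ B.transpose := by
    have : LinearIndependent ℝ B.transpose.row := by
      rw [Matrix.linearIndependent_rows_iff_isUnit, Matrix.isUnit_iff_isUnit_det,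
        Matrix.det_transpose]
      exact isUnit_iff_ne_zero.2 hB
    exact this
  let bs := basisOfLinearIndependentOfCardEqFinrank hli (by simp)
  have hbs : ⇑bs = B.transpose := coe_basisOfLinearIndependentOfCardEqFinrank _ _
  have fund := ZSpan.isAddFundamentalDomain' bs (volume : Measure (Fin j → ℝ))
  have hvol : volume (ZSpan.fundamentalDomain bs) = ENNReal.ofReal |B.det| := by
    rw [ZSpan.volume_fundamentalDomain]
    congr 2
    rw [hbs]
    exact Matrix.det_transpose B
  haveI : Countable (Submodule.span ℤ (range bs)).toAddSubgroup :=
    inferInstanceAs (Countable (Submodule.span ℤ (range bs)))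
  haveI : DiscreteTopology (Submodule.span ℤ (range bs)).toAddSubgroup :=
    inferInstanceAs (DiscreteTopology (Submodule.span ℤ (range bs)))
  obtain ⟨x, hx0, hx⟩ := exists_ne_zero_mem_lattice_of_measure_mul_two_pow_le_measure
    (s := Metric.closedBall (0 : Fin j → ℝ) c) fund
    (by intro x hx; simpa using hx) (convex_closedBall _ _) (isCompact_closedBall _ _)
    (by
      rw [hvol, Real.volume_pi_closedBall _ hc.le]
      rw [Module.finrank_fintype_fun_eq_card, Fintype.card_fin]
      rw [show ((2:ENNReal)^j) = ENNReal.ofReal (2^j) by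
        rw [ENNReal.ofReal_pow (by norm_num)]; norm_num]
      rw [← ENNReal.ofReal_mul (abs_nonneg _)]
      apply ENNReal.ofReal_le_ofReal
      rw [mul_pow, mul_comm]
      gcongr)
  have hxm : (x : Fin j → ℝ) ∈ Submodule.span ℤ (range bs) := x.2
  rw [Submodule.mem_span_range_iff_exists_fun] at hxm
  obtain ⟨z, hz⟩ := hxm
  have hzx : ∀ a, ∑ b, B a b * z b = (x : Fin j → ℝ) a := by
    intro a
    rw [← hz, Finset.sum_apply]
    refine Finset.sum_congr rfl fun b _ => ?_
    rw [hbs, Pi.smul_apply, zsmul_eq_mul, mul_comm]; rfl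
  refine ⟨z, ?_, fun a => ?_⟩
  · rintro rfl
    apply hx0
    ext a
    rw [← hzx a]; simp
  · rw [hzx a]
    rw [mem_closedBall_zero_iff] at hx
    exact (norm_le_pi_norm (x : Fin j → ℝ) a).trans hx

lemma minkowski_mi {j : ℕ} (hj : 1 ≤ j) (R : κ → Fin j → ℝ)
    (hR : ∀ z : Fin j → ℝ, (∀ k, ∑ b, z b * R k b = 0) → z = 0)
    (c : ℝ) (hc : 0 < c) (hcB : ∀ I, |mi R I| ≤ c ^ j) :
    ∃ z : Fin j → ℤ, z ≠ 0 ∧ ∀ k, |∑ b, R k b * z b| ≤ j * c := by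
  classical
  obtain ⟨I0, hI0⟩ := exists_mi_ne R hR
  haveI : Nonempty (Fin j → κ) := ⟨I0⟩
  obtain ⟨I, hI⟩ := Finite.exists_max (fun I => |mi R I|)
  have hpos : 0 < |mi R I| := lt_of_lt_of_le (abs_pos.2 hI0) (hI I0)
  obtain ⟨z, hz0, hz⟩ := minkowski_sq hj (Matrix.of fun a b => R (I a) b) c hc
    (abs_pos.1 hpos) (hcB I)
  refine ⟨z, hz0, fun k => ?_⟩
  have key : mi R I * (∑ b, R k b * z b) =
      ∑ a, mi R (Function.update I a k) * ∑ b, R (I a) b * z b := by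
    rw [Finset.mul_sum]
    simp_rw [Finset.mul_sum]
    rw [Finset.sum_comm]
    refine Finset.sum_congr rfl fun b _ => ?_
    rw [← mul_assoc, ← mi_cramer, Finset.sum_mul]
    refine Finset.sum_congr rfl fun a _ => by ring
  have h2 : |mi R I| * |∑ b, R k b * z b| ≤ |mi R I| * (j * c) := by
    rw [← abs_mul, key]
    refine (Finset.abs_sum_le_sum_abs _ _).trans ?_
    refine (Finset.sum_le_card_nsmul _ _ (|mi R I| * c) fun a _ => ?_).trans ?_
    · rw [abs_mul]
      exact mul_le_mul (hI _) (hz a) (abs_nonneg _) (abs_nonneg _)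
    · simp; apply le_of_eq; ring
  exact le_of_mul_le_mul_left h2 hpos

lemma tmin_eq_mi (h : Matrix κ κ ℝ) {j : ℕ} (A : Fin j → κ → ℤ) (I : Fin j → κ) :
    tmin h A I = mi (fun k b => hvec h (A b) k) I := rfl

lemma tup_real_indep {V : Submodule ℚ (κ → ℚ)} {j : ℕ}
    {A : Fin j → κ → ℤ} (hA : TupIn V A) (z : Fin j → ℝ)
    (hz : ∀ k, ∑ b, z b * (A b k : ℝ) = 0) : z = 0 := by
  classical
  obtain ⟨I, hI⟩ := exists_tmin_one_ne hA
  refine Matrix.eq_zero_of_mulVec_eq_zero hI (v := z) ?_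
  ext a
  have := hz (I a)
  simp only [Matrix.mulVec, dotProduct, hvec, Matrix.of_apply, Pi.zero_apply]
  rw [← this]
  refine Finset.sum_congr rfl fun b _ => ?_
  rw [mul_comm]
  congr 1
  simp [Matrix.one_apply]

/-- Minkowski in the form used later -/
lemma minkowski_tup {V : Submodule ℚ (κ → ℚ)} {j : ℕ} (hj : 1 ≤ j)
    {A : Fin j → κ → ℤ} (hA : TupIn V A) (h : Matrix κ κ ℝ)
    (hinj : ∀ w : κ → ℝ, h.mulVec w = 0 → w = 0)
    (c : ℝ) (hc : 0 < c) (hcB : ∀ I, |tmin h A I| ≤ c ^ j) :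
    ∃ v : κ → ℤ, v ≠ 0 ∧ ∀ k, |hvec h v k| ≤ j * c := by
  have hlin : ∀ (z : Fin j → ℝ) (k : κ), ∑ b, z b * hvec h (A b) k =
      h.mulVec (fun l => ∑ b, z b * (A b l : ℝ)) k := by
    intro z k
    simp only [hvec, Matrix.mulVec, dotProduct, Finset.mul_sum]
    rw [Finset.sum_comm]
    refine Finset.sum_congr rfl fun b _ => Finset.sum_congr rfl fun l _ => by ring
  obtain ⟨z, hz0, hz⟩ := minkowski_mi hj (fun k b => hvec h (A b) k) (by
    intro z hz
    apply tup_real_indep hA z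
    intro k
    have : (fun l => ∑ b, z b * (A b l : ℝ)) = 0 := by
      apply hinj
      ext k
      rw [← hlin z k]; exact hz k
    exact congrFun this k) c hc hcB
  refine ⟨fun l => ∑ b, z b * A b l, ?_, fun k => ?_⟩
  · intro h0
    apply hz0
    have := tup_real_indep hA (fun b => (z b : ℝ)) (fun k => by
      have := congrFun h0 k
      simp only [Pi.zero_apply] at this
      exact_mod_cast this)
    ext b
    have := congrFun this b
    simpa using this
  · have := hz k
    convert this using 2
    have h3 := hlin (fun b => (z b : ℝ)) k
    simp only [hvec] at h3 ⊢
    push_cast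
    rw [← h3]
    refine Finset.sum_congr rfl fun b _ => by ring

/-- Plücker-type inequality -/
lemma pluecker [DecidableEq κ] {j : ℕ} (R : κ → Fin j → ℝ) (r0 r1 : κ) (h01 : r0 ≠ r1) (Y0 Y1 : ℝ)
    (hY0 : ∀ I : Fin j → κ, (∃ a, I a = r0) → (∀ a, I a ≠ r1) → |mi R I| ≤ Y0)
    (hY1 : ∀ I : Fin j → κ, (∃ a, I a = r1) → (∀ a, I a ≠ r0) → |mi R I| ≤ Y1)
    (S I : Fin j → κ) (hS0 : ∀ a, S a ≠ r0) (hS1 : ∀ a, S a ≠ r1)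
    (hI0 : ∃ a, I a = r0) (hI1 : ∃ a, I a = r1) :
    |mi R S| * |mi R I| ≤ (j.factorial : ℝ) * Y0 * Y1 := by
  by_cases hinj : Function.Injective I
  swap
  · rw [mi_of_not_inj R I hinj, abs_zero, mul_zero]
    obtain ⟨a0, ha0⟩ := hI0
    have hj : 0 < j := a0.pos
    have h0 := hY0 (Function.update S a0 r0) ⟨a0, by simp⟩ (by
      intro a; by_cases h : a = a0
      · subst h; simpa using h01
      · rw [Function.update_of_ne h]; exact hS1 a)
    have h1 := hY1 (Function.update S a0 r1) ⟨a0, by simp⟩ (by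
      intro a; by_cases h : a = a0
      · subst h; simpa using h01.symm
      · rw [Function.update_of_ne h]; exact hS0 a)
    have := (abs_nonneg _).trans h0
    have := (abs_nonneg _).trans h1
    positivity
  obtain ⟨a0, ha0⟩ := hI0
  obtain ⟨a1, ha1⟩ := hI1
  have ha01 : a0 ≠ a1 := by rintro rfl; exact h01 (ha0.symm.trans ha1)
  -- maximal S
  let 𝒮 := {S : Fin j → κ // (∀ a, S a ≠ r0) ∧ (∀ a, S a ≠ r1)}
  haveI : Nonempty 𝒮 := ⟨⟨S, hS0, hS1⟩⟩
  obtain ⟨⟨T, hT0, hT1⟩, hT⟩ := Finite.exists_max (fun S : 𝒮 => |mi R S.1|)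
  have hTS : |mi R S| ≤ |mi R T| := hT ⟨S, hS0, hS1⟩
  refine (mul_le_mul_of_nonneg_right hTS (abs_nonneg _)).trans ?_
  have hu0 : ∀ c, |mi R (Function.update T c r0)| ≤ Y0 := fun c =>
    hY0 _ ⟨c, by simp⟩ (by
      intro a; by_cases h : a = c
      · subst h; simpa using h01
      · rw [Function.update_of_ne h]; exact hT1 a)
  have hu1 : ∀ c, |mi R (Function.update T c r1)| ≤ Y1 := fun c =>
    hY1 _ ⟨c, by simp⟩ (by
      intro a; by_cases h : a = c
      · subst h; simpa using h01.symm
      · rw [Function.update_of_ne h]; exact hT0 a)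
  have hY0' : 0 ≤ Y0 := (abs_nonneg _).trans (hu0 a0)
  have hY1' : 0 ≤ Y1 := (abs_nonneg _).trans (hu1 a0)
  by_cases hTz : mi R T = 0
  · rw [hTz, abs_zero, zero_mul]; positivity
  have hTpos : 0 < |mi R T| := abs_pos.2 hTz
  set D := |mi R T| with hD
  let G : Matrix (Fin j) (Fin j) ℝ := Matrix.of fun a c => mi R (Function.update T c (I a))
  -- G * T = mi T • I
  have hG : G * (Matrix.of fun c b => R (T c) b) = mi R T • (Matrix.of fun a b => R (I a) b) := by
    ext a b
    rw [Matrix.mul_apply, Matrix.smul_apply, smul_eq_mul]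
    exact mi_cramer R T (I a) b
  have hdet : |G.det| = D ^ (j - 1) * |mi R I| := by
    have := congrArg Matrix.det hG
    rw [Matrix.det_mul, Matrix.det_smul, Fintype.card_fin] at this
    have h2 : G.det * mi R T = mi R T ^ j * mi R I := this
    have h3 : |G.det| * D = D ^ j * |mi R I| := by
      rw [hD, ← abs_mul, h2, abs_mul, abs_pow]
    have hj : j = (j - 1) + 1 := by have := a0.pos; omega
    have hp : D ^ j = D ^ (j-1) * D := by rw [← pow_succ, ← hj]
    have h4 : |G.det| * D = (D ^ (j-1) * |mi R I|) * D := by rw [h3, hp]; ring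
    exact mul_right_cancel₀ hTpos.ne' h4
  let w : Fin j → ℝ := fun a => if a = a0 then Y0 else if a = a1 then Y1 else D
  have hw : ∀ a c, |G a c| ≤ w a := by
    intro a c
    simp only [w, G, Matrix.of_apply]
    split_ifs with h1 h2
    · rw [h1, ha0]; exact hu0 c
    · rw [h2, ha1]; exact hu1 c
    · have hne0 : I a ≠ r0 := fun h => h1 (hinj (h.trans ha0.symm))
      have hne1 : I a ≠ r1 := fun h => h2 (hinj (h.trans ha1.symm))
      refine hT ⟨Function.update T c (I a), fun a' => ?_, fun a' => ?_⟩
      · by_cases h : a' = c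
        · subst h; simpa using hne0
        · rw [Function.update_of_ne h]; exact hT0 a'
      · by_cases h : a' = c
        · subst h; simpa using hne1
        · rw [Function.update_of_ne h]; exact hT1 a'
  have hprod : ∏ a, w a = Y0 * Y1 * D ^ (j - 2) := by
    rw [← Finset.mul_prod_erase Finset.univ w (Finset.mem_univ a0),
      ← Finset.mul_prod_erase _ w (Finset.mem_erase.2 ⟨ha01.symm, Finset.mem_univ a1⟩)]
    rw [Finset.prod_congr rfl (g := fun _ => D)]
    · rw [Finset.prod_const, Finset.card_erase_of_mem
        (Finset.mem_erase.2 ⟨ha01.symm, Finset.mem_univ a1⟩), Finset.card_erase_of_mem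
        (Finset.mem_univ a0)]
      simp only [w, if_true, if_neg ha01.symm, Finset.card_univ, Fintype.card_fin]
      rw [show j - 1 - 1 = j - 2 by omega]; ring
    · intro a ha
      simp only [Finset.mem_erase, Finset.mem_univ, and_true] at ha
      simp [w, ha.1, ha.2]
  have hdetle : |G.det| ≤ (j.factorial : ℝ) * (Y0 * Y1 * D ^ (j-2)) := by
    rw [Matrix.det_apply, ← hprod]
    refine (Finset.abs_sum_le_sum_abs _ _).trans ?_
    refine (Finset.sum_le_card_nsmul _ _ (∏ a, w a) fun σ _ => ?_).trans ?_
    · rw [Units.smul_def, zsmul_eq_mul, abs_mul]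
      have : |((Equiv.Perm.sign σ : ℤˣ) : ℤ)| = 1 := Int.isUnit_iff_abs_eq.1 (Units.isUnit _)
      rw [← Int.cast_abs, this, Int.cast_one, one_mul, Finset.abs_prod]
      rw [← Equiv.prod_comp σ w]
      exact Finset.prod_le_prod (fun _ _ => abs_nonneg _) fun a _ => hw _ _
    · simp [Fintype.card_perm]
  rw [hdet] at hdetle
  have hj2 : j - 1 = (j - 2) + 1 := by
    have h0 := a0.2; have h1 := a1.2
    have : (a0:ℕ) ≠ a1 := fun h => ha01 (Fin.ext h)
    omega
  rw [hj2, pow_succ] at hdetle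
  have hDp : 0 < D ^ (j-2) := by positivity
  have : D^(j-2) * (D * |mi R I|) ≤ D^(j-2) * ((j.factorial:ℝ) * Y0 * Y1) := by
    calc _ = D^(j-2) * D * |mi R I| := by ring
      _ ≤ _ := hdetle
      _ = _ := by ring
  exact le_of_mul_le_mul_left this hDp

end minors
end Part4

section Part5
open MeasureTheory Set

section rows
variable {κ : Type} [Fintype κ] [DecidableEq κ]

lemma hvec_diag (s : κ → ℝ) (h : Matrix κ κ ℝ) (v : κ → ℤ) (k : κ) :
    hvec (Matrix.diagonal s * h) v k = s k * hvec h v k := by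
  simp only [hvec, ← Matrix.mulVec_mulVec, Matrix.mulVec_diagonal]

lemma tmin_diag (s : κ → ℝ) (h : Matrix κ κ ℝ) {j : ℕ} (A : Fin j → κ → ℤ) (I : Fin j → κ) :
    tmin (Matrix.diagonal s * h) A I = (∏ a, s (I a)) * tmin h A I := by
  rw [tmin, tmin, ← Matrix.det_mul_column]
  congr 1
  ext a b
  simp [hvec_diag]

/-- determinant with row `a0` replaced by the row `l` of `A` -/
noncomputable def rowdet (h : Matrix κ κ ℝ) {j : ℕ} (A : Fin j → κ → ℤ) (I : Fin j → κ)
    (a0 : Fin j) (l : κ) : ℝ :=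
  ((Matrix.of fun a b => hvec h (A b) (I a)).updateRow a0 (fun b => (A b l : ℝ))).det

lemma det_row_expand {j : ℕ} (N : Matrix (Fin j) (Fin j) ℝ) (a0 : Fin j) (c : κ → ℝ)
    (u : κ → Fin j → ℝ) :
    (N.updateRow a0 (fun b => ∑ l, c l * u l b)).det = ∑ l, c l * (N.updateRow a0 (u l)).det := by
  rw [← Matrix.cramer_transpose_apply]
  simp_rw [← Matrix.cramer_transpose_apply]
  have : (fun b => ∑ l, c l * u l b) = ∑ l, c l • u l := by ext b; simp
  rw [this, map_sum, Finset.sum_apply]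
  simp

lemma tmin_expand (h : Matrix κ κ ℝ) {j : ℕ} (A : Fin j → κ → ℤ) (I : Fin j → κ) (a0 : Fin j)
    (k : κ) : tmin h A (Function.update I a0 k) = ∑ l, h k l * rowdet h A I a0 l := by
  rw [tmin_eq_mi, mi_update]
  exact det_row_expand _ a0 (fun l => h k l) (fun l b => (A b l : ℝ))

lemma rowdet_unit (h : Matrix κ κ ℝ) {j : ℕ} (A : Fin j → κ → ℤ) (I : Fin j → κ) (a0 : Fin j)
    (k : κ) (hk : ∀ l, h k l = if l = k then 1 else 0) :
    rowdet h A I a0 k = tmin h A (Function.update I a0 k) := by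
  rw [tmin_expand]; simp [hk]

lemma rowdet_one (h : Matrix κ κ ℝ) {j : ℕ} (A : Fin j → κ → ℤ) (I : Fin j → κ) (a0 : Fin j)
    (l : κ) (hu : ∀ a, a ≠ a0 → ∀ l, h (I a) l = if l = I a then 1 else 0) :
    rowdet h A I a0 l = tmin 1 A (Function.update I a0 l) := by
  rw [rowdet, tmin]
  congr 1
  ext a b
  by_cases ha : a = a0
  · subst ha; simp [hvec]
  · rw [Matrix.updateRow_ne ha]
    simp only [Matrix.of_apply, Function.update_of_ne ha, hvec, Matrix.one_mulVec]
    simp [Matrix.mulVec, dotProduct, hu a ha]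

lemma tmin_full (h : Matrix κ κ ℝ) {j : ℕ} (A : Fin j → κ → ℤ) (I : Fin j → κ)
    (hI : Function.Bijective I) : tmin h A I = h.det * tmin 1 A I := by
  let e := Equiv.ofBijective I hI
  rw [← Matrix.det_submatrix_equiv_self e h, tmin, tmin, ← Matrix.det_mul]
  congr 1
  ext a b
  simp only [Matrix.of_apply, Matrix.mul_apply, Matrix.submatrix_apply, hvec, Matrix.one_mulVec]
  simp only [Matrix.mulVec, dotProduct]
  exact (Equiv.sum_comp e (fun l => h (I a) l * (A b l : ℝ))).symm

lemma tmin_inj (h : Matrix κ κ ℝ) {j : ℕ} (A : Fin j → κ → ℤ) (I : Fin j → κ)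
    (hI : tmin h A I ≠ 0) : Function.Injective I := by
  by_contra hc
  exact hI (by rw [tmin_eq_mi]; exact mi_of_not_inj _ _ hc)

lemma tmin_one_ge {j : ℕ} (A : Fin j → κ → ℤ) (I : Fin j → κ)
    (hI : tmin (1 : Matrix κ κ ℝ) A I ≠ 0) : 1 ≤ |tmin (1 : Matrix κ κ ℝ) A I| := by
  rw [tmin_one_int] at hI ⊢
  have : (Matrix.of fun a b => A b (I a)).det ≠ 0 := by exact_mod_cast hI
  exact_mod_cast Int.one_le_abs this
end rows

section curve
variable {ι : Type} [Fintype ι] [DecidableEq ι]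

/-- the matrix of the curve -/
noncomputable def Mx (f f1 : ι → ℝ → ℝ) (i1 : ι) (x : ℝ) : Matrix (Option ι) (Option ι) ℝ :=
  Matrix.of fun k l => k.elim (l.elim 1 fun i => f i x) fun k =>
    if k = i1 then l.elim 0 (fun i => f1 i x) else if l = some k then 1 else 0

variable {f f1 f2 : ι → ℝ → ℝ} {i1 : ι} {x : ℝ}

@[simp] lemma Mx_nn : Mx f f1 i1 x none none = 1 := rfl
@[simp] lemma Mx_ns (i : ι) : Mx f f1 i1 x none (some i) = f i x := rfl
@[simp] lemma Mx_1n : Mx f f1 i1 x (some i1) none = 0 := by simp [Mx]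
@[simp] lemma Mx_1s (i : ι) : Mx f f1 i1 x (some i1) (some i) = f1 i x := by simp [Mx]
lemma Mx_u (k : ι) (hk : k ≠ i1) (l : Option ι) :
    Mx f f1 i1 x (some k) l = if l = some k then 1 else 0 := by simp [Mx, hk]
lemma Mx_u' (k : Option ι) (hk0 : k ≠ none) (hk : k ≠ some i1) (l : Option ι) :
    Mx f f1 i1 x k l = if l = k then 1 else 0 := by
  cases k with
  | none => exact absurd rfl hk0
  | some k => exact Mx_u k (fun h => hk (by rw [h])) l

lemma hvec_n (v : Option ι → ℤ) :
    hvec (Mx f f1 i1 x) v none = v none + ∑ i, f i x * v (some i) := by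
  simp [hvec, Matrix.mulVec, dotProduct, Fintype.sum_option]
lemma hvec_1 (v : Option ι → ℤ) :
    hvec (Mx f f1 i1 x) v (some i1) = ∑ i, f1 i x * v (some i) := by
  simp [hvec, Matrix.mulVec, dotProduct, Fintype.sum_option]
lemma hvec_u (v : Option ι → ℤ) (k : ι) (hk : k ≠ i1) :
    hvec (Mx f f1 i1 x) v (some k) = v (some k) := by
  simp [hvec, Matrix.mulVec, dotProduct, Mx_u k hk]

lemma Mx_det : (Mx f f1 i1 x).det = f1 i1 x := by
  set N : Matrix (Option ι) (Option ι) ℝ :=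
    (1 : Matrix (Option ι) (Option ι) ℝ).updateRow (some i1) (Mx f f1 i1 x (some i1)) with hN
  have hNdet : N.det = f1 i1 x := by
    have := Matrix.cramer_transpose_apply (1 : Matrix (Option ι) (Option ι) ℝ)
      (Mx f f1 i1 x (some i1)) (some i1)
    rw [hN, ← this]; simp
  have hM : Mx f f1 i1 x = N.updateRow none (Mx f f1 i1 x none) := by
    ext k l
    cases k with
    | none => simp
    | some k =>
      rw [Matrix.updateRow_ne (by simp), hN]
      by_cases hk : k = i1
      · subst hk; simp
      · rw [Matrix.updateRow_ne (by simpa using hk), Mx_u k hk, Matrix.one_apply]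
        simp only [eq_comm]
  have hrow : Mx f f1 i1 x none = ∑ l, Mx f f1 i1 x none l • (Pi.single l (1:ℝ)) := by
    ext l; simp [Finset.sum_apply, Pi.single_apply]
  rw [hM, hrow, ← Matrix.cramer_transpose_apply, map_sum, Finset.sum_apply]
  simp only [Matrix.cramer_transpose_apply]
  rw [Finset.sum_eq_single none]
  · rw [Mx_nn, one_smul, ← hNdet]
    congr 1
    ext k l
    cases k with
    | none => simp [hN, Matrix.one_apply, Pi.single_apply, eq_comm]
    | some k => rw [Matrix.updateRow_ne (by simp)]
  · intro l _ hl
    rw [Matrix.det_eq_zero_of_column_eq_zero none]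
    intro k
    cases k with
    | none => simp [hl.symm]
    | some k =>
      rw [Matrix.updateRow_ne (by simp), hN]
      by_cases hk : k = i1
      · subst hk; simp
      · rw [Matrix.updateRow_ne (by simpa using hk)]; simp
  · simp

lemma Mx_inj (h1 : f1 i1 x ≠ 0) (s : Option ι → ℝ) (hs : ∀ k, s k ≠ 0) (w : Option ι → ℝ)
    (hw : (Matrix.diagonal s * Mx f f1 i1 x).mulVec w = 0) : w = 0 := by
  refine Matrix.eq_zero_of_mulVec_eq_zero ?_ hw
  rw [Matrix.det_mul, Mx_det, Matrix.det_diagonal]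
  exact mul_ne_zero (Finset.prod_ne_zero_iff.2 fun k _ => hs k) h1

end curve
end Part5

section Part6
open MeasureTheory Set

section curve
variable {ι : Type} [Fintype ι] [DecidableEq ι]

/-- quantitative hypotheses on a curve -/
structure Crv (f f1 f2 : ι → ℝ → ℝ) (K C α : ℝ) : Prop where
  hK : 1 ≤ K
  hC : 0 < C
  hα : 0 < α
  d1 : ∀ i, ∀ x ∈ Icc (0:ℝ) 1, HasDerivAt (f i) (f1 i x) x
  d2 : ∀ i, ∀ x ∈ Icc (0:ℝ) 1, HasDerivAt (f1 i) (f2 i x) x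
  b0 : ∀ i, ∀ x ∈ Icc (0:ℝ) 1, |f i x| ≤ K
  b1 : ∀ i, ∀ x ∈ Icc (0:ℝ) 1, |f1 i x| ≤ K
  b2 : ∀ i, ∀ x ∈ Icc (0:ℝ) 1, |f2 i x| ≤ K
  low : ∀ i, ∀ x ∈ Icc (0:ℝ) 1, 1 ≤ K * |f1 i x|
  good : ∀ i1 : ι, ∀ j : ℕ, j ≤ Fintype.card (Option ι) → ∀ (A : Fin j → Option ι → ℤ)
    (I : Fin j → Option ι) (a b : ℝ), a < b → Icc a b ⊆ Icc 0 1 → ∀ S η : ℝ, 0 < S → 0 < η →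
    (∃ x ∈ Icc a b, S ≤ |tmin (Mx f f1 i1 x) A I|) →
    volume {x ∈ Icc a b | |tmin (Mx f f1 i1 x) A I| < η * S} ≤ ENNReal.ofReal (C * η ^ α * (b - a))
  nd : ∀ (c : Option ι → ℝ) (M : ℝ), (∀ x ∈ Ico (0:ℝ) 1, |c none + ∑ i, f i x * c (some i)| ≤ M) →
    ∀ k, |c k| ≤ K * M

/-- weights with a marked maximal component -/
structure Wt (r : ι → ℝ) (τ : ℝ) (i1 : ι) : Prop where
  hτ : 0 < τ
  ge : ∀ i, τ ≤ r i
  sum : ∑ i, r i = 1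
  mx : ∀ i, r i ≤ r i1

/-- the time parameter -/
noncomputable def tt (r1 q d : ℝ) : ℝ := (q + d) / (1 + r1)

/-- exponents -/
noncomputable def Ex (r : ι → ℝ) (i1 : ι) (q d : ℝ) (k : Option ι) : ℝ :=
  k.elim (tt (r i1) q d) fun i => if i = i1 then tt (r i1) q d - q else
    -(r i * tt (r i1) q d + d / (2 * Fintype.card ι))

/-- linear form and its derivatives -/
def U0 (f : ι → ℝ → ℝ) (c : Option ι → ℝ) (x : ℝ) : ℝ := c none + ∑ i, f i x * c (some i)
/-- linear form without constant term -/
def U1 (f1 : ι → ℝ → ℝ) (c : Option ι → ℝ) (x : ℝ) : ℝ := ∑ i, f1 i x * c (some i)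

variable {f f1 f2 : ι → ℝ → ℝ} {K C α : ℝ} {r : ι → ℝ} {τ : ℝ} {i1 : ι}

lemma Crv.dU0 (H : Crv f f1 f2 K C α) (c : Option ι → ℝ) (x : ℝ) (hx : x ∈ Icc (0:ℝ) 1) :
    HasDerivAt (U0 f c) (U1 f1 c x) x := by
  unfold U0 U1
  refine HasDerivAt.const_add _ ?_
  exact HasDerivAt.fun_sum fun i _ => (H.d1 i x hx).mul_const _

lemma Crv.dU1 (H : Crv f f1 f2 K C α) (c : Option ι → ℝ) (x : ℝ) (hx : x ∈ Icc (0:ℝ) 1) :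
    HasDerivAt (U1 f1 c) (U1 f2 c x) x := by
  unfold U1
  exact HasDerivAt.fun_sum fun i _ => (H.d2 i x hx).mul_const _

lemma Wt.r1_pos (hw : Wt r τ i1) : 0 < r i1 := hw.hτ.trans_le (hw.ge _)
lemma Wt.r1_le (hw : Wt r τ i1) : r i1 ≤ 1 := by
  rw [← hw.sum]
  exact Finset.single_le_sum (f := r) (fun i _ => hw.hτ.le.trans (hw.ge i)) (Finset.mem_univ i1)
lemma Wt.card_pos (hw : Wt r τ i1) : (1:ℝ) ≤ Fintype.card ι := by
  have : 0 < Fintype.card ι := Fintype.card_pos_iff.2 ⟨i1⟩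
  exact_mod_cast this
lemma Wt.r1_ge (hw : Wt r τ i1) : 1 ≤ Fintype.card ι * r i1 := by
  have := Finset.sum_le_card_nsmul Finset.univ r (r i1) (fun i _ => hw.mx i)
  rw [hw.sum] at this
  simpa using this
lemma Wt.tau_le (hw : Wt r τ i1) : Fintype.card ι * τ ≤ 1 := by
  have := Finset.card_nsmul_le_sum Finset.univ r τ (fun i _ => hw.ge i)
  rw [hw.sum] at this
  simpa using this
lemma Wt.tau_le1 (hw : Wt r τ i1) : τ ≤ 1 := by
  have := hw.tau_le; have := hw.card_pos; nlinarith [hw.hτ]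
lemma tt_eq (hw : Wt r τ i1) (q d : ℝ) : tt (r i1) q d * (1 + r i1) = q + d := by
  have := hw.r1_pos
  rw [tt]; field_simp

lemma taylor_bd (w w1 w2 : ℝ → ℝ) (x ℓ A B : ℝ) (hℓ : 0 < ℓ)
    (h1 : ∀ y ∈ Icc x (x+ℓ), HasDerivAt w (w1 y) y) (h2 : ∀ y ∈ Icc x (x+ℓ), HasDerivAt w1 (w2 y) y)
    (hA : ∀ y ∈ Icc x (x+ℓ), |w y| ≤ A) (hB : ∀ y ∈ Icc x (x+ℓ), |w2 y| ≤ B) :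
    |w1 x| ≤ 2 * A / ℓ + B * ℓ := by
  obtain ⟨ξ, hξ, he⟩ := exists_hasDerivAt_eq_slope w w1 (show x < x + ℓ by linarith)
    (fun y hy => (h1 y hy).continuousAt.continuousWithinAt)
    (fun y hy => h1 y (Ioo_subset_Icc_self hy))
  have hξ' := Ioo_subset_Icc_self hξ
  have hx : x ∈ Icc x (x+ℓ) := ⟨le_rfl, by linarith⟩
  have hx2 : x + ℓ ∈ Icc x (x+ℓ) := ⟨by linarith, le_rfl⟩
  have hB0 : 0 ≤ B := (abs_nonneg _).trans (hB x hx)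
  have h3 : |w1 ξ| ≤ 2 * A / ℓ := by
    rw [he, show x + ℓ - x = ℓ by ring, abs_div, abs_of_pos hℓ]
    gcongr
    refine (abs_sub _ _).trans ?_
    linarith [hA _ hx, hA _ hx2]
  have h4 : ‖w1 x - w1 ξ‖ ≤ B * ‖x - ξ‖ :=
    (convex_Icc x (x+ℓ)).norm_image_sub_le_of_norm_hasDerivWithin_le
      (fun y hy => (h2 y hy).hasDerivWithinAt) hB hξ' hx
  have h5 : ‖x - ξ‖ ≤ ℓ := by
    rw [Real.norm_eq_abs, abs_le]; constructor <;> linarith [hξ'.1, hξ'.2]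
  have h6 : |w1 x - w1 ξ| ≤ B * ℓ := h4.trans (by gcongr)
  have := abs_sub_abs_le_abs_sub (w1 x) (w1 ξ)
  linarith

/-- bounds for all coordinates and the second derivative from one point -/
lemma vec_bd (H : Crv f f1 f2 K C α) (hw : Wt r τ i1) (q d Y : ℝ) (hd : 0 ≤ d)
    (hq : 0 ≤ q) (hY : 0 ≤ Y)
    (c : Option ι → ℝ) (x : ℝ) (hx : x ∈ Icc (0:ℝ) 1)
    (h1 : |U1 f1 c x| ≤ Y * 2 ^ (-Ex r i1 q d (some i1)))
    (hi : ∀ i, i ≠ i1 → |c (some i)| ≤ Y * 2 ^ (-Ex r i1 q d (some i))) (y : ℝ)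
    (hy : y ∈ Icc (0:ℝ) 1) :
    |U1 f2 c y| ≤ K^3 * (Fintype.card ι + 1)^2 * Y * 2 ^ (r i1 * tt (r i1) q d + d) := by
  set t := tt (r i1) q d with ht
  set n : ℝ := (Fintype.card ι : ℝ)
  have hn : 1 ≤ n := hw.card_pos
  have htt := tt_eq hw q d
  rw [← ht] at htt
  have ht0 : 0 ≤ t := by rw [ht, tt]; have := hw.r1_pos; positivity
  set Z := Y * (2:ℝ) ^ (r i1 * t + d) with hZ
  have hK := H.hK
  have hZ0 : 0 ≤ Z := by positivity
  have h1' : |U1 f1 c x| ≤ Z := by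
    refine h1.trans ?_
    rw [hZ]
    gcongr ?_ * ?_
    apply Real.rpow_le_rpow_of_exponent_le one_le_two
    simp only [Ex, Option.elim, if_true, ← ht]
    nlinarith
  have hi' : ∀ i, i ≠ i1 → |c (some i)| ≤ Z := by
    intro i hne
    refine (hi i hne).trans ?_
    rw [hZ]
    gcongr ?_ * ?_
    apply Real.rpow_le_rpow_of_exponent_le one_le_two
    simp only [Ex, Option.elim, if_neg hne, ← ht]
    have h7 := hw.mx i
    have : d / (2 * n) ≤ d := div_le_self hd (by linarith)
    rw [neg_neg]
    gcongr
  have hci1 : |c (some i1)| ≤ K^2 * (n + 1) * Z := by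
    have hsum : f1 i1 x * c (some i1) = U1 f1 c x - ∑ i ∈ Finset.univ.erase i1, f1 i x * c (some i) := by
      rw [U1, ← Finset.add_sum_erase _ _ (Finset.mem_univ i1)]; ring
    have h2 : |f1 i1 x| * |c (some i1)| ≤ Z + n * (K * Z) := by
      rw [← abs_mul, hsum]
      refine (abs_sub _ _).trans (add_le_add h1' ?_)
      refine (Finset.abs_sum_le_sum_abs _ _).trans ?_
      refine (Finset.sum_le_card_nsmul _ _ (K * Z) fun i hi => ?_).trans ?_
      · rw [abs_mul]
        exact mul_le_mul (H.b1 i x hx) (hi' i (Finset.ne_of_mem_erase hi)) (abs_nonneg _) (by linarith)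
      · rw [nsmul_eq_mul]
        gcongr
        exact Nat.cast_le.2 (Finset.card_le_univ _)
    have h3 := H.low i1 x hx
    calc |c (some i1)| = 1 * |c (some i1)| := (one_mul _).symm
      _ ≤ K * |f1 i1 x| * |c (some i1)| := by gcongr
      _ = K * (|f1 i1 x| * |c (some i1)|) := by ring
      _ ≤ K * (Z + n * (K * Z)) := by gcongr
      _ ≤ K * (K * Z + n * (K * Z)) := by gcongr; nlinarith
      _ = _ := by ring
  have hall : ∀ i, |c (some i)| ≤ K^2 * (n + 1) * Z := by
    intro i
    by_cases h : i = i1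
    · rw [h]; exact hci1
    · refine (hi' i h).trans ?_
      have : 1 ≤ K^2 * (n+1) := by
        have : 1 ≤ K^2 := one_le_pow₀ hK
        nlinarith
      nlinarith
  rw [U1]
  refine (Finset.abs_sum_le_sum_abs _ _).trans ?_
  refine (Finset.sum_le_card_nsmul _ _ (K * (K^2 * (n + 1) * Z)) fun i hi => ?_).trans ?_
  · rw [abs_mul]
    exact mul_le_mul (H.b2 i y hy) (hall i) (abs_nonneg _) (by linarith)
  · rw [nsmul_eq_mul, Finset.card_univ]
    change n * _ ≤ _
    calc n * (K * (K^2 * (n + 1) * Z)) ≤ (n+1) * (K * (K^2 * (n + 1) * Z)) := by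
          have : 0 ≤ (K * (K^2 * (n + 1) * Z)) := by positivity
          nlinarith
      _ = _ := by rw [hZ]; ring

/-- dangerous points -/
def Dg (f f1 : ι → ℝ → ℝ) (r : ι → ℝ) (i1 : ι) (q d : ℝ) (x : ℝ) : Prop :=
  ∃ v : Option ι → ℤ, v ≠ 0 ∧ ∀ k, |hvec (Mx f f1 i1 x) v k| ≤ 2 ^ (-Ex r i1 q d k)

lemma dg_ext (H : Crv f f1 f2 K C α) (hw : Wt r τ i1) (q d : ℝ) (hd : 0 ≤ d)
    (hq : 2 * d ≤ q) (x y : ℝ) (hx : x ∈ Icc (0:ℝ) 1) (hy : y ∈ Icc (0:ℝ) 1)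
    (hxy : |y - x| ≤ 2 ^ (-q)) (hD : Dg f f1 r i1 q d x) :
    ∃ v : Option ι → ℤ, v ≠ 0 ∧ ∀ k, |hvec (Mx f f1 i1 y) v k| ≤
      (2 + K^3 * (Fintype.card ι + 1)^2) * 2 ^ (-Ex r i1 q d k) := by
  obtain ⟨v, hv0, hv⟩ := hD
  refine ⟨v, hv0, ?_⟩
  set c : Option ι → ℝ := fun k => (v k : ℝ)
  have hn := hw.card_pos
  have hK := H.hK
  set t := tt (r i1) q d with ht
  have htt := tt_eq hw q d
  rw [← ht] at htt
  have e0 : ∀ z, hvec (Mx f f1 i1 z) v none = U0 f c z := fun z => hvec_n v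
  have e1 : ∀ z, hvec (Mx f f1 i1 z) v (some i1) = U1 f1 c z := fun z => hvec_1 v
  set B := K^3 * ((Fintype.card ι : ℝ) + 1)^2 with hB
  have hB0 : 0 ≤ B := by positivity
  have hU2 : ∀ z ∈ Icc (0:ℝ) 1, |U1 f2 c z| ≤ B * 2 ^ (r i1 * t + d) := by
    intro z hz
    have := vec_bd H hw q d 1 hd (by linarith) zero_le_one c x hx (by
      rw [one_mul, ← e1]; exact hv _) (by
      intro i hi; rw [one_mul]
      have := hv (some i)
      rwa [hvec_u v i hi] at this) z hz
    rwa [mul_one] at this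
  have hEn : Ex r i1 q d none = t := rfl
  have hE1 : Ex r i1 q d (some i1) = t - q := by simp [Ex, ht]
  have hU1 : ∀ z ∈ Icc (0:ℝ) 1, |z - x| ≤ 2 ^ (-q) → |U1 f1 c z| ≤ (1 + B) * 2 ^ (q - t) := by
    intro z hz hzx
    have h4 : ‖U1 f1 c z - U1 f1 c x‖ ≤ (B * 2 ^ (r i1 * t + d)) * ‖z - x‖ :=
      (convex_Icc (0:ℝ) 1).norm_image_sub_le_of_norm_hasDerivWithin_le
        (fun y hy => (H.dU1 c y hy).hasDerivWithinAt) hU2 hx hz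
    have h5 : |U1 f1 c x| ≤ 2 ^ (q - t) := by
      have := hv (some i1); rw [e1, hE1] at this; rwa [neg_sub] at this
    have h6 : (B * 2 ^ (r i1 * t + d)) * ‖z - x‖ ≤ B * 2 ^ (q - t) := by
      calc (B * 2 ^ (r i1 * t + d)) * ‖z - x‖ ≤ (B * 2 ^ (r i1 * t + d)) * 2 ^ (-q) := by
            gcongr; exact hzx
        _ = B * 2 ^ (r i1 * t + d + -q) := by rw [Real.rpow_add two_pos _ (-q), mul_assoc]
        _ ≤ B * 2 ^ (q - t) := by
            gcongr ?_ * ?_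
            apply Real.rpow_le_rpow_of_exponent_le one_le_two
            nlinarith
    have := abs_sub_abs_le_abs_sub (U1 f1 c z) (U1 f1 c x)
    rw [Real.norm_eq_abs] at h4
    linarith
  have hxy' : ∀ z ∈ uIcc x y, |z - x| ≤ 2 ^ (-q) := fun z hz =>
    (abs_sub_left_of_mem_uIcc hz).trans hxy
  have hsub : uIcc x y ⊆ Icc (0:ℝ) 1 := uIcc_subset_Icc hx hy
  have hU0 : |U0 f c y| ≤ (2 + B) * 2 ^ (-t) := by
    have h4 : ‖U0 f c y - U0 f c x‖ ≤ ((1 + B) * 2 ^ (q - t)) * ‖y - x‖ :=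
      (convex_uIcc x y).norm_image_sub_le_of_norm_hasDerivWithin_le
        (fun z hz => (H.dU0 c z (hsub hz)).hasDerivWithinAt)
        (fun z hz => hU1 z (hsub hz) (hxy' z hz)) left_mem_uIcc right_mem_uIcc
    have h5 : |U0 f c x| ≤ 2 ^ (- t) := by
      have := hv none; rw [e0, hEn] at this; exact this
    have h6 : ((1 + B) * 2 ^ (q - t)) * ‖y - x‖ ≤ (1 + B) * 2 ^ (- t) := by
      calc ((1 + B) * 2 ^ (q - t)) * ‖y - x‖ ≤ ((1 + B) * 2 ^ (q - t)) * 2 ^ (-q) := by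
            gcongr; exact hxy
        _ = (1 + B) * 2 ^ (- t) := by
            rw [mul_assoc, ← Real.rpow_add two_pos]; ring_nf
    have := abs_sub_abs_le_abs_sub (U0 f c y) (U0 f c x)
    rw [Real.norm_eq_abs] at h4
    linarith
  intro k
  cases k with
  | none => rw [e0, hEn]; exact hU0
  | some i =>
    by_cases hi : i = i1
    · rw [hi, e1, hE1, neg_sub]
      refine (hU1 y hy hxy).trans ?_
      gcongr; norm_num
    · rw [hvec_u v i hi]
      have := hv (some i)
      rw [hvec_u v i hi] at this
      refine this.trans ?_
      have h0 : (0:ℝ) < 2 ^ (-Ex r i1 q d (some i)) := by positivity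
      nlinarith

end curve
end Part6

section Part7
open MeasureTheory Set

section curve
variable {ι : Type} [Fintype ι] [DecidableEq ι]

/-- the renormalised matrix -/
noncomputable def hE (f f1 : ι → ℝ → ℝ) (r : ι → ℝ) (i1 : ι) (q d : ℝ) (x : ℝ) :
    Matrix (Option ι) (Option ι) ℝ :=
  Matrix.diagonal (fun k => (2:ℝ) ^ (Ex r i1 q d k)) * Mx f f1 i1 x

variable {f f1 f2 : ι → ℝ → ℝ} {K C α : ℝ} {r : ι → ℝ} {τ : ℝ} {i1 : ι}

lemma tmin_hE (q d x : ℝ) {j : ℕ} (A : Fin j → Option ι → ℤ) (I : Fin j → Option ι) :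
    tmin (hE f f1 r i1 q d x) A I = 2 ^ (∑ a, Ex r i1 q d (I a)) * tmin (Mx f f1 i1 x) A I := by
  rw [hE, tmin_diag, ← Real.rpow_sum_of_pos two_pos]

lemma tmin_Mx_expand {j : ℕ} (A : Fin j → Option ι → ℤ) (I : Fin j → Option ι) (a0 : Fin j)
    (hn : ∀ a, a ≠ a0 → I a ≠ none) (h1 : ∀ a, a ≠ a0 → I a ≠ some i1) (x : ℝ) (k : Option ι) :
    tmin (Mx f f1 i1 x) A (Function.update I a0 k) =
      ∑ l, Mx f f1 i1 x k l * tmin 1 A (Function.update I a0 l) := by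
  rw [tmin_expand]
  refine Finset.sum_congr rfl fun l _ => ?_
  rw [rowdet_one]
  intro a ha l
  exact Mx_u' _ (hn a ha) (h1 a ha) l

lemma tmin_Mx_n {j : ℕ} (A : Fin j → Option ι → ℤ) (I : Fin j → Option ι) (a0 : Fin j)
    (hn : ∀ a, a ≠ a0 → I a ≠ none) (h1 : ∀ a, a ≠ a0 → I a ≠ some i1) (x : ℝ) :
    tmin (Mx f f1 i1 x) A (Function.update I a0 none) =
      U0 f (fun l => tmin 1 A (Function.update I a0 l)) x := by
  rw [tmin_Mx_expand A I a0 hn h1, Fintype.sum_option]; simp [U0]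

lemma tmin_Mx_1 {j : ℕ} (A : Fin j → Option ι → ℤ) (I : Fin j → Option ι) (a0 : Fin j)
    (hn : ∀ a, a ≠ a0 → I a ≠ none) (h1 : ∀ a, a ≠ a0 → I a ≠ some i1) (x : ℝ) :
    tmin (Mx f f1 i1 x) A (Function.update I a0 (some i1)) =
      U1 f1 (fun l => tmin 1 A (Function.update I a0 l)) x := by
  rw [tmin_Mx_expand A I a0 hn h1, Fintype.sum_option]; simp [U1]

lemma tmin_Mx_s {j : ℕ} (A : Fin j → Option ι → ℤ) (I : Fin j → Option ι) (a0 : Fin j)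
    (hn : ∀ a, a ≠ a0 → I a ≠ none) (h1 : ∀ a, a ≠ a0 → I a ≠ some i1) (x : ℝ) (i : ι)
    (hi : i ≠ i1) :
    tmin (Mx f f1 i1 x) A (Function.update I a0 (some i)) =
      tmin 1 A (Function.update I a0 (some i)) := by
  rw [tmin_Mx_expand A I a0 hn h1]; simp [Mx_u i hi]

lemma y1_bd (H : Crv f f1 f2 K C α) (hw : Wt r τ i1) (p d : ℝ) (hd : 0 ≤ d) (hp : 3 * d ≤ p)
    (x0 ℓ : ℝ) (hℓ : ℓ = 2 ^ (-p) / 2) (hsub : Icc x0 (x0 + ℓ) ⊆ Icc 0 1) (X : ℝ) (hX : 0 ≤ X)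
    {j : ℕ} (A : Fin j → Option ι → ℤ)
    (hA : ∀ x ∈ Icc x0 (x0 + ℓ), ∀ I, |tmin (hE f f1 r i1 (p + d) d x) A I| ≤ X)
    (I : Fin j → Option ι) (a0 : Fin j) (ha0 : I a0 = some i1) (hIn : ∀ a, I a ≠ none) :
    |tmin (hE f f1 r i1 (p+d) d x0) A I| ≤
      (4 + K^3 * (Fintype.card ι + 1)^2) * X * 2 ^ (-d) := by
  have hK := H.hK
  by_cases hinj : Function.Injective I
  swap
  · rw [tmin_eq_mi, mi_of_not_inj _ _ hinj, abs_zero]; positivity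
  have hn : ∀ a, a ≠ a0 → I a ≠ none := fun a _ => hIn a
  have h1 : ∀ a, a ≠ a0 → I a ≠ some i1 := fun a ha h => ha (hinj (h.trans ha0.symm))
  set q := p + d with hq
  set t := tt (r i1) q d with ht
  have htt := tt_eq hw q d
  rw [← ht] at htt
  set s := ∑ a ∈ Finset.univ.erase a0, Ex r i1 q d (I a) with hs
  have hsum : ∀ l, ∑ a, Ex r i1 q d (Function.update I a0 l a) = Ex r i1 q d l + s := by
    intro l
    rw [← Finset.add_sum_erase _ _ (Finset.mem_univ a0), hs, Function.update_self]
    congr 1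
    refine Finset.sum_congr rfl fun a ha => ?_
    rw [Function.update_of_ne (Finset.ne_of_mem_erase ha)]
  set Y := X * 2 ^ (-s) with hY
  have hY0 : 0 ≤ Y := by positivity
  have hbd : ∀ x ∈ Icc x0 (x0 + ℓ), ∀ l, |tmin (Mx f f1 i1 x) A (Function.update I a0 l)| ≤
      Y * 2 ^ (-Ex r i1 q d l) := by
    intro x hx l
    have := hA x hx (Function.update I a0 l)
    rw [tmin_hE, hsum, abs_mul, abs_of_pos (by positivity), add_comm, Real.rpow_add two_pos] at this
    rw [hY, Real.rpow_neg two_pos.le, Real.rpow_neg two_pos.le]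
    rw [← div_eq_mul_inv, ← div_eq_mul_inv, div_div, le_div_iff₀ (by positivity)]
    linarith
  set c : Option ι → ℝ := fun l => tmin 1 A (Function.update I a0 l) with hc
  have hℓ0 : 0 < ℓ := by rw [hℓ]; positivity
  have hx0 : x0 ∈ Icc x0 (x0 + ℓ) := ⟨le_rfl, by linarith⟩
  have hEn : Ex r i1 q d none = t := rfl
  have hE1 : Ex r i1 q d (some i1) = t - q := by simp [Ex, ht]
  have hmain := taylor_bd (U0 f c) (U1 f1 c) (U1 f2 c) x0 ℓ (Y * 2 ^ (-t))
    (K^3 * (Fintype.card ι + 1)^2 * Y * 2 ^ (r i1 * t + d)) hℓ0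
    (fun y hy => H.dU0 c y (hsub hy)) (fun y hy => H.dU1 c y (hsub hy))
    (fun y hy => by
      have := hbd y hy none
      rwa [tmin_Mx_n A I a0 hn h1, hEn] at this)
    (fun y hy => vec_bd H hw q d Y hd (by linarith) hY0 c x0 (hsub hx0)
      (by have := hbd x0 hx0 (some i1); rwa [tmin_Mx_1 A I a0 hn h1] at this)
      (fun i hi => by
        have := hbd x0 hx0 (some i); rwa [tmin_Mx_s A I a0 hn h1 x0 i hi] at this) y (hsub hy))
  have hI : Function.update I a0 (some i1) = I := by rw [← ha0]; simp
  rw [tmin_hE, abs_mul, abs_of_pos (by positivity)]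
  conv_lhs => rw [← hI]
  rw [hsum, tmin_Mx_1 A I a0 hn h1, hE1]
  set B := K^3 * ((Fintype.card ι:ℝ) + 1)^2 with hB
  have hB0 : 0 ≤ B := by positivity
  have h2 : 2 * (Y * 2 ^ (-t)) / ℓ = 4 * Y * 2 ^ (p - t) := by
    rw [hℓ, Real.rpow_neg two_pos.le p, sub_eq_add_neg, Real.rpow_add two_pos]
    field_simp; ring
  have h3 : B * Y * 2 ^ (r i1 * t + d) * ℓ ≤ B * Y * 2 ^ (p - t) := by
    calc B * Y * 2 ^ (r i1 * t + d) * ℓ ≤ B * Y * 2 ^ (r i1 * t + d) * 2 ^ (-p) := by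
          gcongr; rw [hℓ]
          have : (0:ℝ) < 2 ^ (-p) := by positivity
          linarith
      _ = B * Y * 2 ^ (r i1 * t + d + -p) := by rw [Real.rpow_add two_pos _ (-p), mul_assoc]
      _ ≤ B * Y * 2 ^ (p - t) := by
          gcongr ?_ * ?_
          apply Real.rpow_le_rpow_of_exponent_le one_le_two
          nlinarith
  rw [h2] at hmain
  calc (2:ℝ) ^ (t - q + s) * |U1 f1 c x0| ≤ 2 ^ (t - q + s) * ((4 + B) * Y * 2 ^ (p - t)) := by
        gcongr; linarith
    _ = (4 + B) * X * (2 ^ (t - q + s) * 2 ^ (-s) * 2 ^ (p - t)) := by rw [hY]; ring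
    _ = (4 + B) * X * 2 ^ (-d) := by
        rw [← Real.rpow_add two_pos, ← Real.rpow_add two_pos]
        congr 2; rw [hq]; ring

/-- indices other than `none`, `some i1` hit by `I` -/
noncomputable def Ts (i1 : ι) {j : ℕ} (I : Fin j → Option ι) : Finset ι :=
  Finset.univ.filter fun i => i ≠ i1 ∧ some i ∈ Finset.univ.image I

lemma sum_inj (g : Option ι → ℝ) {j : ℕ} (I : Fin j → Option ι) (hI : Function.Injective I) :
    ∑ a, g (I a) = (if ∃ a, I a = none then g none else 0) +
      (if ∃ a, I a = some i1 then g (some i1) else 0) + ∑ i ∈ Ts i1 I, g (some i) := by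
  classical
  have h1 : ∑ a, g (I a) = ∑ k ∈ Finset.univ.image I, g k :=
    (Finset.sum_image (fun a _ b _ h => hI h)).symm
  have h2 : ∑ k ∈ Finset.univ.image I, g k = ∑ k, if k ∈ Finset.univ.image I then g k else 0 := by
    rw [Finset.sum_ite_mem, Finset.univ_inter]
  rw [h1, h2, Fintype.sum_option, ← Finset.add_sum_erase _ _ (Finset.mem_univ i1), Ts,
    Finset.sum_filter, add_assoc]
  congr 1
  · simp
  · congr 1
    · simp
    · rw [← Finset.add_sum_erase Finset.univ _ (Finset.mem_univ i1)]
      simp only [ne_eq, not_true_eq_false, false_and, if_false, zero_add]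
      refine Finset.sum_congr rfl fun i hi => ?_
      simp [Finset.ne_of_mem_erase hi]

lemma Ts_card {j : ℕ} (I : Fin j → Option ι) (hI : Function.Injective I) :
    (j:ℝ) = (if ∃ a, I a = none then 1 else 0) +
      (if ∃ a, I a = some i1 then 1 else 0) + ((Ts i1 I).card : ℝ) := by
  have := sum_inj (i1 := i1) (fun _ => 1) I hI
  simpa using this

lemma Ts_sum (hw : Wt r τ i1) {j : ℕ} (I : Fin j → Option ι) : ∑ i ∈ Ts i1 I, r i ≤ 1 - r i1 := by
  have h1 : ∑ i ∈ Ts i1 I, r i ≤ ∑ i ∈ Finset.univ.erase i1, r i := by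
    apply Finset.sum_le_sum_of_subset_of_nonneg
    · intro i hi; simp only [Ts, Finset.mem_filter] at hi; simp [hi.2.1]
    · intro i _ _; exact hw.hτ.le.trans (hw.ge i)
  have h2 := Finset.add_sum_erase Finset.univ r (Finset.mem_univ i1)
  rw [hw.sum] at h2; linarith

lemma Ts_card_le {j : ℕ} (I : Fin j → Option ι) : ((Ts i1 I).card : ℝ) ≤ Fintype.card ι - 1 := by
  have h1 : (Ts i1 I).card ≤ (Finset.univ.erase i1).card := by
    apply Finset.card_le_card
    intro i hi; simp only [Ts, Finset.mem_filter] at hi; simp [hi.2.1]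
  rw [Finset.card_erase_of_mem (Finset.mem_univ _), Finset.card_univ] at h1
  have : 0 < Fintype.card ι := Fintype.card_pos_iff.2 ⟨i1⟩
  rw [le_sub_iff_add_le]
  exact_mod_cast (by omega : (Ts i1 I).card + 1 ≤ Fintype.card ι)

lemma Ts_sum' (hw : Wt r τ i1) {j : ℕ} (I : Fin j → Option ι)
    (hc : ((Ts i1 I).card : ℝ) ≤ Fintype.card ι - 2) : ∑ i ∈ Ts i1 I, r i ≤ 1 - r i1 - τ := by
  obtain ⟨i, hi, hiT⟩ : ∃ i, i ≠ i1 ∧ i ∉ Ts i1 I := by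
    by_contra hcon
    push Not at hcon
    have : Finset.univ.erase i1 ⊆ Ts i1 I := fun i hi => hcon i (Finset.ne_of_mem_erase hi)
    have h1 := Finset.card_le_card this
    rw [Finset.card_erase_of_mem (Finset.mem_univ _), Finset.card_univ] at h1
    have h2 : (Fintype.card ι : ℝ) ≤ (Ts i1 I).card + 1 := by
      exact_mod_cast (by omega : Fintype.card ι ≤ (Ts i1 I).card + 1)
    linarith
  have h1 : ∑ i ∈ insert i (Ts i1 I), r i ≤ ∑ i ∈ Finset.univ.erase i1, r i := by
    apply Finset.sum_le_sum_of_subset_of_nonneg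
    · intro k hk
      rcases Finset.mem_insert.1 hk with rfl | hk
      · simp [hi]
      · simp only [Ts, Finset.mem_filter] at hk; simp [hk.2.1]
    · intro i _ _; exact hw.hτ.le.trans (hw.ge i)
  rw [Finset.sum_insert hiT] at h1
  have h2 := Finset.add_sum_erase Finset.univ r (Finset.mem_univ i1)
  rw [hw.sum] at h2; linarith [hw.ge i]

end curve
end Part7

section Part8
open MeasureTheory Set

section curve
variable {ι : Type} [Fintype ι] [DecidableEq ι]
variable {f f1 f2 : ι → ℝ → ℝ} {K C α : ℝ} {r : ι → ℝ} {τ : ℝ} {i1 : ι}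

lemma r2_le {u v : ℝ} (h : u ≤ v) : (2:ℝ) ^ u ≤ 2 ^ v :=
  Real.rpow_le_rpow_of_exponent_le one_le_two h

/-- constant -/
noncomputable def LL (ι : Type) [Fintype ι] (K : ℝ) : ℝ :=
  (Fintype.card ι : ℝ) ^ (Fintype.card ι) * (Fintype.card ι).factorial *
    (4 + K^3 * (Fintype.card ι + 1)^2) * K

/-- choice of the parameter `xb` -/
lemma xb_choice {j : ℕ} (w : (Fin j → Option ι) → ℝ) (cs d X P : ℝ) (hd : 0 < d) (hcs : 0 ≤ cs)
    (hX : 1 ≤ X) (hwX : ∀ I, |w I| ≤ X)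
    (hP : ∀ S I : Fin j → Option ι, (∀ a, S a ≠ none) → (∀ a, S a ≠ some i1) →
      (∃ a, I a = none) → (∃ a, I a = some i1) → |w S| * |w I| ≤ P) :
    ∃ xb, 0 ≤ xb ∧ xb ≤ cs ∧
      (∀ S : Fin j → Option ι, (∀ a, S a ≠ none) → (∀ a, S a ≠ some i1) → |w S| ≤ X * 2 ^ (-(xb * d))) ∧
      (xb = cs ∨ ∀ I : Fin j → Option ι, (∃ a, I a = none) → (∃ a, I a = some i1) →
        |w I| ≤ P * 2 ^ (xb * d)) := by
  by_cases hz : ∀ S : Fin j → Option ι, (∀ a, S a ≠ none) → (∀ a, S a ≠ some i1) →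
      |w S| ≤ 2 ^ (-(cs * d))
  · refine ⟨cs, hcs, le_rfl, fun S h1 h2 => (hz S h1 h2).trans ?_, Or.inl rfl⟩
    have : (0:ℝ) < 2 ^ (-(cs * d)) := by positivity
    nlinarith
  push Not at hz
  obtain ⟨S1, h1, h2, h3⟩ := hz
  let 𝒮 := {S : Fin j → Option ι // (∀ a, S a ≠ none) ∧ (∀ a, S a ≠ some i1)}
  haveI : Nonempty 𝒮 := ⟨⟨S1, h1, h2⟩⟩
  obtain ⟨⟨T, hT0, hT1⟩, hT⟩ := Finite.exists_max (fun S : 𝒮 => |w S.1|)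
  have hTS : 2 ^ (-(cs * d)) < |w T| := h3.trans_le (hT ⟨S1, h1, h2⟩)
  have hTm : ∀ S : Fin j → Option ι, (∀ a, S a ≠ none) → (∀ a, S a ≠ some i1) → |w S| ≤ |w T| :=
    fun S h1 h2 => hT ⟨S, h1, h2⟩
  have hTpos : 0 < |w T| := lt_trans (by positivity) hTS
  by_cases hT1' : 1 ≤ |w T|
  · refine ⟨0, le_rfl, hcs, fun S _ _ => by simpa using hwX S, Or.inr fun I hI0 hI1 => ?_⟩
    have := hP T I hT0 hT1 hI0 hI1
    simp only [zero_mul, Real.rpow_zero, mul_one]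
    nlinarith [abs_nonneg (w I)]
  push Not at hT1'
  set xb := -Real.logb 2 |w T| / d with hxb
  have hxd : xb * d = -Real.logb 2 |w T| := by rw [hxb]; field_simp
  have h2xb : (2:ℝ) ^ (-(xb * d)) = |w T| := by
    rw [hxd, neg_neg, Real.rpow_logb two_pos (by norm_num) hTpos]
  have hlog : Real.logb 2 |w T| ≤ 0 := Real.logb_nonpos one_lt_two hTpos.le hT1'.le
  refine ⟨xb, div_nonneg (by linarith) hd.le, ?_, fun S h1 h2 => ?_, Or.inr fun I hI0 hI1 => ?_⟩
  · rw [← h2xb] at hTS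
    have := (Real.rpow_lt_rpow_left_iff one_lt_two).1 hTS
    nlinarith
  · rw [h2xb]; nlinarith [hTm S h1 h2]
  · have := hP T I hT0 hT1 hI0 hI1
    have h5 : (2:ℝ) ^ (xb * d) = |w T|⁻¹ := by
      rw [← h2xb, Real.rpow_neg two_pos.le, inv_inv]
    rw [h5, ← div_eq_mul_inv, le_div_iff₀ hTpos]; linarith

set_option maxHeartbeats 1000000 in
lemma key_bd (hw : Wt r τ i1) {j : ℕ} (hj1 : 1 ≤ j) (hjn : j ≤ Fintype.card ι)
    (g : Option ι → ℝ) (w : (Fin j → Option ι) → ℝ) (d s e X B xb σ0 σs cs m Q : ℝ) (hdpos : 0 < d)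
    (hσn : σ0 * Fintype.card ι = 1/12) (hσpos : 0 < σ0) (hσle : σ0 ≤ 1/12) (hσd : 2 ≤ σ0 * d)
    (hd2 : 12 ≤ τ * d) (hmσ : m = τ * σ0 / 4) (hmle : 2 * m ≤ σ0 / 2)
    (hgn : g none = -s) (hg1 : g (some i1) = d - s) (hgi : ∀ i, i ≠ i1 → g (some i) = r i * s - e)
    (hs0 : 0 ≤ s) (hs1 : s ≤ σs * d) (hs2 : σs * d - 1 ≤ s) (hsσ : σ0 * d / 2 ≤ s)
    (hσs : σs = min (xb + σ0) cs) (he0 : 0 ≤ e)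
    (h10 : e * (2 * Fintype.card ι) = d - s * (1 + r i1)) (hcs1 : cs * (1 + r i1) = 1)
    (hcs2 : 1 / 2 ≤ cs)
    (hwX : ∀ I, |w I| ≤ X)
    (hy1 : ∀ I : Fin j → Option ι, (∃ a, I a = some i1) → (∀ a, I a ≠ none) →
      |w I| ≤ (4 + B) * X * 2 ^ (-d))
    (hxz : ∀ S : Fin j → Option ι, (∀ a, S a ≠ none) → (∀ a, S a ≠ some i1) →
      |w S| ≤ X * 2 ^ (-(xb * d)))
    (hxv : xb = cs ∨ ∀ I : Fin j → Option ι, (∃ a, I a = none) → (∃ a, I a = some i1) →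
        |w I| ≤ (j.factorial : ℝ) * X * ((4 + B) * X * 2 ^ (-d)) * 2 ^ (xb * d))
    (hX1 : 1 ≤ X) (hB0 : 0 ≤ B) (hQ : Q = j.factorial * (4 + B) * X^2) (hQX : X ≤ Q)
    (hQ4 : (4 + B) * X ≤ Q) (I : Fin j → Option ι) (hinj : Function.Injective I) :
    2 ^ (∑ a, g (I a)) * |w I| ≤ Q * 2 ^ (-(2 * m * d)) := by
  have hn := hw.card_pos
  have hrp := hw.r1_pos
  have hr1 := hw.r1_le
  have hτ := hw.hτ
  have hτ1 := hw.tau_le1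
  have hrn := hw.r1_ge
  have hge := hw.ge i1
  have hQ0 : 0 ≤ Q := by linarith
  have hsum := sum_inj (i1 := i1) g I hinj
  have hcard := Ts_card (i1 := i1) I hinj
  have hTr := Ts_sum hw I
  have hTg : ∑ i ∈ Ts i1 I, g (some i) = s * ∑ i ∈ Ts i1 I, r i - (Ts i1 I).card * e := by
    rw [Finset.sum_congr rfl (g := fun i => r i * s - e), Finset.sum_sub_distrib,
      ← Finset.sum_mul, Finset.sum_const, nsmul_eq_mul]
    · ring
    · intro i hi; simp only [Ts, Finset.mem_filter] at hi; exact hgi i hi.2.1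
  rw [hTg] at hsum
  have hTs : s * ∑ i ∈ Ts i1 I, r i ≤ s * (1 - r i1) := mul_le_mul_of_nonneg_left hTr hs0
  have hce : 0 ≤ ((Ts i1 I).card : ℝ) * e := by positivity
  have hτs : τ * (σ0 * d / 2) ≤ r i1 * s := mul_le_mul hge hsσ (by linarith) hrp.le
  by_cases h0 : ∃ a, I a = none <;> by_cases h1 : ∃ a, I a = some i1
  · -- both
    rw [if_pos h0, if_pos h1, hgn, hg1] at hsum
    rw [if_pos h0, if_pos h1] at hcard
    have hTr' := Ts_sum' hw I (by
      have : (j:ℝ) ≤ Fintype.card ι := by exact_mod_cast hjn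
      linarith)
    have hTs' : s * ∑ i ∈ Ts i1 I, r i ≤ s * (1 - r i1 - τ) := mul_le_mul_of_nonneg_left hTr' hs0
    have hsum' : ∑ a, g (I a) ≤ d - (1 + r i1 + τ) * s := by rw [hsum]; linarith
    rcases min_choice (xb + σ0) cs with hc | hc
    · by_cases hxc : xb = cs
      · exfalso
        have := min_le_right (xb + σ0) cs
        rw [hc] at this; linarith
      have hv := (hxv.resolve_left hxc) I h0 h1
      calc 2 ^ (∑ a, g (I a)) * |w I| ≤ 2 ^ (d - (1 + r i1 + τ) * s) *
            ((j.factorial : ℝ) * X * ((4 + B) * X * 2 ^ (-d)) * 2 ^ (xb * d)) := by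
              gcongr; exact one_le_two
        _ = Q * (2 ^ (d - (1 + r i1 + τ) * s) * 2 ^ (-d) * 2 ^ (xb * d)) := by rw [hQ]; ring
        _ = Q * 2 ^ (d - (1 + r i1 + τ) * s + -d + xb * d) := by
              rw [Real.rpow_add two_pos, Real.rpow_add two_pos]
        _ ≤ Q * 2 ^ (-(2 * m * d)) := by
              refine mul_le_mul_of_nonneg_left (r2_le ?_) hQ0
              rw [hσs, hc] at hs2
              have : 2 * m * d ≤ σ0 / 2 * d := by gcongr
              nlinarith [mul_nonneg hrp.le hs0, mul_nonneg hτ.le hs0]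
    · calc 2 ^ (∑ a, g (I a)) * |w I| ≤ 2 ^ (d - (1 + r i1 + τ) * s) * Q := by
              gcongr
              · exact one_le_two
              · exact (hwX I).trans hQX
        _ = Q * 2 ^ (d - (1 + r i1 + τ) * s) := by ring
        _ ≤ Q * 2 ^ (-(2 * m * d)) := by
              refine mul_le_mul_of_nonneg_left (r2_le ?_) hQ0
              rw [hσs, hc] at hs2
              have h7 : (1 + r i1) * s ≥ d - 2 := by
                have : (1 + r i1) * (cs * d - 1) ≤ (1 + r i1) * s := by gcongr
                have : (1 + r i1) * (cs * d - 1) = d - (1 + r i1) := by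
                  linear_combination d * hcs1
                linarith
              have h8 : τ * (d / 2 - 1) ≤ τ * s := by
                have : (1:ℝ) / 2 * d ≤ cs * d := by gcongr
                gcongr; linarith
              have h9 : 2 * m * d ≤ τ * d / 24 := by
                rw [hmσ]
                have : τ * d * σ0 ≤ τ * d * (1/12) := by gcongr
                linarith
              linarith
  · -- none only
    rw [if_pos h0, if_neg h1, hgn] at hsum
    calc 2 ^ (∑ a, g (I a)) * |w I| ≤ 2 ^ (-(2 * m * d)) * Q := by
          refine mul_le_mul (r2_le ?_) ((hwX I).trans hQX) (abs_nonneg _) (by positivity)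
          rw [hsum, hmσ]; linarith
      _ = _ := mul_comm _ _
  · -- i1 only
    rw [if_neg h0, if_pos h1, hg1] at hsum
    have hv := hy1 I h1 (fun a ha => h0 ⟨a, ha⟩)
    calc 2 ^ (∑ a, g (I a)) * |w I| ≤ 2 ^ (d - 2 * m * d) * ((4 + B) * X * 2 ^ (-d)) := by
          refine mul_le_mul (r2_le ?_) hv (abs_nonneg _) (by positivity)
          rw [hsum, hmσ]; linarith
      _ = (4 + B) * X * (2 ^ (d - 2 * m * d) * 2 ^ (-d)) := by ring
      _ = (4 + B) * X * 2 ^ (-(2 * m * d)) := by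
          rw [← Real.rpow_add two_pos]; congr 2; ring
      _ ≤ _ := by gcongr
  · rw [if_neg h0, if_neg h1] at hsum
    rw [if_neg h0, if_neg h1] at hcard
    have hv := hxz I (fun a ha => h0 ⟨a, ha⟩) (fun a ha => h1 ⟨a, ha⟩)
    have hj1' : (1:ℝ) ≤ j := by exact_mod_cast hj1
    have hce1 : e ≤ ((Ts i1 I).card : ℝ) * e := by
      apply le_mul_of_one_le_left he0; linarith
    calc 2 ^ (∑ a, g (I a)) * |w I| ≤ 2 ^ (s * (1 - r i1) - e) * (X * 2 ^ (-(xb * d))) := by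
          refine mul_le_mul (r2_le ?_) hv (abs_nonneg _) (by positivity)
          linarith
      _ = X * 2 ^ (s * (1 - r i1) - e + -(xb * d)) := by
          rw [Real.rpow_add two_pos]; ring
      _ ≤ Q * 2 ^ (-(2 * m * d)) := by
          refine mul_le_mul hQX (r2_le ?_) (by positivity) hQ0
          have h7 : σs * d ≤ (xb + σ0) * d := by
            rw [hσs]; exact mul_le_mul_of_nonneg_right (min_le_left _ _) hdpos.le
          have h8 : d * (6 * σ0) ≤ r i1 * s + e := by
            have h11 : 0 ≤ s * (2 * (Fintype.card ι : ℝ) * r i1 - 1 - r i1) := by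
              apply mul_nonneg hs0; linarith
            have h12 : d * (6 * σ0) * (2 * (Fintype.card ι : ℝ)) = d := by linear_combination 12 * d * hσn
            have h13 : d * (6 * σ0) * (2 * (Fintype.card ι : ℝ)) ≤ (r i1 * s + e) * (2*(Fintype.card ι : ℝ)) := by
              rw [h12, add_mul, h10]; linarith
            exact le_of_mul_le_mul_right h13 (by linarith)
          have : 2 * m * d ≤ σ0 / 2 * d := by gcongr
          linarith

set_option maxHeartbeats 3000000 in
lemma local_low (H : Crv f f1 f2 K C α) (hw : Wt r τ i1) (p d : ℕ)
    (hp : 3 * d ≤ p) (hd1 : 24 * (Fintype.card ι : ℝ) ≤ d) (hd2 : 12 ≤ τ * d)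
    (hd3 : LL ι K ≤ 2 ^ (τ / (48 * Fintype.card ι) * d))
    (x0 ℓ : ℝ) (hℓ : ℓ = 2 ^ (-(p:ℝ)) / 2) (hsub : Icc x0 (x0 + ℓ) ⊆ Icc 0 1)
    (hnd : ∀ d' : ℕ, d ≤ d' → d' ≤ 2 * d → ¬ Dg f f1 r i1 p d' x0)
    {V : Submodule ℚ (Option ι → ℚ)}
    {j : ℕ} (hj1 : 1 ≤ j) (hjn : j ≤ Fintype.card ι) (A : Fin j → Option ι → ℤ) (hAV : TupIn V A)
    (hA : ∀ x ∈ Icc x0 (x0 + ℓ), ∀ I, |tmin (hE f f1 r i1 (p + d) d x) A I| ≤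
      2 ^ (j * (τ / (96 * (Fintype.card ι)^2)) * (d:ℝ))) : False := by
  have hK := H.hK
  have hn := hw.card_pos
  have hrp := hw.r1_pos
  have hr1 := hw.r1_le
  have hτ := hw.hτ
  have hτ1 := hw.tau_le1
  have hrn := hw.r1_ge
  have hge := hw.ge i1
  set nn := Fintype.card ι with hnn
  set n : ℝ := (nn : ℝ) with hndef
  set r1 := r i1 with hr1def
  have hdpos : (0:ℝ) < d := by linarith
  set X : ℝ := 2 ^ (j * (τ / (96 * n^2)) * (d:ℝ)) with hX
  have hX1 : 1 ≤ X := Real.one_le_rpow one_le_two (by positivity)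
  set B : ℝ := K^3 * (n + 1)^2 with hB
  have hB0 : 0 ≤ B := by positivity
  set w : (Fin j → Option ι) → ℝ := fun I => tmin (hE f f1 r i1 (p + d) d x0) A I with hwdef
  have hℓ0 : 0 < ℓ := by rw [hℓ]; positivity
  have hx0 : x0 ∈ Icc x0 (x0 + ℓ) := ⟨le_rfl, by linarith⟩
  have hwX : ∀ I, |w I| ≤ X := hA x0 hx0
  have hp' : 3 * (d:ℝ) ≤ p := by exact_mod_cast hp
  have hy1 : ∀ I : Fin j → Option ι, (∃ a, I a = some i1) → (∀ a, I a ≠ none) →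
      |w I| ≤ (4 + B) * X * 2 ^ (-(d:ℝ)) := by
    rintro I ⟨a0, ha0⟩ hIn
    exact y1_bd H hw p d hdpos.le hp' x0 ℓ hℓ hsub X (by linarith) A hA I a0 ha0 hIn
  have hpl := pluecker (fun k b => hvec (hE f f1 r i1 (p + d) d x0) (A b) k) none (some i1)
    (by simp) X ((4 + B) * X * 2 ^ (-(d:ℝ))) (fun I _ _ => hwX I) hy1
  set cs := 1 / (1 + r1) with hcs
  have hcs1 : cs * (1 + r1) = 1 := by rw [hcs]; field_simp
  have hcs2 : 1 / 2 ≤ cs := by rw [hcs]; apply one_div_le_one_div_of_le <;> linarith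
  obtain ⟨xb, hxb0, hxbc, hxz, hxv⟩ := xb_choice (i1 := i1) w cs d X
    ((j.factorial : ℝ) * X * ((4 + B) * X * 2 ^ (-(d:ℝ)))) hdpos (by linarith) hX1 hwX
    (fun S I h1 h2 h3 h4 => hpl S I h1 h2 h3 h4)
  set σ0 := 1 / (12 * n) with hσ0
  have hσn : σ0 * n = 1/12 := by rw [hσ0]; field_simp
  have hσpos : 0 < σ0 := by positivity
  have hσle : σ0 ≤ 1/12 := by
    have := mul_le_mul_of_nonneg_left hn hσpos.le
    linarith
  have hσd : 2 ≤ σ0 * d := by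
    have := mul_le_mul_of_nonneg_left hd1 hσpos.le
    linarith
  set σs := min (xb + σ0) cs with hσs
  have hσs0 : σ0 ≤ σs := le_min (by linarith) (by linarith)
  set D := ⌊(1 + r1) * σs * d⌋₊ with hD
  have hDnn : 0 ≤ (1 + r1) * σs * d := by
    have : 0 ≤ σs := by linarith
    positivity
  have hD1 : (D:ℝ) ≤ (1 + r1) * σs * d := Nat.floor_le hDnn
  have hD2 : (1 + r1) * σs * d < D + 1 := Nat.lt_floor_add_one _
  have hσc : σs ≤ cs := min_le_right _ _
  have hDd : (D:ℝ) ≤ d := by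
    refine hD1.trans ?_
    have h1 := mul_le_mul_of_nonneg_left hσc (show 0 ≤ 1 + r1 by linarith)
    have h2 : (1 + r1) * σs ≤ 1 := by linarith
    have h3 := mul_le_mul_of_nonneg_right h2 hdpos.le
    linarith
  have hDd' : D ≤ d := by exact_mod_cast hDd
  set s : ℝ := D / (1 + r1) with hs
  have hsD : s * (1 + r1) = D := by rw [hs]; field_simp
  have hs1 : s ≤ σs * d := by
    rw [hs, div_le_iff₀ (by linarith)]; linarith
  have hs2 : σs * d - 1 ≤ s := by
    rw [hs, le_div_iff₀ (by linarith)]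
    have : (σs * d - 1) * (1 + r1) = (1 + r1) * σs * d - 1 - r1 := by ring
    linarith
  have hs0 : 0 ≤ s := by positivity
  have hsσ : σ0 * d / 2 ≤ s := by
    have : σ0 * d ≤ σs * d := by gcongr
    linarith
  set d' := 2 * d - D with hd'
  have hd'r : (d':ℝ) = 2 * d - D := by
    rw [hd', Nat.cast_sub (by omega)]; push_cast; ring
  apply hnd d' (by omega) (by omega)
  set t := tt r1 (p + d : ℝ) d with ht
  have ht' : tt r1 p d' = t - s := by
    rw [ht, tt, tt, hs, hd'r, ← sub_div]; congr 1; ring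
  set e : ℝ := (d - D) / (2 * n) with he
  have he0 : 0 ≤ e := div_nonneg (by linarith) (by linarith)
  have hen : e * (2 * n) = d - D := by rw [he]; field_simp
  -- exponent difference
  set g : Option ι → ℝ := fun k => Ex r i1 p d' k - Ex r i1 (p + d) d k with hg
  have hgn : g none = -s := by
    simp only [hg, Ex, Option.elim, ← hr1def, ht', ← ht]; ring
  have hg1 : g (some i1) = d - s := by
    simp only [hg, Ex, Option.elim, ← hr1def, ht', ← ht, if_true]; ring
  have hgi : ∀ i, i ≠ i1 → g (some i) = r i * s - e := by
    intro i hi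
    simp only [hg, Ex, Option.elim, ← hr1def, ht', ← ht, if_neg hi]
    rw [he, hd'r, ← hnn]; ring
  have htr : ∀ I, tmin (hE f f1 r i1 p d' x0) A I = 2 ^ (∑ a, g (I a)) * w I := by
    intro I
    simp only [hwdef]
    rw [tmin_hE, tmin_hE, ← mul_assoc, ← Real.rpow_add two_pos, ← Finset.sum_add_distrib]
    congr 2
    refine Finset.sum_congr rfl fun a _ => ?_
    simp only [hg]; ring
  have hfac : (1:ℝ) ≤ j.factorial := by exact_mod_cast Nat.one_le_iff_ne_zero.2 (Nat.factorial_ne_zero j)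
  set m := τ / (48 * n) with hm
  have hmσ : m = τ * σ0 / 4 := by rw [hm, hσ0]; field_simp; norm_num
  have hmle : 2 * m ≤ σ0 / 2 := by
    rw [hmσ]
    have := mul_le_mul_of_nonneg_right hτ1 hσpos.le
    linarith
  set Q : ℝ := j.factorial * (4 + B) * X^2 with hQ
  have hQX : X ≤ Q := by
    have h1 : (1:ℝ) ≤ j.factorial * (4 + B) := one_le_mul_of_one_le_of_one_le hfac (by linarith)
    have h2 : X ≤ X^2 := by
      rw [pow_two]; exact le_mul_of_one_le_left (by linarith) hX1
    exact h2.trans (le_mul_of_one_le_left (sq_nonneg X) h1)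
  have hQ4 : (4 + B) * X ≤ Q := by
    rw [hQ]
    have : X ≤ X^2 := by rw [pow_two]; exact le_mul_of_one_le_left (by linarith) hX1
    calc (4+B) * X ≤ (4 + B) * X^2 := by gcongr
      _ ≤ j.factorial * ((4 + B) * X^2) := le_mul_of_one_le_left (by positivity) hfac
      _ = _ := by ring
  have key : ∀ I, |tmin (hE f f1 r i1 p d' x0) A I| ≤ Q * 2 ^ (-(2 * m * d)) := by
    intro I
    by_cases hinj : Function.Injective I
    swap
    · rw [tmin_eq_mi, mi_of_not_inj _ _ hinj, abs_zero]; positivity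
    rw [htr, abs_mul, abs_of_pos (by positivity)]
    exact key_bd hw hj1 hjn g w d s e X B xb σ0 σs cs m Q hdpos hσn hσpos hσle hσd hd2 hmσ hmle hgn
      hg1 hgi hs0 hs1 hs2 hsσ hσs he0 (by rw [hen, hsD]) hcs1 hcs2 hwX hy1 hxz hxv hX1 hB0 hQ hQX
      hQ4 I hinj
  -- final size
  have hjr : (0:ℝ) < j := by exact_mod_cast hj1
  have hX2 : X^2 ≤ 2 ^ (m * d) := by
    rw [hX, ← Real.rpow_natCast, ← Real.rpow_mul two_pos.le]
    apply r2_le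
    have : (j:ℝ) ≤ n := by rw [hndef]; exact_mod_cast hjn
    calc (j * (τ / (96 * n ^ 2)) * (d:ℝ)) * ((2:ℕ):ℝ) ≤ (n * (τ / (96 * n ^ 2)) * (d:ℝ)) * ((2:ℕ):ℝ) := by gcongr
      _ = m * d := by rw [hm]; push_cast; field_simp; norm_num
  have hfin : Q * 2 ^ (-(2 * m * d)) ≤ (1 / (j:ℝ)) ^ j := by
    have h1 : (nn.factorial : ℝ) ≥ j.factorial := by exact_mod_cast Nat.factorial_le hjn
    have h2 : ((j:ℝ) ^ j) ≤ n ^ nn := by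
      rw [hndef]
      exact_mod_cast (Nat.pow_le_pow_left hjn j).trans (Nat.pow_le_pow_right (by omega) hjn)
    have h3 : (j:ℝ) ^ j * (j.factorial * (4 + B)) ≤ 2 ^ (m * d) := by
      calc (j:ℝ) ^ j * (j.factorial * (4 + B)) ≤ n ^ nn * (nn.factorial * (4 + B)) := by gcongr
        _ = n ^ nn * nn.factorial * (4 + B) * 1 := by ring
        _ ≤ n ^ nn * nn.factorial * (4 + B) * K := by gcongr
        _ ≤ _ := hd3
    rw [one_div, inv_pow, ← one_div, le_div_iff₀ (by positivity)]
    calc Q * 2 ^ (-(2 * m * d)) * (j:ℝ)^j = ((j:ℝ) ^ j * (j.factorial * (4 + B))) * X^2 * 2 ^ (-(2 * m * d)) := by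
          rw [hQ]; ring
      _ ≤ 2 ^ (m * d) * 2 ^ (m * d) * 2 ^ (-(2 * m * d)) := by gcongr
      _ = 1 := by
          rw [← Real.rpow_add two_pos, ← Real.rpow_add two_pos]
          rw [show m * d + m * d + -(2 * m * d) = 0 by ring, Real.rpow_zero]
  have hf1 : f1 i1 x0 ≠ 0 := by
    intro h
    have := H.low i1 x0 (hsub hx0)
    rw [h] at this; simp at this; linarith
  obtain ⟨v, hv0, hv⟩ := minkowski_tup hj1 hAV (hE f f1 r i1 p d' x0)
    (fun w' hw' => Mx_inj hf1 _ (fun k => (Real.rpow_pos_of_pos two_pos _).ne') w' hw')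
    (1 / j) (by positivity) (fun I => (key I).trans hfin)
  refine ⟨v, hv0, fun k => ?_⟩
  have := hv k
  rw [hE, hvec_diag, abs_mul, abs_of_pos (by positivity), mul_one_div_cancel hjr.ne'] at this
  rw [Real.rpow_neg two_pos.le, ← one_div, le_div_iff₀ (by positivity)]
  linarith

end curve
end Part8

section Part9
open MeasureTheory Set

section curve
variable {ι : Type} [Fintype ι] [DecidableEq ι]
variable {f f1 f2 : ι → ℝ → ℝ} {K C α : ℝ} {r : ι → ℝ} {τ : ℝ} {i1 : ι}

lemma sumE_ge (hw : Wt r τ i1) (q d : ℝ) (hd : 0 ≤ d) (hq : d ≤ τ / 2 * q) (hq0 : 0 ≤ q)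
    {j : ℕ} (I : Fin j → Option ι) (hI : Function.Injective I) (h0 : ∃ a, I a = none) :
    d / 2 ≤ ∑ a, Ex r i1 q d (I a) := by
  have hn := hw.card_pos
  have hrp := hw.r1_pos
  have hr1 := hw.r1_le
  have hge := hw.ge i1
  have hte := tt_eq hw q d
  have ht0 : 0 ≤ tt (r i1) q d := by rw [tt]; positivity
  rw [sum_inj (i1 := i1) _ I hI, if_pos h0]
  have hT := Ts_sum hw I
  have hTc := Ts_card_le (i1 := i1) I
  have hTg : ∑ i ∈ Ts i1 I, Ex r i1 q d (some i) =
      -(tt (r i1) q d * ∑ i ∈ Ts i1 I, r i) - (Ts i1 I).card * (d / (2 * Fintype.card ι)) := by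
    rw [Finset.sum_congr rfl (g := fun i => -(r i * tt (r i1) q d) - d / (2 * Fintype.card ι)),
      Finset.sum_sub_distrib, Finset.sum_neg_distrib, ← Finset.sum_mul, Finset.sum_const,
      nsmul_eq_mul]
    · ring
    · intro i hi; simp only [Ts, Finset.mem_filter] at hi
      simp only [Ex, Option.elim, if_neg hi.2.1]; ring
  rw [hTg]
  have e1 : Ex r i1 q d none = tt (r i1) q d := rfl
  have e2 : Ex r i1 q d (some i1) = tt (r i1) q d - q := by simp [Ex]
  rw [e1, e2]
  set t := tt (r i1) q d
  set n : ℝ := (Fintype.card ι : ℝ)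
  have h1 := mul_le_mul_of_nonneg_left hT ht0
  have h2 : ((Ts i1 I).card : ℝ) * (d / (2 * n)) ≤ d / 2 := by
    calc ((Ts i1 I).card : ℝ) * (d / (2 * n)) ≤ n * (d / (2 * n)) := by
          apply mul_le_mul_of_nonneg_right (by linarith); positivity
      _ = d / 2 := by field_simp
  split_ifs
  · linarith
  · have h3 : q / 2 ≤ t := by
      have : t * (1 + r i1) ≤ t * 2 := mul_le_mul_of_nonneg_left (by linarith) ht0
      linarith
    have h4 : τ * (q / 2) ≤ r i1 * t := mul_le_mul hge h3 (by linarith) hrp.le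
    linarith

/-- auxiliary matrix: only the `none` row is nontrivial -/
noncomputable def Mn (f : ι → ℝ → ℝ) (x : ℝ) : Matrix (Option ι) (Option ι) ℝ :=
  Matrix.of fun k l => if k = none then l.elim 1 (fun i => f i x) else if l = k then 1 else 0

lemma nd_ex (H : Crv f f1 f2 K C α) (c : Option ι → ℝ) (k : Option ι) (hk : 1 ≤ |c k|) :
    ∃ x ∈ Ico (0:ℝ) 1, 1 / (2 * K) ≤ |U0 f c x| := by
  by_contra hcon
  push Not at hcon
  have := H.nd c (1 / (2 * K)) (fun x hx => (hcon x hx).le) k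
  have hK := H.hK
  have h2 : K * (1 / (2 * K)) = 1 / 2 := by field_simp
  linarith

lemma root_c (H : Crv f f1 f2 K C α) (hw : Wt r τ i1)
    {V : Submodule ℚ (Option ι → ℚ)} {j : ℕ} (hj1 : 1 ≤ j) (A : Fin j → Option ι → ℤ)
    (hAV : TupIn V A) : ∃ I : Fin j → Option ι, (∃ a, I a = none) ∧ ∃ x ∈ Ico (0:ℝ) 1,
      1 / (2 * K^3 * (Fintype.card ι + 1)) ≤ |tmin (Mx f f1 i1 x) A I| := by
  obtain ⟨K0, hK0⟩ := exists_tmin_one_ne hAV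
  have hinj := tmin_inj _ _ _ hK0
  have hK1 := tmin_one_ge _ _ hK0
  have hK := H.hK
  have hn := hw.card_pos
  have hK3 : K ≤ K^3 := by
    calc K = K^1 := (pow_one K).symm
      _ ≤ K^3 := pow_le_pow_right₀ hK (by norm_num)
  have hc : 1 / (2 * K^3 * (Fintype.card ι + 1)) ≤ 1 / (2 * K) := by
    apply one_div_le_one_div_of_le (by linarith)
    calc 2 * K ≤ 2 * K^3 * 1 := by linarith
      _ ≤ _ := by apply mul_le_mul_of_nonneg_left (by linarith); positivity
  by_cases hb : (∃ a, K0 a = none) ∧ ∃ a, K0 a = some i1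
  · obtain ⟨⟨a0, h0⟩, a1, h1⟩ := hb
    have h01 : a1 ≠ a0 := by rintro rfl; rw [h0] at h1; simp at h1
    obtain ⟨x, hx, hxQ⟩ := nd_ex H (fun l => tmin 1 A (Function.update K0 a0 l)) none (by
      simpa [← h0] using hK1)
    have hxI := Ico_subset_Icc_self hx
    have hQ : rowdet (Mx f f1 i1 x) A K0 a1 (some i1) =
        U0 f (fun l => tmin 1 A (Function.update K0 a0 l)) x := by
      have e1 : rowdet (Mx f f1 i1 x) A K0 a1 (some i1) = rowdet (Mn f x) A K0 a1 (some i1) := by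
        unfold rowdet
        congr 1
        ext a b
        by_cases ha : a = a1
        · subst ha; simp
        · rw [Matrix.updateRow_ne ha, Matrix.updateRow_ne ha]
          simp only [Matrix.of_apply, hvec, Matrix.mulVec, dotProduct]
          refine Finset.sum_congr rfl fun l _ => ?_
          congr 1
          rcases hKa : K0 a with _ | i
          · cases l <;> simp [Mn]
          · have hi : i ≠ i1 := by
              rintro rfl; exact ha (hinj (hKa.trans h1.symm))
            rw [Mx_u i hi]; simp [Mn]
      rw [e1, rowdet_unit _ _ _ _ _ (fun l => by simp [Mn]), ← h1, Function.update_eq_self]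
      conv_lhs => rw [← Function.update_eq_self a0 K0, h0]
      rw [tmin_expand, Fintype.sum_option, U0]
      have e2 : ∀ l, rowdet (Mn f x) A K0 a0 l = tmin 1 A (Function.update K0 a0 l) := by
        intro l
        apply rowdet_one
        intro a ha l
        have : K0 a ≠ none := fun h => ha (hinj (h.trans h0.symm))
        simp [Mn, this]
      simp only [e2]
      simp [Mn]
    have hexp := tmin_expand (Mx f f1 i1 x) A K0 a1 (some i1)
    rw [← h1, Function.update_eq_self, h1, Fintype.sum_option] at hexp
    simp only [Mx_1n, Mx_1s, zero_mul, zero_add] at hexp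
    rw [← Finset.add_sum_erase _ _ (Finset.mem_univ i1), hQ] at hexp
    by_contra hcon
    push Not at hcon
    set c := 1 / (2 * K^3 * ((Fintype.card ι : ℝ) + 1)) with hcdef
    have hc0 : 0 < c := by positivity
    have g1 := hcon K0 ⟨a0, h0⟩ x hx
    have g2 : |∑ i ∈ Finset.univ.erase i1, f1 i x * rowdet (Mx f f1 i1 x) A K0 a1 (some i)| ≤
        Fintype.card ι * (K * c) := by
      refine (Finset.abs_sum_le_sum_abs _ _).trans ?_
      calc _ ≤ ∑ i ∈ Finset.univ.erase i1, K * c := by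
            refine Finset.sum_le_sum fun i hi => ?_
            have hi' := Finset.ne_of_mem_erase hi
            rw [abs_mul, rowdet_unit _ _ _ _ _ (fun l => Mx_u i hi' l)]
            refine mul_le_mul (H.b1 i x hxI) (hcon _ ⟨a0, ?_⟩ x hx).le (abs_nonneg _) (by linarith)
            rw [Function.update_of_ne h01.symm, h0]
        _ ≤ _ := by
            rw [Finset.sum_const, nsmul_eq_mul]
            apply mul_le_mul_of_nonneg_right _ (by positivity)
            exact_mod_cast Finset.card_le_univ _
    have g3 : |f1 i1 x * U0 f (fun l => tmin 1 A (Function.update K0 a0 l)) x| <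
        c + Fintype.card ι * (K * c) := by
      rw [← sub_eq_iff_eq_add] at hexp
      rw [← hexp]
      exact (abs_sub _ _).trans_lt (by linarith)
    have g4 : 1 / (2 * K^2) ≤ |f1 i1 x * U0 f (fun l => tmin 1 A (Function.update K0 a0 l)) x| := by
      rw [abs_mul]
      have := H.low i1 x hxI
      have h5 : 1 / K ≤ |f1 i1 x| := by
        rw [div_le_iff₀ (by linarith)]; linarith
      calc 1 / (2 * K^2) = 1 / K * (1 / (2 * K)) := by field_simp
        _ ≤ _ := mul_le_mul h5 hxQ (by positivity) (abs_nonneg _)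
    have g5 : c + Fintype.card ι * (K * c) ≤ 1 / (2 * K^2) := by
      calc c + Fintype.card ι * (K * c) ≤ K * c + Fintype.card ι * (K * c) := by
            have := le_mul_of_one_le_left hc0.le hK
            linarith
        _ = 1 / (2 * K^2) := by rw [hcdef]; field_simp; ring
    linarith
  · obtain ⟨a0, ha0, ha1⟩ : ∃ a0, (∀ a, a ≠ a0 → K0 a ≠ none) ∧ (∀ a, a ≠ a0 → K0 a ≠ some i1) := by
      by_cases h0 : ∃ a, K0 a = none
      · obtain ⟨a0, h0⟩ := h0
        refine ⟨a0, fun a ha h => ha (hinj (h.trans h0.symm)), fun a _ h => hb ⟨⟨a0, h0⟩, a, h⟩⟩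
      · by_cases h1 : ∃ a, K0 a = some i1
        · obtain ⟨a0, h1⟩ := h1
          exact ⟨a0, fun a _ h => h0 ⟨a, h⟩, fun a ha h => ha (hinj (h.trans h1.symm))⟩
        · exact ⟨⟨0, hj1⟩, fun a _ h => h0 ⟨a, h⟩, fun a _ h => h1 ⟨a, h⟩⟩
    obtain ⟨x, hx, hxQ⟩ := nd_ex H (fun l => tmin 1 A (Function.update K0 a0 l)) (K0 a0) (by
      simpa using hK1)
    refine ⟨Function.update K0 a0 none, ⟨a0, by simp⟩, x, hx, hc.trans ?_⟩
    rw [tmin_Mx_n A K0 a0 ha0 ha1]; exact hxQ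

/-- the normalized matrix -/
noncomputable def hh (f f1 : ι → ℝ → ℝ) (r : ι → ℝ) (i1 : ι) (γ q d : ℝ) (x : ℝ) :
    Matrix (Option ι) (Option ι) ℝ :=
  Matrix.diagonal (fun k => (2:ℝ) ^ (Ex r i1 q d k - γ * d)) * Mx f f1 i1 x

lemma tmin_hh (γ q d x : ℝ) {j : ℕ} (A : Fin j → Option ι → ℤ) (I : Fin j → Option ι) :
    tmin (hh f f1 r i1 γ q d x) A I =
      2 ^ (∑ a, Ex r i1 q d (I a) - j * γ * d) * tmin (Mx f f1 i1 x) A I := by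
  rw [hh, tmin_diag, ← Real.rpow_sum_of_pos two_pos]
  congr 2
  simp [Finset.sum_sub_distrib]; ring

lemma LL_ge (hK : 1 ≤ K) (hn : (1:ℝ) ≤ Fintype.card ι) :
    2 * K^3 * (Fintype.card ι + 1) ≤ LL ι K := by
  unfold LL
  set n : ℝ := (Fintype.card ι : ℝ)
  have h1 : 1 ≤ n ^ Fintype.card ι := one_le_pow₀ hn
  have h2 : (1:ℝ) ≤ (Fintype.card ι).factorial := by
    exact_mod_cast Nat.one_le_iff_ne_zero.2 (Nat.factorial_ne_zero _)
  have h3 : 1 ≤ n ^ Fintype.card ι * (Fintype.card ι).factorial :=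
    one_le_mul_of_one_le_of_one_le h1 h2
  have h4 : 2 * K^3 * (n + 1) ≤ 4 + K^3 * (n+1)^2 := by
    have : K^3 * (n+1) * 2 ≤ K^3 * (n+1) * (n+1) :=
      mul_le_mul_of_nonneg_left (by linarith) (by positivity)
    nlinarith
  have h5 : 0 ≤ 4 + K^3 * (n+1)^2 := by positivity
  calc _ ≤ _ := h4
    _ ≤ n ^ Fintype.card ι * (Fintype.card ι).factorial * (4 + K^3 * (n+1)^2) :=
        le_mul_of_one_le_left h5 h3
    _ ≤ _ := le_mul_of_one_le_right (by positivity) hK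

lemma fin_bd (hw : Wt r τ i1) (d c S j : ℝ) (hd : 0 ≤ d) (hc : 0 < c)
    (hj : j ≤ Fintype.card ι + 1)
    (hS : d / 2 ≤ S) (hcL : 1 / c ≤ 2 ^ (τ / (48 * Fintype.card ι) * d)) :
    1 ≤ 2 ^ (S - j * (τ / (96 * (Fintype.card ι)^2)) * d) * c := by
  have hn := hw.card_pos
  have hτ := hw.hτ
  have hτn := hw.tau_le
  set n : ℝ := (Fintype.card ι : ℝ)
  have h1 : j * (τ / (96 * n^2)) * d ≤ τ / (48 * n) * d := by
    apply mul_le_mul_of_nonneg_right _ hd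
    calc j * (τ / (96 * n^2)) ≤ (2 * n) * (τ / (96 * n^2)) := by
          apply mul_le_mul_of_nonneg_right (by linarith); positivity
      _ = _ := by field_simp; norm_num
  have h2 : τ / (48 * n) ≤ 1 / 48 := by
    rw [div_le_iff₀ (by linarith)]; nlinarith [hw.tau_le1]
  have h3 : τ / (48 * n) * d ≤ S - j * (τ / (96 * n^2)) * d := by
    have := mul_le_mul_of_nonneg_right h2 hd
    linarith
  have h4 := hcL.trans (r2_le h3)
  rwa [div_le_iff₀ hc] at h4

lemma finrank_le_opt (V : Submodule ℚ (Option ι → ℚ)) : Module.finrank ℚ V ≤ Fintype.card ι + 1 := by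
  have := Submodule.finrank_le V
  simpa using this

lemma local_sup (H : Crv f f1 f2 K C α) (hw : Wt r τ i1) (p d : ℕ)
    (hp : 8 * (d:ℝ) ≤ τ * (p + d)) (hd1 : 24 * (Fintype.card ι : ℝ) ≤ d) (hd2 : 12 ≤ τ * d)
    (hd3 : LL ι K ≤ 2 ^ (τ / (48 * Fintype.card ι) * d))
    (x0 ℓ : ℝ) (hℓ : ℓ = 2 ^ (-(p:ℝ)) / 2) (hsub : Icc x0 (x0 + ℓ) ⊆ Icc 0 1)
    (hnd : ∀ d' : ℕ, d ≤ d' → d' ≤ 2 * d → ¬ Dg f f1 r i1 p d' x0)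
    (V : Submodule ℚ (Option ι → ℚ)) (hV : V ≠ ⊥) :
    ∃ x ∈ Icc x0 (x0 + ℓ), 1 ≤ psi (hh f f1 r i1 (τ / (96 * (Fintype.card ι)^2)) (p + d) d x) V := by
  by_contra hcon
  push Not at hcon
  set γ := τ / (96 * (Fintype.card ι : ℝ)^2) with hγ
  have hn := hw.card_pos
  have hτ1 := hw.tau_le1
  have hK := H.hK
  have hj1 : 1 ≤ Module.finrank ℚ V := by
    rw [Nat.one_le_iff_ne_zero]; intro h; exact hV (Submodule.finrank_eq_zero.1 h)
  have hdp : (0:ℝ) ≤ d := by positivity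
  have hℓ0 : 0 < ℓ := by rw [hℓ]; positivity
  have hA1 : ∀ x ∈ Icc x0 (x0 + ℓ), ∀ I, |tmin (hh f f1 r i1 γ (p+d) d x) (AV V) I| < 1 :=
    fun x hx I => (tmin_le_tmax _ _ I).trans_lt (hcon x hx)
  have hp3 : 3 * d ≤ p := by
    have : τ * (p + d : ℝ) ≤ 1 * (p + d : ℝ) := mul_le_mul_of_nonneg_right hτ1 (by positivity)
    have : (3 * d : ℝ) ≤ p := by linarith
    exact_mod_cast this
  by_cases hjn : Module.finrank ℚ V ≤ Fintype.card ι
  · refine local_low H hw p d hp3 hd1 hd2 hd3 x0 ℓ hℓ hsub hnd hj1 hjn (AV V) (AV_tup V) ?_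
    intro x hx I
    have h1 := hA1 x hx I
    have h2 : tmin (hE f f1 r i1 (p + d) d x) (AV V) I =
        2 ^ (Module.finrank ℚ V * γ * d) * tmin (hh f f1 r i1 γ (p+d) d x) (AV V) I := by
      rw [tmin_hE, tmin_hh, ← mul_assoc, ← Real.rpow_add two_pos]
      congr 2; ring
    rw [h2, abs_mul, abs_of_pos (by positivity)]
    exact mul_le_of_le_one_right (by positivity) h1.le
  · have hjc : Module.finrank ℚ V = Fintype.card ι + 1 := by
      have := finrank_le_opt V
      omega
    obtain ⟨I, hI⟩ := exists_tmin_one_ne (AV_tup V)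
    have hinj := tmin_inj _ _ _ hI
    have hbij : Function.Bijective I := by
      rw [Fintype.bijective_iff_injective_and_card]
      exact ⟨hinj, by simp [hjc]⟩
    have hx0 : x0 ∈ Icc x0 (x0 + ℓ) := ⟨le_rfl, by linarith⟩
    have h1 := hA1 x0 hx0 I
    rw [tmin_hh, tmin_full _ _ _ hbij, Mx_det, abs_mul, abs_of_pos (by positivity), abs_mul] at h1
    have h2 := H.low i1 x0 (hsub hx0)
    have h3 : 1 / K ≤ |f1 i1 x0| * |tmin 1 (AV V) I| := by
      rw [div_le_iff₀ (by linarith)]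
      have := le_mul_of_one_le_right (abs_nonneg (f1 i1 x0)) (tmin_one_ge _ _ hI)
      have := mul_le_mul_of_nonneg_left this (show 0 ≤ K by linarith)
      linarith
    have h4 := fin_bd hw d (1 / K) (∑ a, Ex r i1 (p + d) d (I a)) (Module.finrank ℚ V) hdp
      (by positivity) (by rw [hjc]; push_cast; exact le_rfl)
      (sumE_ge hw _ _ hdp (by linarith) (by positivity) I hinj (hbij.2 none)) (by
        rw [one_div_one_div]
        refine le_trans ?_ hd3
        refine le_trans ?_ (LL_ge hK hn)
        have h6 : K ≤ K^3 := by
          calc K = K^1 := (pow_one K).symm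
            _ ≤ K^3 := pow_le_pow_right₀ hK (by norm_num)
        have : K^3 * 1 ≤ K^3 * (Fintype.card ι + 1) := mul_le_mul_of_nonneg_left (by linarith) (by positivity)
        linarith)
    have h5 := mul_le_mul_of_nonneg_left h3 (show (0:ℝ) ≤ 2 ^ (∑ a, Ex r i1 (p + d) d (I a) - (Module.finrank ℚ V) * γ * d) by positivity)
    linarith

lemma root_sup (H : Crv f f1 f2 K C α) (hw : Wt r τ i1) (q d : ℝ)
    (hd0 : 0 ≤ d) (hq : d ≤ τ / 2 * q) (hq0 : 0 ≤ q)
    (hd3 : LL ι K ≤ 2 ^ (τ / (48 * Fintype.card ι) * d))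
    (V : Submodule ℚ (Option ι → ℚ)) (hV : V ≠ ⊥) :
    ∃ x ∈ Ico (0:ℝ) 1, 1 ≤ psi (hh f f1 r i1 (τ / (96 * (Fintype.card ι)^2)) q d x) V := by
  set γ := τ / (96 * (Fintype.card ι : ℝ)^2) with hγ
  have hn := hw.card_pos
  have hK := H.hK
  have hj1 : 1 ≤ Module.finrank ℚ V := by
    rw [Nat.one_le_iff_ne_zero]; intro h; exact hV (Submodule.finrank_eq_zero.1 h)
  obtain ⟨I, h0, x, hx, hxI⟩ := root_c H hw hj1 (AV V) (AV_tup V)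
  have hc0 : 0 < 1 / (2 * K ^ 3 * ((Fintype.card ι : ℝ) + 1)) := by positivity
  have hinj := tmin_inj _ _ _ (fun h => by rw [h, abs_zero] at hxI; linarith)
  refine ⟨x, hx, le_trans ?_ (tmin_le_tmax _ _ I)⟩
  rw [tmin_hh, abs_mul, abs_of_pos (by positivity)]
  have h4 := fin_bd hw d _ (∑ a, Ex r i1 q d (I a)) (Module.finrank ℚ V) hd0 hc0
      (by exact_mod_cast finrank_le_opt V)
      (sumE_ge hw _ _ hd0 hq hq0 I hinj h0) (by
        rw [one_div_one_div]
        exact (LL_ge hK hn).trans hd3)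
  have h5 := mul_le_mul_of_nonneg_left hxI (show (0:ℝ) ≤ 2 ^ (∑ a, Ex r i1 q d (I a) - (Module.finrank ℚ V) * γ * d) by positivity)
  linarith

end curve
end Part9

section Part10
open MeasureTheory Set ENNReal

/-- counting dyadic intervals by measure -/
lemma count_bd (T : Finset ℕ) (q : ℕ) (E : Set ℝ) (hT : ∀ i ∈ T, dy q i ⊆ E) :
    (T.card : ℝ≥0∞) * ENNReal.ofReal (1 / 2 ^ q) ≤ volume E := by
  have h1 : volume (⋃ i ∈ T, dy q i) = ∑ i ∈ T, volume (dy q i) := by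
    apply measure_biUnion_finset
    · intro i _ j _ hij
      rw [Function.onFun, Set.disjoint_left]
      intro x hx hy
      have hx0 := dy_nonneg hx
      exact hij (((mem_dy_iff hx0).1 hx).symm.trans ((mem_dy_iff hx0).1 hy))
    · intro i _; exact meas_dy q i
  simp only [vol_dy, Finset.sum_const, nsmul_eq_mul] at h1
  rw [← h1]
  exact measure_mono (iUnion₂_subset hT)

/-- closed dyadic interval -/
def dyc (q i : ℕ) : Set ℝ := Icc ((i:ℝ) / 2 ^ q) (((i:ℝ) + 1) / 2 ^ q)

lemma dy_sub_dyc (q i : ℕ) : dy q i ⊆ dyc q i := Ico_subset_Icc_self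

lemma dyc_sub {q i : ℕ} (hi : i < 2 ^ q) : dyc q i ⊆ Icc 0 1 := by
  intro x hx
  refine ⟨le_trans (by positivity) hx.1, hx.2.trans ?_⟩
  rw [div_le_one (by positivity)]
  exact_mod_cast hi

lemma dyc_dist {q i : ℕ} {x y : ℝ} (hx : x ∈ dyc q i) (hy : y ∈ dyc q i) :
    |x - y| ≤ 2 ^ (-(q:ℝ)) := by
  have h1 : ((i:ℝ) + 1) / 2 ^ q = (i:ℝ) / 2 ^ q + 2 ^ (-(q:ℝ)) := by
    rw [Real.rpow_neg two_pos.le, Real.rpow_natCast]; field_simp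
  have := hx.1; have := hx.2; have := hy.1; have := hy.2
  rw [abs_le]; constructor <;> linarith

section curve
variable {ι : Type} [Fintype ι] [DecidableEq ι]
variable {f f1 f2 : ι → ℝ → ℝ} {K C α : ℝ} {r : ι → ℝ} {τ : ℝ} {i1 : ι}

lemma cont_Mx (H : Crv f f1 f2 K C α) (k l : Option ι) :
    ContinuousOn (fun x => Mx f f1 i1 x k l) (Icc 0 1) := by
  have c0 : ∀ i, ContinuousOn (f i) (Icc 0 1) := fun i x hx =>
    (H.d1 i x hx).continuousAt.continuousWithinAt
  have c1 : ∀ i, ContinuousOn (f1 i) (Icc 0 1) := fun i x hx =>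
    (H.d2 i x hx).continuousAt.continuousWithinAt
  rcases k with _ | k
  · rcases l with _ | l
    · simpa using continuousOn_const
    · simpa using c0 l
  · by_cases hk : k = i1
    · subst hk
      rcases l with _ | l
      · simpa using continuousOn_const
      · simpa using c1 l
    · simp only [Mx_u k hk l]; exact continuousOn_const

lemma good_psi (H : Crv f f1 f2 K C α) (γ q d η : ℝ) (hη : 0 < η)
    (V : Submodule ℚ (Option ι → ℚ)) (g i : ℕ) (hJ : dy g i ⊆ Icc 0 1)
    (hx : ∃ x ∈ dy g i, 1 ≤ psi (hh f f1 r i1 γ q d x) V) :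
    volume {x ∈ dy g i | psi (hh f f1 r i1 γ q d x) V < η} ≤
      ENNReal.ofReal (C * η ^ α) * volume (dy g i) := by
  obtain ⟨x, hx, h1⟩ := hx
  obtain ⟨I, hI⟩ := tmax_exists (hh f f1 r i1 γ q d x) (AV V)
  rw [psi, hI] at h1
  set s : ℝ := ∑ a, Ex r i1 q d (I a) - (Module.finrank ℚ V) * γ * d with hs
  have htm : ∀ y, |tmin (hh f f1 r i1 γ q d y) (AV V) I| = 2 ^ s * |tmin (Mx f f1 i1 y) (AV V) I| := by
    intro y; rw [tmin_hh, abs_mul, abs_of_pos (by positivity)]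
  have h2s : (0:ℝ) < 2 ^ s := by positivity
  have hsub : Icc ((i:ℝ) / 2 ^ g) (((i:ℝ) + 1) / 2 ^ g) ⊆ Icc 0 1 := by
    have hlt : (i:ℝ) / 2 ^ g < ((i:ℝ) + 1) / 2 ^ g := by
      apply div_lt_div_of_pos_right (by linarith); positivity
    rw [← closure_Ico hlt.ne]
    exact isClosed_Icc.closure_subset_iff.2 hJ
  have hlt : (i:ℝ) / 2 ^ g < ((i:ℝ) + 1) / 2 ^ g := by
    apply div_lt_div_of_pos_right (by linarith); positivity
  have hg := H.good i1 (Module.finrank ℚ V) (by simpa using finrank_le_opt V) (AV V) I _ _ hlt hsub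
    (1 / 2 ^ s) η (by positivity) hη ⟨x, dy_sub_dyc g i hx, by
      rw [htm] at h1; rw [div_le_iff₀ h2s]; linarith⟩
  calc volume {x ∈ dy g i | psi (hh f f1 r i1 γ q d x) V < η} ≤ _ := measure_mono ?_
    _ ≤ _ := hg
    _ = _ := by
      rw [vol_dy, ← ENNReal.ofReal_mul (by have := H.hC; positivity)]
      congr 1; congr 1; field_simp; ring
  rintro y ⟨hy, hyp⟩
  refine ⟨dy_sub_dyc g i hy, ?_⟩
  have := (tmin_le_tmax (hh f f1 r i1 γ q d y) (AV V) I).trans_lt hyp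
  rw [htm] at this
  rw [mul_one_div, lt_div_iff₀ h2s]; linarith

lemma meas_bd (H : Crv f f1 f2 K C α) (hw : Wt r τ i1) (γ q d C1 : ℝ) (hd : 0 ≤ d) (hq : 2 * d ≤ q)
    (hC1 : C1 = 2 + K^3 * (Fintype.card ι + 1)^2)
    (hd4 : 2 * (Fintype.card ι + 1) * C1 ≤ 2 ^ (γ * d))
    (g i : ℕ) (hJ : dy g i ⊆ Icc 0 1)
    (hsup : ∀ V : Submodule ℚ (Option ι → ℚ), V ≠ ⊥ → ∃ x ∈ dy g i, 1 ≤ psi (hh f f1 r i1 γ q d x) V) :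
    volume {x ∈ dy g i | ∃ y ∈ Icc (0:ℝ) 1, |x - y| ≤ 2 ^ (-q) ∧ Dg f f1 r i1 q d y} ≤
      ENNReal.ofReal (4 ^ (Fintype.card ι + 1) * (C * (2 * (Fintype.card ι + 1) * C1) ^ α) *
        2 ^ (-(α * γ * d))) * volume (dy g i) := by
  have hK := H.hK
  have hC := H.hC
  have hn := hw.card_pos
  have hC1p : 0 < C1 := by rw [hC1]; positivity
  set η : ℝ := 2 * (Fintype.card ι + 1) * C1 * 2 ^ (-(γ * d)) with hη
  have hη0 : 0 < η := by positivity
  have hη1 : η ≤ 1 := by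
    calc η ≤ 2 ^ (γ * d) * 2 ^ (-(γ * d)) := by
          rw [hη]; exact mul_le_mul_of_nonneg_right hd4 (by positivity)
      _ = 1 := by rw [← Real.rpow_add two_pos, add_neg_cancel, Real.rpow_zero]
  have hqn := qnd_final (hh f f1 r i1 γ q d) η hη1 (by
      intro k l
      simp only [hh, Matrix.diagonal_mul]
      exact continuousOn_const.mul (cont_Mx H k l))
    (ENNReal.ofReal (C * η ^ α)) (fun V _ g i hJ hx => good_psi H γ q d η hη0 V g i hJ hx) g i hJ hsup
  have hmono : volume {x ∈ dy g i | ∃ y ∈ Icc (0:ℝ) 1, |x - y| ≤ 2 ^ (-q) ∧ Dg f f1 r i1 q d y} ≤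
      ((4 ^ (Fintype.card (Option ι)) : ℕ) : ℝ≥0∞) * ENNReal.ofReal (C * η ^ α) * volume (dy g i) := by
    refine le_trans (measure_mono ?_) hqn
    rintro x ⟨hx, y, hy, hxy, hD⟩
    obtain ⟨v, hv0, hv⟩ := dg_ext H hw q d hd hq y x hy (hJ hx) hxy hD
    refine ⟨hx, v, hv0, C1 * 2 ^ (-(γ * d)), ?_, fun k => ?_⟩
    · rw [hη, Fintype.card_option]; push_cast
      have : 0 < ((Fintype.card ι : ℝ) + 1) * C1 * 2 ^ (-(γ * d)) := by positivity
      linarith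
    · rw [hh, hvec_diag, abs_mul, abs_of_pos (by positivity)]
      calc _ ≤ 2 ^ (Ex r i1 q d k - γ * d) * (C1 * 2 ^ (-Ex r i1 q d k)) := by
            rw [hC1]; exact mul_le_mul_of_nonneg_left (hv k) (by positivity)
        _ = C1 * (2 ^ (Ex r i1 q d k - γ * d) * 2 ^ (-Ex r i1 q d k)) := by ring
        _ = _ := by rw [← Real.rpow_add two_pos]; congr 2; ring
  refine hmono.trans (le_of_eq ?_)
  congr 1
  rw [Fintype.card_option]
  have : ((4 ^ (Fintype.card ι + 1) : ℕ) : ℝ≥0∞) = ENNReal.ofReal (4 ^ (Fintype.card ι + 1)) := by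
    rw [← ENNReal.ofReal_natCast]; push_cast; rfl
  rw [this, ← ENNReal.ofReal_mul (by positivity)]
  congr 1
  rw [hη, Real.mul_rpow (by positivity) (by positivity), ← Real.rpow_mul two_pos.le,
    show -(γ * d) * α = -(α * γ * d) by ring]
  ring

end curve

/-- the axiomatic output for one constraint -/
def Ctl (D : ℕ → ℕ → ℝ → Prop) (τ a : ℝ) : Prop :=
  ∃ C0 > (0:ℝ), ∃ D0 : ℕ, ∀ d ≥ D0, ∀ q : ℕ,
    (8 * (d:ℝ) ≤ τ * q → ∀ i' : ℕ, i' < 2 ^ (q - d) →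
      (∀ d', d ≤ d' → d' ≤ 2 * d → ¬ D (q - d) d' ((i':ℝ) / 2 ^ (q - d))) →
      ∀ T : Finset ℕ, (∀ i ∈ T, i / 2 ^ d = i' ∧ ∃ x ∈ dyc q i, D q d x) →
        (T.card : ℝ) ≤ C0 * 2 ^ (-(a * d)) * 2 ^ d) ∧
    ((d:ℝ) ≤ τ / 2 * q → ∀ T : Finset ℕ, (∀ i ∈ T, i < 2 ^ q ∧ ∃ x ∈ dyc q i, D q d x) →
        (T.card : ℝ) ≤ C0 * 2 ^ (-(a * d)) * 2 ^ q)

lemma Ctl.mono {D : ℕ → ℕ → ℝ → Prop} {τ a a' : ℝ} (h : Ctl D τ a) (ha : a' ≤ a) : Ctl D τ a' := by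
  obtain ⟨C0, hC0, D0, h⟩ := h
  have key : ∀ d : ℕ, C0 * (2:ℝ) ^ (-(a * d)) ≤ C0 * 2 ^ (-(a' * d)) := by
    intro d
    apply mul_le_mul_of_nonneg_left _ hC0.le
    apply r2_le
    have := mul_le_mul_of_nonneg_right ha (Nat.cast_nonneg (α := ℝ) d)
    linarith
  refine ⟨C0, hC0, D0, fun d hd q => ⟨fun h1 i' hi' h2 T hT => ?_, fun h1 T hT => ?_⟩⟩
  · exact ((h d hd q).1 h1 i' hi' h2 T hT).trans (mul_le_mul_of_nonneg_right (key d) (by positivity))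
  · exact ((h d hd q).2 h1 T hT).trans (mul_le_mul_of_nonneg_right (key d) (by positivity))

lemma count_conv (T : Finset ℕ) (q p : ℕ) (hpq : p ≤ q) (c : ℝ) (hc : 0 ≤ c)
    (h : (T.card : ℝ≥0∞) * ENNReal.ofReal (1 / 2 ^ q) ≤ ENNReal.ofReal c * ENNReal.ofReal (1 / 2 ^ p)) :
    (T.card : ℝ) ≤ c * 2 ^ (q - p) := by
  rw [← ENNReal.ofReal_natCast, ← ENNReal.ofReal_mul (by positivity), ← ENNReal.ofReal_mul hc,
    ENNReal.ofReal_le_ofReal_iff (by positivity)] at h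
  have h2 : (2:ℝ) ^ q = 2 ^ (q - p) * 2 ^ p := by rw [← pow_add]; congr 1; omega
  have h3 := mul_le_mul_of_nonneg_right h (show (0:ℝ) ≤ 2 ^ q by positivity)
  calc (T.card : ℝ) = T.card * (1 / 2 ^ q) * 2 ^ q := by field_simp
    _ ≤ c * (1 / 2 ^ p) * 2 ^ q := h3
    _ = c * 2 ^ (q - p) := by rw [h2]; field_simp

lemma ev_pow (L b : ℝ) (hb : 0 < b) : ∃ D0 : ℕ, ∀ d : ℕ, D0 ≤ d → L ≤ 2 ^ (b * d) := by
  obtain ⟨D0, hD0⟩ := exists_nat_ge (L / b)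
  obtain ⟨D1, hD1⟩ := exists_nat_ge (1 / b * Real.logb 2 (max L 1))
  refine ⟨D1, fun d hd => ?_⟩
  have h1 : Real.logb 2 (max L 1) ≤ b * d := by
    have : (D1:ℝ) ≤ d := by exact_mod_cast hd
    have h2 := hD1.trans this
    rw [one_div, inv_mul_le_iff₀ hb] at h2
    exact h2
  calc L ≤ max L 1 := le_max_left _ _
    _ = 2 ^ Real.logb 2 (max L 1) := (Real.rpow_logb two_pos (by norm_num) (by positivity)).symm
    _ ≤ _ := r2_le h1

section curve
variable {ι : Type} [Fintype ι] [DecidableEq ι]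
variable {f f1 f2 : ι → ℝ → ℝ} {K C α : ℝ} {r : ι → ℝ} {τ : ℝ} {i1 : ι}

theorem ctl_Dg (H : Crv f f1 f2 K C α) (hw : Wt r τ i1) :
    Ctl (fun q d x => Dg f f1 r i1 q d x) τ (α * (τ / (96 * (Fintype.card ι)^2))) := by
  have hK := H.hK
  have hC := H.hC
  have hα := H.hα
  have hn := hw.card_pos
  have hτ := hw.hτ
  have hτ1 := hw.tau_le1
  set γ := τ / (96 * (Fintype.card ι : ℝ)^2) with hγ
  set C1 : ℝ := 2 + K^3 * (Fintype.card ι + 1)^2 with hC1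
  have hC1p : 0 < C1 := by rw [hC1]; positivity
  obtain ⟨Da, hDa⟩ := ev_pow (LL ι K) (τ / (48 * Fintype.card ι)) (by positivity)
  obtain ⟨Db, hDb⟩ := ev_pow (2 * (Fintype.card ι + 1) * C1) γ (by positivity)
  obtain ⟨Dc, hDc⟩ := exists_nat_ge (24 * (Fintype.card ι : ℝ))
  obtain ⟨Dd, hDd⟩ := exists_nat_ge (12 / τ)
  set C0 := 4 ^ (Fintype.card ι + 1) * (C * (2 * (Fintype.card ι + 1) * C1) ^ α) with hC0
  have hC0p : 0 < C0 := by positivity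
  refine ⟨C0, hC0p, max (max Da Db) (max Dc Dd), fun d hd q => ?_⟩
  have hda := hDa d (by omega)
  have hdb := hDb d (by omega)
  have hdc : 24 * (Fintype.card ι : ℝ) ≤ d := hDc.trans (by exact_mod_cast (by omega))
  have hdd : 12 ≤ τ * d := by
    have : 12 / τ ≤ d := hDd.trans (by exact_mod_cast (by omega))
    rw [div_le_iff₀ hτ] at this; linarith
  have hq0 : (0:ℝ) ≤ q := by positivity
  have hd0 : (0:ℝ) ≤ d := by positivity
  have hτq : τ * q ≤ 1 * q := mul_le_mul_of_nonneg_right hτ1 hq0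
  refine ⟨fun h1 i' hi' h2 T hT => ?_, fun h1 T hT => ?_⟩
  · have hdq : d ≤ q := by
      have : (d:ℝ) ≤ q := by linarith
      exact_mod_cast this
    set p := q - d with hp
    have hqp : (q:ℝ) = p + d := by rw [hp, Nat.cast_sub hdq]; ring
    have hpos2 : (0:ℝ) < 2 ^ p := by positivity
    have hℓ : (2:ℝ) ^ (-(p:ℝ)) = 1 / 2 ^ p := by
      rw [Real.rpow_neg two_pos.le, Real.rpow_natCast, one_div]
    have hxsub : Icc ((i':ℝ) / 2^p) ((i':ℝ) / 2^p + 2 ^ (-(p:ℝ)) / 2) ⊆ dy p i' := by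
      intro x hx
      refine ⟨hx.1, hx.2.trans_lt ?_⟩
      rw [hℓ, add_div]
      have : 0 < 1 / (2:ℝ)^p := by positivity
      linarith
    have hJ : dy p i' ⊆ Icc 0 1 := (dy_sub_dyc _ _).trans (dyc_sub hi')
    have hsup : ∀ V : Submodule ℚ (Option ι → ℚ), V ≠ ⊥ →
        ∃ x ∈ dy p i', 1 ≤ psi (hh f f1 r i1 γ q d x) V := by
      intro V hV
      obtain ⟨x, hx, hx1⟩ := local_sup H hw p d (by rw [← hqp]; exact h1) hdc hdd hda _ _ rfl
        (hxsub.trans hJ) h2 V hV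
      refine ⟨x, hxsub hx, ?_⟩
      rw [hqp]; exact hx1
    have hm := meas_bd H hw γ q d C1 hd0 (by linarith) hC1 hdb p i' hJ hsup
    have hcount := (count_bd T q _ (fun i hi => ?_)).trans hm
    · rw [vol_dy] at hcount
      have := count_conv T q p (by omega) _ (by positivity) hcount
      rw [show q - p = d by omega] at this
      exact this
    · obtain ⟨hi1, y, hy, hD⟩ := hT i hi
      intro x hx
      have h3 : dy q i ⊆ dy p i' := by
        have := dy_sub_anc p d i
        rwa [hi1, show p + d = q by omega] at this
      refine ⟨h3 hx, y, ?_, dyc_dist (dy_sub_dyc _ _ hx) hy, hD⟩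
      refine dyc_sub ?_ hy
      calc i < 2 ^ d * (i / 2^d + 1) := Nat.lt_mul_div_succ i (by positivity)
        _ ≤ 2 ^ d * 2 ^ p := Nat.mul_le_mul_left _ (by omega)
        _ = 2 ^ q := by rw [← pow_add]; congr 1; omega
  · have hJe : dy 0 0 = Ico (0:ℝ) 1 := by simp [dy]
    have hJ : dy 0 0 ⊆ Icc 0 1 := by rw [hJe]; exact Ico_subset_Icc_self
    have hsup : ∀ V : Submodule ℚ (Option ι → ℚ), V ≠ ⊥ →
        ∃ x ∈ dy 0 0, 1 ≤ psi (hh f f1 r i1 γ q d x) V := by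
      intro V hV
      rw [hJe]
      exact root_sup H hw q d hd0 h1 hq0 hda V hV
    have hm := meas_bd H hw γ q d C1 hd0 (by linarith) hC1 hdb 0 0 hJ hsup
    have hcount := (count_bd T q _ (fun i hi => ?_)).trans hm
    · rw [vol_dy] at hcount
      exact count_conv T q 0 (by omega) _ (by positivity) hcount
    · obtain ⟨hi1, y, hy, hD⟩ := hT i hi
      intro x hx
      refine ⟨?_, y, dyc_sub hi1 hy, dyc_dist (dy_sub_dyc _ _ hx) hy, hD⟩
      rw [hJe]
      refine ⟨dy_nonneg hx, hx.2.trans_le ?_⟩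
      rw [div_le_one (by positivity)]
      exact_mod_cast hi1

end curve
end Part10

section Part11
open MeasureTheory Set

section cantor
open Classical

/-- survivors -/
def Surv (Rm : ℕ → ℕ → Prop) (q i : ℕ) : Prop :=
  i < 2 ^ q ∧ ∀ g, 1 ≤ g → g ≤ q → ¬ Rm g (i / 2 ^ (q - g))

lemma Surv.anc {Rm : ℕ → ℕ → Prop} {q i : ℕ} (h : Surv Rm q i) (d : ℕ) (hd : d ≤ q) :
    Surv Rm (q - d) (i / 2 ^ d) := by
  refine ⟨?_, fun g hg hgq => ?_⟩
  · rw [Nat.div_lt_iff_lt_mul (by positivity), ← pow_add]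
    convert h.1 using 2; omega
  · rw [Nat.div_div_eq_div_mul, ← pow_add, show d + (q - d - g) = q - g by omega]
    exact h.2 g hg (by omega)

lemma surv_succ {Rm : ℕ → ℕ → Prop} {q i : ℕ} :
    Surv Rm (q+1) i ↔ Surv Rm q (i / 2) ∧ ¬ Rm (q+1) i := by
  constructor
  · intro h
    refine ⟨by simpa using h.anc 1 (by omega), by simpa using h.2 (q+1) (by omega) le_rfl⟩
  · rintro ⟨h1, h2⟩
    refine ⟨?_, fun g hg hgq => ?_⟩
    · have := h1.1; rw [pow_succ]; omega
    · rcases Nat.lt_or_ge g (q+1) with h | h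
      · have := h1.2 g hg (by omega)
        rwa [Nat.div_div_eq_div_mul, ← pow_succ', show q - g + 1 = q + 1 - g by omega] at this
      · have : g = q + 1 := by omega
        subst this; simpa using h2

/-- survivors as a finset -/
noncomputable def SF (Rm : ℕ → ℕ → Prop) (q : ℕ) : Finset ℕ := (Finset.range (2 ^ q)).filter (Surv Rm q)

lemma mem_SF {Rm : ℕ → ℕ → Prop} {q i : ℕ} : i ∈ SF Rm q ↔ Surv Rm q i := by
  simp only [SF, Finset.mem_filter, Finset.mem_range]
  exact ⟨fun h => h.2, fun h => ⟨h.1, h⟩⟩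

/-- children -/
noncomputable def CF (Rm : ℕ → ℕ → Prop) (q : ℕ) : Finset ℕ :=
  (SF Rm q).biUnion fun i => {2 * i, 2 * i + 1}

lemma mem_CF {Rm : ℕ → ℕ → Prop} {q i : ℕ} : i ∈ CF Rm q ↔ Surv Rm q (i / 2) := by
  simp only [CF, Finset.mem_biUnion, mem_SF, Finset.mem_insert, Finset.mem_singleton]
  constructor
  · rintro ⟨j, hj, rfl | rfl⟩
    · rwa [show 2 * j / 2 = j by omega]
    · rwa [show (2 * j + 1) / 2 = j by omega]
  · intro h; exact ⟨i / 2, h, by omega⟩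

lemma card_CF (Rm : ℕ → ℕ → Prop) (q : ℕ) : (CF Rm q).card = 2 * (SF Rm q).card := by
  rw [CF, Finset.card_biUnion]
  · rw [Finset.sum_congr rfl (g := fun _ => 2)]
    · simp [mul_comm]
    · intro i _; rw [Finset.card_pair]; omega
  · intro i _ j _ hij
    rw [Function.onFun, Finset.disjoint_left]
    intro x hx hy
    simp only [Finset.mem_insert, Finset.mem_singleton] at hx hy
    omega

theorem cantor_count (Bd : ℕ → ℕ → ℕ → ℕ → Prop) (X : ℕ → ℕ → Prop) (Rm : ℕ → ℕ → Prop)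
    (hRm : ∀ q i, Rm q i ↔ (∃ k d, Bd k q d i) ∨ X q i)
    (e : ℕ → ℕ → ℝ) (he0 : ∀ k d, 0 ≤ e k d) (ω : ℝ) (hω : 0 < ω) (hω1 : ω < 1)
    (hkd : ∀ k q d i, Bd k q d i → k ≤ q ∧ 1 ≤ d ∧ d ≤ q)
    (hcnt : ∀ k q d, 1 ≤ d → d ≤ q →
      (∀ i', Surv Rm (q - d) i' → ∀ T : Finset ℕ, (∀ i ∈ T, i / 2 ^ d = i' ∧ Bd k q d i) →
        (T.card : ℝ) ≤ e k d * (1 - ω) ^ d * 2 ^ d) ∨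
      (∀ T : Finset ℕ, (∀ i ∈ T, i < 2 ^ q ∧ Bd k q d i) →
        (T.card : ℝ) ≤ e k d * (1 - ω) ^ q * 2 ^ q))
    (he : ∀ q, ∑ k ∈ Finset.range (q+1), ∑ d ∈ Finset.range (q+1), e k d ≤ ω / 2)
    (hX : ∀ q, ∀ T : Finset ℕ, (∀ i ∈ T, i < 2 ^ (q+1) ∧ X (q+1) i) →
      (T.card : ℝ) ≤ ω * (2 * (1 - ω)) ^ q) (q : ℕ) :
    2 * (1 - ω) * (SF Rm q).card ≤ (SF Rm (q+1)).card := by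
  induction q using Nat.strong_induction_on with
  | _ q ih =>
  set b := 2 * (1 - ω) with hb
  have hb0 : 0 < b := by rw [hb]; linarith
  have h0 : ((SF Rm 0).card : ℝ) = 1 := by
    have : SF Rm 0 = {0} := by
      ext i; rw [mem_SF, Finset.mem_singleton]
      constructor
      · intro h; simpa using h.1
      · rintro rfl; exact ⟨by simp, fun g h1 h2 => by omega⟩
    rw [this]; simp
  have hgr : ∀ m, ∀ g, g + m = q → b ^ m * (SF Rm g).card ≤ (SF Rm q).card := by
    intro m
    induction m with
    | zero => intro g hg; simp at hg; subst hg; simp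
    | succ m ihm =>
      intro g hg
      have h1 := ihm (g+1) (by omega)
      have h2 := ih g (by omega)
      calc b ^ (m+1) * ((SF Rm g).card : ℝ) = b ^ m * (b * (SF Rm g).card) := by ring
        _ ≤ b ^ m * (SF Rm (g+1)).card := mul_le_mul_of_nonneg_left h2 (by positivity)
        _ ≤ _ := h1
  set N : ℝ := ((SF Rm q).card : ℝ) with hN
  have hN0 : 0 ≤ N := by positivity
  have hbN : b * N ≤ 2 * N := mul_le_mul_of_nonneg_right (by linarith) hN0
  -- bound for each removal
  have hrem : ∀ k d, (((CF Rm q).filter (fun i => Bd k (q+1) d i)).card : ℝ) ≤ e k d * (2 * N) := by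
    intro k d
    by_cases hd : 1 ≤ d ∧ d ≤ q + 1
    swap
    · rw [Finset.card_eq_zero.2]
      · simp only [Nat.cast_zero]; exact mul_nonneg (he0 k d) (by linarith)
      · rw [Finset.filter_eq_empty_iff]
        intro i _ h; exact hd (hkd _ _ _ _ h).2
    rcases hcnt k (q+1) d hd.1 hd.2 with hl | hr
    · have hmap : ∀ i ∈ (CF Rm q).filter (fun i => Bd k (q+1) d i), i / 2 ^ d ∈ SF Rm (q + 1 - d) := by
        intro i hi
        rw [Finset.mem_filter, mem_CF] at hi
        rw [mem_SF]
        have := hi.1.anc (d-1) (by omega)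
        rwa [Nat.div_div_eq_div_mul, ← pow_succ', show d - 1 + 1 = d by omega,
          show q - (d - 1) = q + 1 - d by omega] at this
      have h1 : ((((CF Rm q).filter (fun i => Bd k (q+1) d i)).card : ℕ) : ℝ) ≤
          (SF Rm (q + 1 - d)).card * (e k d * (1 - ω) ^ d * 2 ^ d) := by
        rw [Finset.card_eq_sum_card_fiberwise hmap]
        push_cast
        rw [← nsmul_eq_mul]
        apply Finset.sum_le_card_nsmul
        intro i' hi'
        refine hl i' (mem_SF.1 hi') _ (fun i hi => ?_)
        rw [Finset.mem_filter, Finset.mem_filter] at hi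
        exact ⟨hi.2, hi.1.2⟩
      refine h1.trans ?_
      have h2 := hgr (d-1) (q + 1 - d) (by omega)
      have h3 : b ^ d = b * b ^ (d-1) := by rw [← pow_succ']; congr 1; omega
      calc _ = e k d * (b ^ d * (SF Rm (q + 1 - d)).card) := by rw [hb, mul_pow]; ring
        _ = e k d * (b * (b ^ (d-1) * (SF Rm (q + 1 - d)).card)) := by rw [h3]; ring
        _ ≤ e k d * (b * N) := mul_le_mul_of_nonneg_left (mul_le_mul_of_nonneg_left h2 hb0.le) (he0 k d)
        _ ≤ _ := mul_le_mul_of_nonneg_left hbN (he0 k d)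
    · refine (hr _ (fun i hi => ?_)).trans ?_
      · rw [Finset.mem_filter, mem_CF] at hi
        refine ⟨?_, hi.2⟩
        have := hi.1.1; rw [pow_succ]; omega
      · have h2 := hgr q 0 (by omega)
        rw [h0, mul_one] at h2
        calc _ = e k d * (b * b ^ q) := by rw [hb, ← pow_succ', mul_pow]; ring
          _ ≤ e k d * (b * N) := mul_le_mul_of_nonneg_left (mul_le_mul_of_nonneg_left h2 hb0.le) (he0 k d)
          _ ≤ _ := mul_le_mul_of_nonneg_left hbN (he0 k d)
  have hXc : (((CF Rm q).filter (fun i => X (q+1) i)).card : ℝ) ≤ ω * N := by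
    refine (hX q _ (fun i hi => ?_)).trans ?_
    · rw [Finset.mem_filter, mem_CF] at hi
      refine ⟨?_, hi.2⟩
      have := hi.1.1; rw [pow_succ]; omega
    · have h2 := hgr q 0 (by omega)
      rw [h0, mul_one] at h2
      exact mul_le_mul_of_nonneg_left h2 hω.le
  have hcov : CF Rm q ⊆ SF Rm (q+1) ∪ (((Finset.range (q+2)).biUnion fun k => (Finset.range (q+2)).biUnion
      fun d => (CF Rm q).filter (fun i => Bd k (q+1) d i)) ∪ (CF Rm q).filter (fun i => X (q+1) i)) := by
    intro i hi
    simp only [Finset.mem_union, Finset.mem_biUnion, Finset.mem_filter, Finset.mem_range]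
    by_cases hR : Rm (q+1) i
    · right
      rcases (hRm _ _).1 hR with ⟨k, d, h⟩ | h
      · left
        have := hkd _ _ _ _ h
        exact ⟨k, by omega, d, by omega, hi, h⟩
      · exact Or.inr ⟨hi, h⟩
    · left; rw [mem_SF, surv_succ]; exact ⟨mem_CF.1 hi, hR⟩
  have hcc := (Finset.card_le_card hcov).trans ((Finset.card_union_le _ _).trans
    (Nat.add_le_add_left ((Finset.card_union_le _ _).trans (Nat.add_le_add_right
      (Finset.card_biUnion_le.trans (Finset.sum_le_sum fun k _ => Finset.card_biUnion_le)) _)) _))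
  rw [card_CF] at hcc
  have hcc' : 2 * N ≤ (SF Rm (q+1)).card + (∑ k ∈ Finset.range (q+2), ∑ d ∈ Finset.range (q+2),
      (((CF Rm q).filter (fun i => Bd k (q+1) d i)).card : ℝ) + ((CF Rm q).filter (fun i => X (q+1) i)).card) := by
    rw [hN]; exact_mod_cast hcc
  have hsum : ∑ k ∈ Finset.range (q+2), ∑ d ∈ Finset.range (q+2),
      (((CF Rm q).filter (fun i => Bd k (q+1) d i)).card : ℝ) ≤ ω / 2 * (2 * N) := by
    calc _ ≤ ∑ k ∈ Finset.range (q+2), ∑ d ∈ Finset.range (q+2), e k d * (2 * N) :=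
          Finset.sum_le_sum fun k _ => Finset.sum_le_sum fun d _ => hrem k d
      _ = (∑ k ∈ Finset.range (q+2), ∑ d ∈ Finset.range (q+2), e k d) * (2 * N) := by
          simp_rw [Finset.sum_mul]
      _ ≤ _ := mul_le_mul_of_nonneg_right (he (q+1)) (by linarith)
  rw [hb]; linarith

/-- a point in all generations -/
theorem cantor_point (Rm : ℕ → ℕ → Prop) (h : ∀ q, (SF Rm q).Nonempty) :
    ∃ x ∈ Icc (0:ℝ) 1, ∀ q, ∃ i, Surv Rm q i ∧ x ∈ dyc q i := by
  let Z : ℕ → Set ℝ := fun q => ⋃ i ∈ SF Rm q, dyc q i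
  have hne : (⋂ q, Z q).Nonempty := by
    apply IsCompact.nonempty_iInter_of_sequence_nonempty_isCompact_isClosed Z
    · intro q x hx
      simp only [Z, mem_iUnion] at hx ⊢
      obtain ⟨i, hi, hx⟩ := hx
      refine ⟨i / 2, mem_SF.2 (surv_succ.1 (mem_SF.1 hi)).1, ?_⟩
      have h1 : (2:ℝ) * ((i / 2 : ℕ) : ℝ) ≤ i := by exact_mod_cast (by omega : 2 * (i / 2) ≤ i)
      have h2 : (i:ℝ) + 1 ≤ 2 * (((i / 2 : ℕ) : ℝ) + 1) := by
        exact_mod_cast (by omega : i + 1 ≤ 2 * (i / 2 + 1))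
      constructor
      · refine le_trans ?_ hx.1
        rw [div_le_div_iff₀ (by positivity) (by positivity), pow_succ]
        have := mul_le_mul_of_nonneg_right h1 (show (0:ℝ) ≤ 2 ^ q by positivity)
        linarith
      · refine hx.2.trans ?_
        rw [div_le_div_iff₀ (by positivity) (by positivity), pow_succ]
        have := mul_le_mul_of_nonneg_right h2 (show (0:ℝ) ≤ 2 ^ q by positivity)
        linarith
    · intro q
      obtain ⟨i, hi⟩ := h q
      refine ⟨(i:ℝ) / 2 ^ q, ?_⟩
      simp only [Z, mem_iUnion]
      refine ⟨i, hi, le_rfl, ?_⟩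
      apply div_le_div_of_nonneg_right (by linarith); positivity
    · exact (SF Rm 0).isCompact_biUnion fun i _ => isCompact_Icc
    · intro q; exact ((SF Rm q).isCompact_biUnion fun i _ => isCompact_Icc).isClosed
  obtain ⟨x, hx⟩ := hne
  have hx' : ∀ q, ∃ i, Surv Rm q i ∧ x ∈ dyc q i := by
    intro q
    have := mem_iInter.1 hx q
    simp only [Z, mem_iUnion] at this
    obtain ⟨i, hi, hx⟩ := this
    exact ⟨i, mem_SF.1 hi, hx⟩
  obtain ⟨i, hi, hxi⟩ := hx' 0
  exact ⟨x, dyc_sub hi.1 hxi, hx'⟩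

end cantor
end Part11

section Part12
open MeasureTheory Set

section cantor
open Classical

/-- few dyadic intervals meet a small set -/
lemma few_dyc (q : ℕ) (U : Set ℝ) (δ : ℝ) (hU : ∀ x ∈ U, ∀ y ∈ U, |x - y| ≤ δ) (hδ : δ ≤ 2 / 2 ^ q)
    (T : Finset ℕ) (hT : ∀ i ∈ T, ∃ x ∈ dyc q i, x ∈ U) : T.card ≤ 4 := by
  rcases T.eq_empty_or_nonempty with rfl | hne
  · simp
  have hsub : T ⊆ Finset.Icc (T.min' hne) (T.min' hne + 3) := by
    intro i hi
    rw [Finset.mem_Icc]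
    refine ⟨Finset.min'_le _ _ hi, ?_⟩
    obtain ⟨x, hx, hxU⟩ := hT i hi
    obtain ⟨y, hy, hyU⟩ := hT _ (T.min'_mem hne)
    set m := T.min' hne
    have h1 := (abs_le.1 ((hU x hxU y hyU).trans hδ)).2
    have h2 := hx.1
    have h3 := hy.2
    have h4 : (i:ℝ) / 2 ^ q ≤ ((m:ℝ) + 1) / 2 ^ q + 2 / 2 ^ q := by linarith
    rw [← add_div, div_le_div_iff_of_pos_right (by positivity)] at h4
    have : (i:ℝ) ≤ ((m + 3 : ℕ) : ℝ) := by push_cast; linarith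
    exact_mod_cast this
  have := Finset.card_le_card hsub
  rw [Nat.card_Icc] at this
  omega

lemma cover_count {J : Type} (s η0 : ℝ) (hs0 : 0 < s) (hs1 : s < 1) (U : J → Set ℝ) (δ : J → ℝ)
    (hU : ∀ j, ∀ x ∈ U j, ∀ y ∈ U j, |x - y| ≤ δ j) (pj : J → ℕ)
    (hp : ∀ j, 1 / 2 ^ (pj j + 1) < δ j ∧ δ j ≤ 2 / 2 ^ (pj j + 1))
    (hsum : ∀ T : Finset J, ∑ j ∈ T, δ j ^ s ≤ η0) (p : ℕ) (T : Finset ℕ)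
    (hT : ∀ i ∈ T, ∃ j, pj j = p ∧ ∃ x ∈ dyc (p+1) i, x ∈ U j) :
    (T.card : ℝ) ≤ 8 * η0 * (2 ^ s) ^ p := by
  rcases T.eq_empty_or_nonempty with hTe | ⟨i00, hi00⟩
  · subst hTe
    have hη : 0 ≤ η0 := by simpa using hsum ∅
    simp only [Finset.card_empty, Nat.cast_zero]
    positivity
  haveI : Nonempty J := ⟨(hT i00 hi00).choose⟩
  choose! F hF1 hF2 using hT
  have h1 : T.card ≤ 4 * (T.image F).card := by
    apply Finset.card_le_mul_card_image
    intro j hj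
    obtain ⟨i0, hi0, rfl⟩ := Finset.mem_image.1 hj
    have := (hp (F i0)).2
    rw [hF1 i0 hi0] at this
    refine few_dyc (p+1) (U (F i0)) _ (hU _) this _ (fun i hi => ?_)
    rw [Finset.mem_filter] at hi
    have := hF2 i hi.1
    rwa [hi.2] at this
  have h2 : ((T.image F).card : ℝ) * (1 / 2 ^ (p+1)) ^ s ≤ η0 := by
    refine le_trans ?_ (hsum (T.image F))
    rw [← nsmul_eq_mul]
    apply Finset.card_nsmul_le_sum
    intro j hj
    obtain ⟨i0, hi0, rfl⟩ := Finset.mem_image.1 hj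
    have := (hp (F i0)).1
    rw [hF1 i0 hi0] at this
    exact Real.rpow_le_rpow (by positivity) this.le hs0.le
  have h3 : ((1:ℝ) / 2 ^ (p+1)) ^ s = 1 / (2 ^ s * (2 ^ s) ^ p) := by
    rw [Real.div_rpow zero_le_one (by positivity), Real.one_rpow, ← Real.rpow_natCast,
      ← Real.rpow_mul two_pos.le, ← pow_succ', ← Real.rpow_natCast (2 ^ s), ← Real.rpow_mul two_pos.le,
      mul_comm s]
  rw [h3, mul_one_div, div_le_iff₀ (by positivity)] at h2
  have h4 : (2:ℝ) ^ s ≤ 2 := by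
    calc (2:ℝ) ^ s ≤ 2 ^ (1:ℝ) := r2_le hs1.le
      _ = 2 := Real.rpow_one 2
  have hη : 0 ≤ η0 := by simpa using hsum ∅
  calc (T.card : ℝ) ≤ 4 * (T.image F).card := by exact_mod_cast h1
    _ ≤ 4 * (η0 * (2 ^ s * (2 ^ s) ^ p)) := by linarith
    _ ≤ 4 * (η0 * (2 * (2 ^ s) ^ p)) := by
        apply mul_le_mul_of_nonneg_left _ (by norm_num)
        apply mul_le_mul_of_nonneg_left _ hη
        exact mul_le_mul_of_nonneg_right h4 (by positivity)
    _ = _ := by ring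

lemma exists_scale (δ : ℝ) (h0 : 0 < δ) (h1 : δ ≤ 1) :
    ∃ p : ℕ, 1 / 2 ^ (p + 1) < δ ∧ δ ≤ 2 / 2 ^ (p + 1) := by
  obtain ⟨n, hn1, hn2⟩ := exists_nat_pow_near_of_lt_one h0 h1 (y := (1/2:ℝ)) (by norm_num) (by norm_num)
  refine ⟨n, by simpa using hn1, ?_⟩
  rw [pow_succ]
  simp only [one_div, inv_pow] at hn2
  calc δ ≤ _ := hn2
    _ = _ := by field_simp

lemma geo_tail (ρ : ℝ) (h0 : 0 < ρ) (h1 : ρ < 1) (Cc ε : ℝ) (hC : 0 < Cc) (hε : 0 < ε) :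
    ∃ d0 : ℕ, ∀ d1, d0 ≤ d1 → ∀ q, ∑ d ∈ Finset.range q, (if d1 ≤ d then Cc * ρ ^ d else 0) ≤ ε := by
  obtain ⟨n, hn⟩ := exists_pow_lt_of_lt_one (show 0 < ε * (1 - ρ) / Cc by
    have : 0 < 1 - ρ := by linarith
    positivity) h1
  have h1' : 0 < 1 - ρ := by linarith
  refine ⟨n, fun d1 hd1 q => ?_⟩
  rw [← Finset.sum_filter]
  have h2 : ∑ d ∈ Finset.range q with d1 ≤ d, Cc * ρ ^ d ≤ ∑ m ∈ Finset.range q, Cc * ρ ^ d1 * ρ ^ m := by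
    calc _ ≤ ∑ d ∈ (Finset.range q).image (fun m => d1 + m), Cc * ρ ^ d := by
          apply Finset.sum_le_sum_of_subset_of_nonneg
          · intro d hd
            rw [Finset.mem_filter, Finset.mem_range] at hd
            rw [Finset.mem_image]
            exact ⟨d - d1, by rw [Finset.mem_range]; omega, by omega⟩
          · intros; positivity
      _ = ∑ m ∈ Finset.range q, Cc * ρ ^ (d1 + m) := by
          rw [Finset.sum_image]; intro a _ b _ h; simpa using h
      _ = _ := Finset.sum_congr rfl fun m _ => by rw [pow_add]; ring
  refine h2.trans ?_
  rw [← Finset.mul_sum]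
  have h3 : ∑ m ∈ Finset.range q, ρ ^ m ≤ 1 / (1 - ρ) := by
    rw [geom_sum_eq h1.ne, ← neg_div_neg_eq]
    apply div_le_div₀ zero_le_one _ h1' (by linarith)
    have : 0 < ρ ^ q := by positivity
    linarith
  have h4 : ρ ^ d1 ≤ ρ ^ n := pow_le_pow_of_le_one h0.le h1.le hd1
  rw [lt_div_iff₀ hC] at hn
  calc Cc * ρ ^ d1 * ∑ m ∈ Finset.range q, ρ ^ m ≤ Cc * ρ ^ n * (1 / (1 - ρ)) :=
        mul_le_mul (mul_le_mul_of_nonneg_left h4 hC.le) h3 (Finset.sum_nonneg fun _ _ => by positivity)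
          (by positivity)
    _ ≤ ε := by rw [mul_one_div, div_le_iff₀ h1']; linarith

theorem cantor_main (D : ℕ → ℕ → ℕ → ℝ → Prop) (τ a s : ℝ) (hτ : 0 < τ) (hτ1 : τ ≤ 1) (ha : 0 < a)
    (hs0 : 0 < s) (hs1 : s < 1) (hD : ∀ k, Ctl (D k) τ a) :
    ∃ η0 > (0:ℝ), ∀ (J : Type) (U : J → Set ℝ) (δ : J → ℝ), (∀ j, 0 < δ j) →
      (∀ j, ∀ x ∈ U j, ∀ y ∈ U j, |x - y| ≤ δ j) → (∀ T : Finset J, ∑ j ∈ T, δ j ^ s ≤ η0) →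
      ∃ x ∈ Icc (0:ℝ) 1, (∀ j, x ∉ U j) ∧
        ∀ k, ∃ d0 : ℕ, ∀ q d : ℕ, d0 ≤ d → (d:ℝ) ≤ τ / 2 * q → ¬ D k q d x := by
  choose C0 hC0 D0 hctl using hD
  have hlt1 : ∀ u : ℝ, u < 0 → (2:ℝ) ^ u < 1 := fun u hu => Real.rpow_lt_one_of_one_lt_of_neg one_lt_two hu
  set M : ℝ := max (max (2 ^ (-(a/2))) (2 ^ (-(a * τ / 16)))) (2 ^ (s - 1)) with hM
  have hM0 : 0 < M := lt_max_of_lt_right (by positivity)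
  have hM1 : M < 1 := by
    rw [hM]
    refine max_lt (max_lt (hlt1 _ (by linarith)) (hlt1 _ ?_)) (hlt1 _ (by linarith))
    have : 0 < a * τ := by positivity
    linarith
  set ω := 1 - M with hω
  have hω0 : 0 < ω := by linarith
  have hωM : 1 - ω = M := by rw [hω]; ring
  set ρ : ℝ := 2 ^ (-(a/2)) with hρ
  have hρ0 : 0 < ρ := by positivity
  have hρ1 : ρ < 1 := hlt1 _ (by linarith)
  have hgt : ∀ k : ℕ, ∃ d0 : ℕ, ∀ d1, d0 ≤ d1 → ∀ q, ∑ d ∈ Finset.range q,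
      (if d1 ≤ d then C0 k * ρ ^ d else 0) ≤ ω / 4 * (1/2) ^ k := fun k =>
    geo_tail ρ hρ0 hρ1 (C0 k) _ (hC0 k) (by positivity)
  choose D1 hD1 using hgt
  set d0 : ℕ → ℕ := fun k => D0 k + D1 k + k + 1 with hd0
  have hpowρ : ∀ d : ℕ, (2:ℝ) ^ (-(a * d)) = ρ ^ d * ρ ^ d := by
    intro d
    rw [hρ, ← Real.rpow_natCast, ← Real.rpow_mul two_pos.le, ← Real.rpow_add two_pos]
    congr 1; ring
  refine ⟨ω / 8, by positivity, fun J U δ hδ hU hsum => ?_⟩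
  have hδ1 : ∀ j, δ j ≤ 1 := by
    intro j
    have := hsum {j}
    rw [Finset.sum_singleton] at this
    by_contra hcon
    push Not at hcon
    have := Real.one_lt_rpow hcon hs0
    linarith
  have hpj : ∀ j, ∃ p : ℕ, 1 / 2 ^ (p + 1) < δ j ∧ δ j ≤ 2 / 2 ^ (p + 1) := fun j =>
    exists_scale _ (hδ j) (hδ1 j)
  choose pj hpj using hpj
  let Bd : ℕ → ℕ → ℕ → ℕ → Prop := fun k q d i => d0 k ≤ d ∧ (d:ℝ) ≤ τ / 2 * q ∧ ∃ x ∈ dyc q i, D k q d x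
  let X : ℕ → ℕ → Prop := fun q i => ∃ j, pj j + 1 = q ∧ ∃ x ∈ dyc q i, x ∈ U j
  let Rm : ℕ → ℕ → Prop := fun q i => (∃ k d, Bd k q d i) ∨ X q i
  let e : ℕ → ℕ → ℝ := fun k d => if d0 k ≤ d then C0 k * ρ ^ d else 0
  have hdq : ∀ q d : ℕ, (d:ℝ) ≤ τ / 2 * q → d ≤ q := by
    intro q d h
    have hq : (0:ℝ) ≤ q := by positivity
    have : τ / 2 * q ≤ 1 * q := mul_le_mul_of_nonneg_right (by linarith) hq
    have : (d:ℝ) ≤ q := by linarith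
    exact_mod_cast this
  have hcc := cantor_count Bd X Rm (fun q i => Iff.rfl) e
    (fun k d => by
      simp only [e]; split_ifs
      · have := hC0 k; positivity
      · exact le_rfl) ω hω0 (by linarith)
    (fun k q d i h => by
      have h1 := hdq q d h.2.1
      have h2 := h.1
      simp only [hd0] at h2
      omega)
    (fun k q d hd1 hd2 => by
      by_cases hdk : d0 k ≤ d
      swap
      · right
        intro T hT
        have : T = ∅ := by
          rw [Finset.eq_empty_iff_forall_notMem]
          intro i hi; exact hdk (hT i hi).2.1
        simp [this, e, hdk]
      have hdD : D0 k ≤ d := by simp only [hd0] at hdk; omega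
      have hek : e k d = C0 k * ρ ^ d := by simp only [e, if_pos hdk]
      have hC := hC0 k
      by_cases hl : 8 * (d:ℝ) ≤ τ * q
      · left
        intro i' hi' T hT
        refine ((hctl k d hdD q).1 hl i' hi'.1 ?_ T (fun i hi => ⟨(hT i hi).1, (hT i hi).2.2.2⟩)).trans ?_
        · intro d' hd' hd'' hDk
          have hqd : 1 ≤ q - d := by
            by_contra hcon
            have : q = d := by omega
            have h8 : (q:ℝ) = d := by exact_mod_cast this
            have h9 : (1:ℝ) ≤ d := by exact_mod_cast hd1
            rw [h8] at hl
            have : τ * d ≤ 1 * d := mul_le_mul_of_nonneg_right hτ1 (by linarith)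
            linarith
          refine hi'.2 (q - d) hqd le_rfl (Or.inl ⟨k, d', hdk.trans hd', ?_, _, ?_, hDk⟩)
          · rw [Nat.cast_sub hd2]
            have h1 : (d':ℝ) ≤ 2 * d := by exact_mod_cast hd''
            have : τ * d ≤ 1 * d := mul_le_mul_of_nonneg_right hτ1 (by positivity)
            linarith
          · simp only [Nat.sub_self, pow_zero, Nat.div_one]
            refine ⟨le_rfl, ?_⟩
            apply div_le_div_of_nonneg_right (by linarith); positivity
        · rw [hek, hpowρ, hωM]
          have hρM : ρ ^ d ≤ M ^ d := pow_le_pow_left₀ hρ0.le ((le_max_left _ _).trans (le_max_left _ _)) d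
          calc C0 k * (ρ ^ d * ρ ^ d) * 2 ^ d = C0 k * ρ ^ d * 2 ^ d * ρ ^ d := by ring
            _ ≤ C0 k * ρ ^ d * 2 ^ d * M ^ d := mul_le_mul_of_nonneg_left hρM (by positivity)
            _ = _ := by ring
      · right
        intro T hT
        rcases T.eq_empty_or_nonempty with rfl | ⟨i0, hi0⟩
        · rw [hek, hωM]; simp; positivity
        push Not at hl
        refine ((hctl k d hdD q).2 (hT i0 hi0).2.2.1 T (fun i hi => ⟨(hT i hi).1, (hT i hi).2.2.2⟩)).trans ?_
        rw [hek, hpowρ, hωM]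
        have hρM : ρ ^ d ≤ M ^ q := by
          calc ρ ^ d = 2 ^ (-(a * d / 2)) := by
                rw [hρ, ← Real.rpow_natCast, ← Real.rpow_mul two_pos.le]; congr 1; ring
            _ ≤ 2 ^ (-(a * τ / 16 * q)) := by
                apply r2_le
                have := mul_le_mul_of_nonneg_left hl.le ha.le
                linarith
            _ = (2 ^ (-(a * τ / 16))) ^ q := by
                rw [← Real.rpow_natCast, ← Real.rpow_mul two_pos.le]; congr 1; ring
            _ ≤ M ^ q := pow_le_pow_left₀ (by positivity) ((le_max_right _ _).trans (le_max_left _ _)) q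
        calc C0 k * (ρ ^ d * ρ ^ d) * 2 ^ q = C0 k * ρ ^ d * 2 ^ q * ρ ^ d := by ring
          _ ≤ C0 k * ρ ^ d * 2 ^ q * M ^ q := mul_le_mul_of_nonneg_left hρM (by positivity)
          _ = _ := by ring)
    (fun q => by
      calc _ ≤ ∑ k ∈ Finset.range (q+1), ω / 4 * (1/2) ^ k := Finset.sum_le_sum fun k _ =>
            hD1 k (d0 k) (by simp only [hd0]; omega) (q+1)
        _ = ω / 4 * ∑ k ∈ Finset.range (q+1), (1/2) ^ k := by rw [Finset.mul_sum]
        _ ≤ ω / 4 * 2 := by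
            apply mul_le_mul_of_nonneg_left _ (by positivity)
            exact sum_geometric_two_le (q+1)
        _ = ω / 2 := by ring)
    (fun q T hT => by
      refine (cover_count s (ω / 8) hs0 hs1 U δ hU pj hpj hsum q T (fun i hi => ?_)).trans ?_
      · obtain ⟨j, hj, h⟩ := (hT i hi).2
        exact ⟨j, by omega, h⟩
      · rw [hωM]
        have h1 : (2:ℝ) ^ s ≤ 2 * M := by
          calc (2:ℝ) ^ s = 2 * 2 ^ (s - 1) := by
                rw [Real.rpow_sub two_pos, Real.rpow_one]; field_simp
            _ ≤ 2 * M := mul_le_mul_of_nonneg_left (le_max_right _ _) (by norm_num)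
        calc 8 * (ω / 8) * (2 ^ s) ^ q = ω * (2 ^ s) ^ q := by ring
          _ ≤ _ := mul_le_mul_of_nonneg_left (pow_le_pow_left₀ (by positivity) h1 q) hω0.le)
  have hne : ∀ q, (SF Rm q).Nonempty := by
    intro q
    rw [← Finset.card_pos]
    induction q with
    | zero =>
      rw [Finset.card_pos]
      exact ⟨0, mem_SF.2 ⟨by simp, fun g h1 h2 => by omega⟩⟩
    | succ q ih =>
      have h1 := hcc q
      have h2 : (0:ℝ) < (SF Rm q).card := by exact_mod_cast ih
      rw [hωM] at h1
      have h3 : 0 < 2 * M * (SF Rm q).card := by positivity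
      have : (0:ℝ) < (SF Rm (q+1)).card := by linarith
      exact_mod_cast this
  obtain ⟨x, hx, hxs⟩ := cantor_point Rm hne
  refine ⟨x, hx, fun j hxj => ?_, fun k => ⟨d0 k, fun q d hd hdq' hDx => ?_⟩⟩
  · obtain ⟨i, hi, hxi⟩ := hxs (pj j + 1)
    have := hi.2 (pj j + 1) (by omega) le_rfl
    simp only [Nat.sub_self, pow_zero, Nat.div_one] at this
    exact this (Or.inr ⟨j, rfl, x, hxi, hxj⟩)
  · obtain ⟨i, hi, hxi⟩ := hxs q
    have h1 := hdq q d hdq'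
    have h2 : 1 ≤ d0 k := by simp only [hd0]; omega
    have := hi.2 q (by omega) le_rfl
    simp only [Nat.sub_self, pow_zero, Nat.div_one] at this
    exact this (Or.inl ⟨k, d, hd, hdq', x, hxi, hDx⟩)

end cantor
end Part12

section Part13
open MeasureTheory Set

section transf
variable {ι : Type} [Fintype ι] [DecidableEq ι]

lemma pigeon_lin (Q : ℕ) (hQ : 1 ≤ Q) (r : ι → ℝ) (hr : ∀ i, 0 ≤ r i) (hsum : ∑ i, r i = 1)
    (p : ι → ℤ) : ∃ a : ι → ℤ, a ≠ 0 ∧ (∀ i, |(a i : ℝ)| ≤ (Q:ℝ) ^ r i) ∧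
      ∃ a0 : ℤ, ∑ i, a i * p i = - (a0 * Q) := by
  haveI : NeZero Q := ⟨by omega⟩
  have hQ0 : (0:ℝ) < Q := by exact_mod_cast hQ
  let N : ι → ℕ := fun i => ⌊(Q:ℝ) ^ r i⌋₊
  let S : Finset (ι → ℕ) := Fintype.piFinset fun i => Finset.range (N i + 1)
  have hcard : Q < S.card := by
    have h1 : (S.card : ℝ) = ∏ i, ((N i : ℝ) + 1) := by
      simp [S, Fintype.card_piFinset]
    have h2 : (Q : ℝ) = ∏ i, (Q:ℝ) ^ r i := by
      rw [← Real.rpow_sum_of_pos hQ0, hsum, Real.rpow_one]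
    have hne : (Finset.univ : Finset ι).Nonempty := by
      by_contra h
      rw [Finset.not_nonempty_iff_eq_empty] at h
      rw [h] at hsum
      simp at hsum
    have h3 : (∏ i, (Q:ℝ) ^ r i) < ∏ i, ((N i : ℝ) + 1) := by
      apply Finset.prod_lt_prod_of_nonempty
      · intro i _; exact Real.rpow_pos_of_pos hQ0 _
      · intro i _; exact Nat.lt_floor_add_one _
      · exact hne
    rw [← h2, ← h1] at h3
    exact_mod_cast h3
  have hcard' : (Finset.univ : Finset (ZMod Q)).card < S.card := by
    rw [Finset.card_univ, ZMod.card]; exact hcard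
  obtain ⟨b, hb, b', hb', hne, heq⟩ := Finset.exists_ne_map_eq_of_card_lt_of_maps_to hcard'
    (f := fun b : ι → ℕ => ((∑ i, (b i : ℤ) * p i : ℤ) : ZMod Q)) (fun _ _ => Finset.mem_coe.2 (Finset.mem_univ _))
  refine ⟨fun i => (b i : ℤ) - b' i, ?_, ?_, ?_⟩
  · intro h
    apply hne
    ext i
    have := congrFun h i
    simp only [Pi.zero_apply] at this
    omega
  · intro i
    have e1 : b i ≤ N i := by
      have := Fintype.mem_piFinset.1 hb i
      rw [Finset.mem_range] at this; omega
    have e2 : b' i ≤ N i := by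
      have := Fintype.mem_piFinset.1 hb' i
      rw [Finset.mem_range] at this; omega
    have e3 : (N i : ℝ) ≤ (Q:ℝ) ^ r i := Nat.floor_le (Real.rpow_nonneg hQ0.le _)
    have e4 : (b i : ℝ) ≤ N i := by exact_mod_cast e1
    have e5 : (b' i : ℝ) ≤ N i := by exact_mod_cast e2
    have e6 : (0:ℝ) ≤ b i := Nat.cast_nonneg _
    have e7 : (0:ℝ) ≤ b' i := Nat.cast_nonneg _
    push_cast
    rw [abs_le]; constructor <;> linarith
  · have h := (ZMod.intCast_eq_intCast_iff_dvd_sub _ _ _).1 heq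
    obtain ⟨z, hz⟩ := h
    refine ⟨z, ?_⟩
    simp only [sub_mul, Finset.sum_sub_distrib]
    linarith [hz, mul_comm z (Q:ℤ)]

variable {f f1 f2 : ι → ℝ → ℝ} {K C α : ℝ} {r : ι → ℝ} {τ : ℝ} {i1 : ι}

lemma transf (H : Crv f f1 f2 K C α) (hw : Wt r τ i1) (x : ℝ) (hx : x ∈ Icc (0:ℝ) 1) (d0 : ℕ)
    (hd : ∀ q d : ℕ, d0 ≤ d → (d:ℝ) ≤ τ / 2 * q → ¬ Dg f f1 r i1 q d x) :
    ∃ c > (0:ℝ), ∀ Q : ℕ, 1 ≤ Q → ∀ p : ι → ℤ, ∃ i, (c / Q) ^ r i ≤ |Q * f i x - p i| := by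
  have hr1 := hw.r1_pos
  have hτ := hw.hτ
  have hn1 := hw.card_pos
  have hK := H.hK
  obtain ⟨Λ, hΛ1, hΛ⟩ : ∃ Λ : ℝ, 1 ≤ Λ ∧ (Fintype.card ι : ℝ) * K * 2 ^ (d0:ℝ) ≤ Λ ^ r i1 := by
    have h1 : 1 ≤ (Fintype.card ι : ℝ) * K * 2 ^ (d0:ℝ) := by
      have := Real.one_le_rpow (one_le_two (α := ℝ)) (Nat.cast_nonneg (α := ℝ) d0)
      exact one_le_mul_of_one_le_of_one_le (one_le_mul_of_one_le_of_one_le hn1 hK) this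
    refine ⟨((Fintype.card ι : ℝ) * K * 2 ^ (d0:ℝ)) ^ (1 / r i1), Real.one_le_rpow h1 (by positivity), ?_⟩
    rw [← Real.rpow_mul (by linarith), one_div_mul_cancel hr1.ne', Real.rpow_one]
  obtain ⟨G, hG⟩ : ∃ G : ℝ, G = 2 * d0 / τ + 1 + d0 := ⟨_, rfl⟩
  obtain ⟨c, hc0, hc1, hc⟩ : ∃ c : ℝ, 0 < c ∧ c ≤ 1 ∧ Λ * 2 ^ G * (Fintype.card ι * c ^ τ) ≤ 1 := by
    have hG0 : 0 ≤ G := by rw [hG]; positivity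
    have h1 : 1 ≤ Λ * 2 ^ G * Fintype.card ι := by
      have := Real.one_le_rpow (one_le_two (α := ℝ)) hG0
      exact one_le_mul_of_one_le_of_one_le (one_le_mul_of_one_le_of_one_le hΛ1 this) hn1
    refine ⟨((Λ * 2 ^ G * Fintype.card ι)⁻¹) ^ (1 / τ), by positivity, ?_, ?_⟩
    · exact Real.rpow_le_one (by positivity) (inv_le_one_of_one_le₀ h1) (by positivity)
    · rw [← Real.rpow_mul (by positivity), one_div_mul_cancel hτ.ne', Real.rpow_one, ← mul_assoc,
        mul_inv_cancel₀ (by linarith)]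
  refine ⟨c, hc0, fun Q hQ p => ?_⟩
  by_contra hcon
  push Not at hcon
  obtain ⟨a, ha0, ha, a0, hsum⟩ := pigeon_lin Q hQ r (fun i => hτ.le.trans (hw.ge i)) hw.sum p
  have hQ1 : (1:ℝ) ≤ Q := by exact_mod_cast hQ
  have hQ0 : (0:ℝ) < Q := by linarith
  have hlin : |(a0:ℝ) + ∑ i, f i x * a i| ≤ Fintype.card ι * c ^ τ / Q := by
    have e : (a0:ℝ) + ∑ i, f i x * a i = (∑ i, (a i : ℝ) * (Q * f i x - p i)) / Q := by
      rw [eq_div_iff hQ0.ne']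
      have h2 : (∑ i, (a i : ℝ) * p i) = - (a0 * Q) := by exact_mod_cast hsum
      simp only [mul_sub, Finset.sum_sub_distrib, h2]
      rw [add_mul, Finset.sum_mul]
      have : ∀ i, f i x * (a i : ℝ) * Q = a i * (Q * f i x) := fun i => by ring
      simp only [this]; ring
    rw [e, abs_div, abs_of_pos hQ0]
    apply div_le_div_of_nonneg_right _ hQ0.le
    refine (Finset.abs_sum_le_sum_abs _ _).trans ?_
    have : ∀ i ∈ Finset.univ, |(a i : ℝ) * (Q * f i x - p i)| ≤ c ^ τ := by
      intro i _
      rw [abs_mul]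
      calc |(a i:ℝ)| * |Q * f i x - p i| ≤ (Q:ℝ) ^ r i * (c / Q) ^ r i :=
            mul_le_mul (ha i) (hcon i).le (abs_nonneg _) (by positivity)
        _ = c ^ r i := by
            rw [← Real.mul_rpow hQ0.le (by positivity)]; congr 1; field_simp
        _ ≤ c ^ τ := Real.rpow_le_rpow_of_exponent_ge hc0 hc1 (hw.ge i)
    simpa using Finset.sum_le_card_nsmul _ _ _ this
  -- the generation
  have hQΛ : 1 ≤ Q * Λ := one_le_mul_of_one_le_of_one_le hQ1 hΛ1
  obtain ⟨L, hL⟩ : ∃ L : ℝ, L = Real.logb 2 (Q * Λ) := ⟨_, rfl⟩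
  have hL0 : 0 ≤ L := by rw [hL]; exact Real.logb_nonneg one_lt_two hQΛ
  have hLQ : (2:ℝ) ^ L = Q * Λ := by
    rw [hL]; exact Real.rpow_logb two_pos (by norm_num) (by linarith)
  obtain ⟨g, hg⟩ : ∃ g : ℕ, g = ⌈(1 + r i1) * L + 2 * d0 / τ⌉₊ := ⟨_, rfl⟩
  have hA : 0 ≤ 2 * (d0:ℝ) / τ := by positivity
  have hg1 : (1 + r i1) * L + 2 * d0 / τ ≤ g := by rw [hg]; exact Nat.le_ceil _
  have hg2 : (g:ℝ) < (1 + r i1) * L + 2 * d0 / τ + 1 := by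
    rw [hg]; exact Nat.ceil_lt_add_one (by positivity)
  obtain ⟨t, ht⟩ : ∃ t : ℝ, t = tt (r i1) g d0 := ⟨_, rfl⟩
  have htd : t * (1 + r i1) = g + d0 := by
    rw [ht, tt, div_mul_cancel₀ _ (by linarith)]
  have hd0 : (0:ℝ) ≤ d0 := Nat.cast_nonneg _
  have ht1 : L ≤ t := by
    by_contra h
    push Not at h
    have := mul_lt_mul_of_pos_right h (by linarith : 0 < 1 + r i1)
    linarith
  have ht2 : t ≤ L + G := by
    by_contra h
    push Not at h
    have h1 := mul_lt_mul_of_pos_right h (by linarith : 0 < 1 + r i1)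
    have h2 : 0 ≤ G * r i1 := by rw [hG]; positivity
    rw [htd] at h1
    have : (L + G) * (1 + r i1) = (1 + r i1) * L + G + G * r i1 := by ring
    linarith
  have ht0 : 0 ≤ t := hL0.trans ht1
  have h2t : Q * Λ ≤ (2:ℝ) ^ t := by rw [← hLQ]; exact r2_le ht1
  have h2t' : (2:ℝ) ^ t ≤ Q * Λ * 2 ^ G := by
    rw [← hLQ, ← Real.rpow_add two_pos]; exact r2_le ht2
  refine hd g d0 le_rfl ?_ ⟨fun k => k.elim a0 a, ?_, ?_⟩
  · have : 2 * d0 / τ ≤ (g:ℝ) := by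
      have := mul_nonneg (by linarith : 0 ≤ 1 + r i1) hL0
      linarith
    rw [div_le_iff₀ hτ] at this
    linarith
  · intro h
    apply ha0
    ext i
    exact congrFun h (some i)
  · rintro (_ | i)
    · rw [hvec_n]
      simp only [Ex, Option.elim, ← ht]
      refine hlin.trans ?_
      rw [Real.rpow_neg two_pos.le, div_le_iff₀ hQ0, ← div_eq_inv_mul,
        le_div_iff₀ (by positivity)]
      have h0 : 0 ≤ (Fintype.card ι : ℝ) * c ^ τ := by positivity
      have h3 := mul_le_mul_of_nonneg_left h2t' h0
      have h4 := mul_le_mul_of_nonneg_left hc hQ0.le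
      calc _ ≤ _ := h3
        _ = Q * (Λ * 2 ^ G * (Fintype.card ι * c ^ τ)) := by ring
        _ ≤ _ := by linarith
    · by_cases hi : i = i1
      · subst hi
        rw [hvec_1]
        simp only [Ex, Option.elim, if_true, ← ht]
        have e1 : -(t - g) = r i * t - d0 := by linarith [htd, mul_comm t (r i)]
        rw [e1, Real.rpow_sub two_pos, le_div_iff₀ (by positivity)]
        have e2 : |∑ l, f1 l x * (a l : ℝ)| ≤ Fintype.card ι * K * (Q:ℝ) ^ r i := by
          refine (Finset.abs_sum_le_sum_abs _ _).trans ?_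
          have : ∀ l ∈ Finset.univ, |f1 l x * (a l : ℝ)| ≤ K * (Q:ℝ) ^ r i := by
            intro l _
            rw [abs_mul]
            refine mul_le_mul (H.b1 l x hx) ((ha l).trans ?_) (abs_nonneg _) (by linarith)
            exact Real.rpow_le_rpow_of_exponent_le hQ1 (hw.mx l)
          have := Finset.sum_le_card_nsmul _ _ _ this
          simpa [mul_assoc] using this
        calc _ ≤ (Fintype.card ι * K * (Q:ℝ) ^ r i) * 2 ^ (d0:ℝ) :=
              mul_le_mul_of_nonneg_right e2 (by positivity)
          _ = (Q:ℝ) ^ r i * (Fintype.card ι * K * 2 ^ (d0:ℝ)) := by ring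
          _ ≤ (Q:ℝ) ^ r i * Λ ^ r i := mul_le_mul_of_nonneg_left hΛ (by positivity)
          _ = (Q * Λ) ^ r i := (Real.mul_rpow hQ0.le (by linarith)).symm
          _ ≤ ((2:ℝ) ^ t) ^ r i := Real.rpow_le_rpow (by linarith) h2t hr1.le
          _ = 2 ^ (r i * t) := by rw [← Real.rpow_mul two_pos.le, mul_comm]
      · rw [hvec_u _ i hi]
        simp only [Ex, Option.elim, if_neg hi, ← ht, neg_neg]
        have hri : 0 ≤ r i := hτ.le.trans (hw.ge i)
        refine (ha i).trans ?_
        calc (Q:ℝ) ^ r i ≤ (Q * Λ) ^ r i := Real.rpow_le_rpow hQ0.le (le_mul_of_one_le_right hQ0.le hΛ1) hri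
          _ ≤ ((2:ℝ) ^ t) ^ r i := Real.rpow_le_rpow (by linarith) h2t hri
          _ = 2 ^ (r i * t) := by rw [← Real.rpow_mul two_pos.le, mul_comm]
          _ ≤ _ := r2_le (le_add_of_nonneg_right (by positivity))
end transf
end Part13

section Part14
open MeasureTheory Set

section oned

lemma pos_inf {X : Type} [Finite X] (g : X → ℝ) (hg : ∀ x, 0 < g x) : ∃ a > (0:ℝ), ∀ x, a ≤ g x := by
  rcases isEmpty_or_nonempty X with h | h
  · exact ⟨1, one_pos, fun x => (h.false x).elim⟩
  · obtain ⟨x0, hx0⟩ := Finite.exists_min g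
    exact ⟨g x0, hg x0, hx0⟩

lemma exists_sup {X : Type} [Finite X] (g : X → ℝ) : ∃ a ≥ (1:ℝ), ∀ x, g x ≤ a := by
  rcases isEmpty_or_nonempty X with h | h
  · exact ⟨1, le_rfl, fun x => (h.false x).elim⟩
  · obtain ⟨x0, hx0⟩ := Finite.exists_max g
    exact ⟨max 1 (g x0), le_max_left _ _, fun x => (hx0 x).trans (le_max_right _ _)⟩

lemma tauW_le {n : ℕ} (r : Fin n → ℝ) (i : Fin n) (hi : 0 < r i) : tauW r ≤ r i :=
  csInf_le ⟨0, fun _ ht => ht.1.le⟩ ⟨hi, i, rfl⟩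

/-- support of a weight vector -/
noncomputable def supW {n : ℕ} (r : Fin n → ℝ) : Finset (Fin n) := Finset.univ.filter fun i => 0 < r i

lemma mem_supW {n : ℕ} (r : Fin n → ℝ) (i : Fin n) : i ∈ supW r ↔ 0 < r i := by simp [supW]

lemma supW_sum {n : ℕ} (r : Fin n → ℝ) (hr : r ∈ Weights n) : ∑ i : {i // i ∈ supW r}, r i = 1 := by
  rw [Finset.sum_coe_sort (supW r) r, ← hr.1]
  apply Finset.sum_subset (Finset.subset_univ _)
  intro i _ hi
  rw [mem_supW, not_lt] at hi
  exact le_antisymm hi (hr.2 i)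

lemma exists_Wt {n : ℕ} (r : Fin n → ℝ) (hr : r ∈ Weights n) (τ : ℝ) (hτ : 0 < τ) (h : τ ≤ tauW r) :
    ∃ i1, Wt (fun i : {i // i ∈ supW r} => r i) τ i1 := by
  have hs := supW_sum r hr
  have : Nonempty {i // i ∈ supW r} := by
    by_contra hc
    rw [not_nonempty_iff] at hc
    simp at hs
  obtain ⟨i1, h1⟩ := Finite.exists_max (fun i : {i // i ∈ supW r} => r i)
  exact ⟨i1, hτ, fun i => h.trans (tauW_le r i ((mem_supW r _).1 i.2)), hs, h1⟩

lemma mem_Bad {n : ℕ} (r : Fin n → ℝ) (y : EuclideanSpace ℝ (Fin n))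
    (h : ∃ c > (0:ℝ), ∀ Q : ℕ, 1 ≤ Q → ∀ p : {i // i ∈ supW r} → ℤ, ∃ i : {i // i ∈ supW r}, (c / Q) ^ r i ≤ |Q * y i - p i|) :
    y ∈ BadSet r := by
  obtain ⟨c, hc, h⟩ := h
  refine ⟨c, hc, fun Q hQ => ?_⟩
  have hQ0 : (0:ℝ) < Q := by exact_mod_cast hQ
  by_contra hcon
  push Not at hcon
  have key : ∀ i : {i // i ∈ supW r}, ∃ p : ℤ, |(Q:ℝ) * y i - p| < (c / Q) ^ r i := by
    intro i
    have hri : 0 < r i := (mem_supW r _).1 i.2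
    have h1 := hcon i
    rw [badPow, if_neg hri.ne'] at h1
    have hnn : 0 ≤ distNearestInt (Q * y i) := Real.iInf_nonneg fun p => abs_nonneg _
    have h2 : distNearestInt (Q * y i) < (c / Q) ^ r i := by
      have := Real.rpow_lt_rpow (Real.rpow_nonneg hnn _) h1 hri
      rwa [← Real.rpow_mul hnn, one_div_mul_cancel hri.ne', Real.rpow_one, ← div_eq_mul_inv] at this
    exact exists_lt_of_ciInf_lt h2
  choose p hp using key
  obtain ⟨i, hi⟩ := h Q hQ p
  exact absurd (hp i) (not_lt.2 hi)

lemma Ctl_false (D : ℕ → ℕ → ℝ → Prop) (h : ∀ q d x, ¬ D q d x) (τ a : ℝ) : Ctl D τ a := by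
  refine ⟨1, one_pos, 0, fun d _ q => ⟨fun _ i' _ _ T hT => ?_, fun _ T hT => ?_⟩⟩
  · have : T = ∅ := Finset.eq_empty_of_forall_notMem fun i hi => by
      obtain ⟨_, x, _, hx⟩ := hT i hi; exact h _ _ _ hx
    rw [this]; simp only [Finset.card_empty, Nat.cast_zero]; positivity
  · have : T = ∅ := Finset.eq_empty_of_forall_notMem fun i hi => by
      obtain ⟨_, x, _, hx⟩ := hT i hi; exact h _ _ _ hx
    rw [this]; simp only [Finset.card_empty, Nat.cast_zero]; positivity

theorem oneD {n : ℕ} {P : Type} [Finite P] (f : P → Fin n → ℝ → ℝ)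
    (hf : ∀ p, ∀ s : Finset (Fin n), ∃ (f1 f2 : {i // i ∈ s} → ℝ → ℝ) (K C α : ℝ),
      Crv (fun i : {i // i ∈ s} => f p i) f1 f2 K C α)
    (W : Set (Fin n → ℝ)) (hW : W.Countable) (hWs : W ⊆ Weights n)
    (hτ : ∃ ε > 0, ∀ r ∈ W, ε ≤ tauW r) (s : ℝ) (hs0 : 0 < s) (hs1 : s < 1) :
    ∃ η0 > (0:ℝ), ∀ (J : Type) (U : J → Set ℝ) (δ : J → ℝ), (∀ j, 0 < δ j) →
      (∀ j, ∀ x ∈ U j, ∀ y ∈ U j, |x - y| ≤ δ j) → (∀ T : Finset J, ∑ j ∈ T, δ j ^ s ≤ η0) →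
      ∃ x ∈ Icc (0:ℝ) 1, (∀ j, x ∉ U j) ∧
        ∀ p, ∀ r ∈ W, WithLp.toLp 2 (fun i => f p i x) ∈ BadSet r := by
  obtain ⟨ε, hε, hτ⟩ := hτ
  choose f1 f2 K C α hC using hf
  obtain ⟨τ, hτdef⟩ : ∃ τ : ℝ, τ = min ε 1 := ⟨_, rfl⟩
  have hτ0 : 0 < τ := by rw [hτdef]; exact lt_min hε one_pos
  have hτ1 : τ ≤ 1 := by rw [hτdef]; exact min_le_right _ _
  have hτε : τ ≤ ε := by rw [hτdef]; exact min_le_left _ _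
  have hwt : ∀ r : W, ∃ i1, Wt (fun i : {i // i ∈ supW r.1} => r.1 i) τ i1 := fun r =>
    exists_Wt r.1 (hWs r.2) τ hτ0 (hτε.trans (hτ r.1 r.2))
  choose i1 hwt using hwt
  obtain ⟨a, ha, hale⟩ := pos_inf (X := P × {s : Finset (Fin n) // s.Nonempty})
    (fun z => α z.1 z.2.1 * (τ / (96 * (Fintype.card {i // i ∈ z.2.1} : ℝ) ^ 2))) (by
      intro z
      have h1 := (hC z.1 z.2.1).hα
      have h2 : 0 < (Fintype.card {i // i ∈ z.2.1} : ℝ) := by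
        rw [Fintype.card_coe]; exact_mod_cast z.2.2.card_pos
      positivity)
  have : Countable W := hW.to_subtype
  have : Countable (P × W) := inferInstance
  obtain ⟨e, he⟩ := exists_injective_nat (P × W)
  let D : ℕ → ℕ → ℕ → ℝ → Prop := fun k q d x => ∃ z : P × W, e z = k ∧
    Dg (fun i : {i // i ∈ supW z.2.1} => f z.1 i) (f1 z.1 (supW z.2.1))
      (fun i : {i // i ∈ supW z.2.1} => z.2.1 i) (i1 z.2) q d x
  have hD : ∀ k, Ctl (D k) τ a := by
    intro k
    by_cases hk : ∃ z, e z = k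
    · obtain ⟨z, rfl⟩ := hk
      have : D (e z) = fun (q d : ℕ) x => Dg (fun i : {i // i ∈ supW z.2.1} => f z.1 i) (f1 z.1 (supW z.2.1))
          (fun i : {i // i ∈ supW z.2.1} => z.2.1 i) (i1 z.2) q d x := by
        funext q d x
        apply propext
        constructor
        · rintro ⟨z', hz', h⟩
          obtain rfl := he hz'
          exact h
        · intro h; exact ⟨z, rfl, h⟩
      rw [this]
      exact (ctl_Dg (hC z.1 (supW z.2.1)) (hwt z.2)).mono (hale (z.1, ⟨supW z.2.1, ⟨_, (i1 z.2).2⟩⟩))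
    · exact Ctl_false _ (fun q d x ⟨z, hz, _⟩ => hk ⟨z, hz⟩) _ _
  obtain ⟨η0, hη0, h⟩ := cantor_main D τ a s hτ0 hτ1 ha hs0 hs1 hD
  refine ⟨η0, hη0, fun J U δ h1 h2 h3 => ?_⟩
  obtain ⟨x, hx, hxU, hxD⟩ := h J U δ h1 h2 h3
  refine ⟨x, hx, hxU, fun p r hr => mem_Bad r _ ?_⟩
  obtain ⟨d0, hd0⟩ := hxD (e (p, ⟨r, hr⟩))
  exact transf (hC p (supW r)) (hwt ⟨r, hr⟩) x hx d0
    (fun q d hd hq hDg => hd0 q d hd hq ⟨(p, ⟨r, hr⟩), rfl, hDg⟩)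
end oned
end Part14

section Part15
open MeasureTheory Set

section scaled

lemma vol_affine (xs ρ : ℝ) (hρ : 0 < ρ) (S : Set ℝ) :
    volume ((fun y => xs + ρ * y) ⁻¹' S) = ENNReal.ofReal ρ⁻¹ * volume S := by
  have : (fun y => xs + ρ * y) ⁻¹' S = (fun y => ρ * y) ⁻¹' ((fun y => xs + y) ⁻¹' S) := rfl
  rw [this, Real.volume_preimage_mul_left hρ.ne', measure_preimage_add, abs_of_pos (inv_pos.2 hρ)]

lemma good_scaled {κ : Type} [Fintype κ] (v : κ → ℝ → ℝ) (xs : ℝ) (hv : ∀ j, AnalyticAt ℝ (v j) xs) :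
    ∃ r > (0:ℝ), ∃ C > (0:ℝ), ∃ α > (0:ℝ), ∀ ρ, 0 < ρ → ρ ≤ r → ∀ c : κ → ℝ, ∀ a b, a < b →
      Icc a b ⊆ Icc 0 1 → ∀ S η, 0 < S → 0 < η →
      (∃ x ∈ Icc a b, S ≤ |∑ j, c j * v j (xs + ρ * x)|) →
      volume {x ∈ Icc a b | |∑ j, c j * v j (xs + ρ * x)| < η * S} ≤
        ENNReal.ofReal (C * η ^ α * (b - a)) := by
  obtain ⟨r, hr, C, hC, α, hα, h⟩ := good_span v xs hv
  refine ⟨r, hr, C, hC, α, hα, fun ρ hρ hρr c a b hab hsub S η hS hη ⟨x, hx, hxS⟩ => ?_⟩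
  have ha := hsub (left_mem_Icc.2 hab.le)
  have hb := hsub (right_mem_Icc.2 hab.le)
  have hmap : ∀ y, y ∈ Icc a b ↔ xs + ρ * y ∈ Icc (xs + ρ * a) (xs + ρ * b) := by
    intro y
    simp only [mem_Icc, add_le_add_iff_left, mul_le_mul_iff_right₀ hρ]
  have h1 := h c (xs + ρ * a) (xs + ρ * b) (by have := mul_lt_mul_of_pos_left hab hρ; linarith) (by
    apply Icc_subset_Icc
    · have := mul_nonneg hρ.le ha.1; linarith
    · have := mul_le_mul_of_nonneg_left hb.2 hρ.le; linarith) S η hS hη ⟨xs + ρ * x, (hmap x).1 hx, hxS⟩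
  have h2 : {x ∈ Icc a b | |∑ j, c j * v j (xs + ρ * x)| < η * S} = (fun y => xs + ρ * y) ⁻¹'
      {x ∈ Icc (xs + ρ * a) (xs + ρ * b) | |∑ j, c j * v j x| < η * S} := by
    ext y
    simp only [mem_preimage]
    exact and_congr_left fun _ => hmap y
  rw [h2, vol_affine xs ρ hρ]
  refine (mul_le_mul_right h1 _).trans ?_
  rw [← ENNReal.ofReal_mul (by positivity)]
  apply ENNReal.ofReal_le_ofReal
  apply le_of_eq
  field_simp
  ring

section gm
variable {ι : Type} [Fintype ι] [DecidableEq ι]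

lemma tmin_sum {κ : Type} [Fintype κ] [DecidableEq κ] (h : Matrix κ κ ℝ) {j : ℕ} (A : Fin j → κ → ℤ) (I : Fin j → κ) :
    tmin h A I = ∑ L : Fin j → κ, (∏ a, h (I a) (L a)) * (Matrix.of fun a b => (A b (L a) : ℝ)).det := by
  have e : (Matrix.of fun a b => hvec h (A b) (I a)) =
      Matrix.of (fun a => ∑ l, h (I a) l • (fun b => (A b l : ℝ))) := by
    ext a b
    simp [hvec, Matrix.mulVec, dotProduct, Finset.sum_apply]
  rw [tmin, e]
  have := (Matrix.detRowAlternating (n := Fin j) (R := ℝ)).toMultilinearMap.map_sum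
    (g := fun (a : Fin j) (l : κ) => h (I a) l • (fun b => (A b l : ℝ)))
  refine this.trans ?_
  apply Finset.sum_congr rfl
  intro L _
  exact (Matrix.detRowAlternating (n := Fin j) (R := ℝ)).toMultilinearMap.map_smul_univ
    (fun a => h (I a) (L a)) (fun a b => (A b (L a) : ℝ))

lemma Mx_analytic (f f1 : ι → ℝ → ℝ) (xs : ℝ) (h0 : ∀ i, AnalyticAt ℝ (f i) xs)
    (h1 : ∀ i, AnalyticAt ℝ (f1 i) xs) (i1 : ι) (k l : Option ι) :
    AnalyticAt ℝ (fun x => Mx f f1 i1 x k l) xs := by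
  cases k with
  | none =>
    cases l with
    | none => simp only [Mx_nn]; exact analyticAt_const
    | some l => simp only [Mx_ns]; exact h0 l
  | some k =>
    by_cases hk : k = i1
    · subst hk
      cases l with
      | none => simp only [Mx_1n]; exact analyticAt_const
      | some l => simp only [Mx_1s]; exact h1 l
    · simp only [Mx_u k hk]; exact analyticAt_const

/-- scaling factors -/
def sg (i1 : ι) (ρ : ℝ) (k : Option ι) : ℝ := if k = some i1 then ρ else 1

lemma Mx_scale (f f1 : ι → ℝ → ℝ) (xs ρ : ℝ) (i1 : ι) (y : ℝ) :
    Mx (fun i y => f i (xs + ρ * y)) (fun i y => ρ * f1 i (xs + ρ * y)) i1 y =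
      Matrix.diagonal (sg i1 ρ) * Mx f f1 i1 (xs + ρ * y) := by
  ext k l
  rw [Matrix.diagonal_mul]
  cases k with
  | none => cases l <;> simp [sg]
  | some k =>
    by_cases hk : k = i1
    · subst hk
      cases l <;> simp [sg]
    · rw [Mx_u k hk, Mx_u k hk]; simp [sg, hk]

lemma good_Mx (f f1 : ι → ℝ → ℝ) (xs : ℝ) (h0 : ∀ i, AnalyticAt ℝ (f i) xs)
    (h1 : ∀ i, AnalyticAt ℝ (f1 i) xs) : ∃ r > (0:ℝ), ∃ C > (0:ℝ), ∃ α > (0:ℝ),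
    ∀ ρ, 0 < ρ → ρ ≤ r → ∀ i1 : ι, ∀ j : ℕ, j ≤ Fintype.card (Option ι) → ∀ (A : Fin j → Option ι → ℤ)
    (I : Fin j → Option ι) (a b : ℝ), a < b → Icc a b ⊆ Icc 0 1 → ∀ S η : ℝ, 0 < S → 0 < η →
    (∃ x ∈ Icc a b, S ≤ |tmin (Mx (fun i y => f i (xs + ρ * y)) (fun i y => ρ * f1 i (xs + ρ * y)) i1 x) A I|) →
    volume {x ∈ Icc a b | |tmin (Mx (fun i y => f i (xs + ρ * y)) (fun i y => ρ * f1 i (xs + ρ * y)) i1 x) A I|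
      < η * S} ≤ ENNReal.ofReal (C * η ^ α * (b - a)) := by
  have key : ∀ z : ι × (Σ j : Fin (Fintype.card (Option ι) + 1), (Fin (j:ℕ) → Option ι)), _ := fun z =>
    good_scaled (fun (L : Fin (z.2.1 : ℕ) → Option ι) x => ∏ a, Mx f f1 z.1 x (z.2.2 a) (L a)) xs
      (fun L => Finset.analyticAt_fun_prod _ fun a _ => Mx_analytic f f1 xs h0 h1 _ _ _)
  choose r hr C hC α hα h using key
  obtain ⟨r', hr', hrle⟩ := pos_inf r hr
  obtain ⟨α', hα', hαle⟩ := pos_inf α hα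
  obtain ⟨C', hC', hCle⟩ := exists_sup C
  refine ⟨r', hr', C', by linarith, α', hα', fun ρ hρ hρr i1 j hj A I a b hab hsub S η hS hη hex => ?_⟩
  let z : ι × (Σ j : Fin (Fintype.card (Option ι) + 1), (Fin (j:ℕ) → Option ι)) :=
    ⟨i1, ⟨⟨j, by omega⟩, I⟩⟩
  have e : ∀ x, tmin (Mx (fun i y => f i (xs + ρ * y)) (fun i y => ρ * f1 i (xs + ρ * y)) i1 x) A I =
      ∑ L : Fin j → Option ι, ((∏ a, sg i1 ρ (I a)) * (Matrix.of fun a b => (A b (L a) : ℝ)).det) *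
        ∏ a, Mx f f1 i1 (xs + ρ * x) (I a) (L a) := by
    intro x
    rw [Mx_scale, tmin_diag, tmin_sum, Finset.mul_sum]
    apply Finset.sum_congr rfl
    intro L _; ring
  have hba : 0 < b - a := by linarith
  rcases le_total η 1 with h1 | h1
  · simp only [e] at hex ⊢
    refine (h z ρ hρ (hρr.trans (hrle z)) (fun L => (∏ a, sg i1 ρ (I a)) *
      (Matrix.of fun a b => (A b (L a) : ℝ)).det) a b hab hsub S η hS hη hex).trans ?_
    apply ENNReal.ofReal_le_ofReal
    apply mul_le_mul_of_nonneg_right _ hba.le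
    exact mul_le_mul (hCle z) (Real.rpow_le_rpow_of_exponent_ge hη h1 (hαle z)) (by positivity) (by linarith)
  · refine (measure_mono (sep_subset _ _)).trans ?_
    rw [Real.volume_Icc]
    apply ENNReal.ofReal_le_ofReal
    have := one_le_mul_of_one_le_of_one_le hC' (Real.one_le_rpow h1 hα'.le)
    exact le_mul_of_one_le_left hba.le this
end gm

/-- generic evaluation points -/
lemma exists_pts {X : Type} {N : ℕ} (g : Fin N → X → ℝ) (S : ℕ → Set X)
    (h : ∀ k, ∀ c : Fin N → ℝ, (∀ x ∈ S k, ∑ l, c l * g l x = 0) → c = 0) :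
    ∃ y : Fin N → X, (∀ k : Fin N, y k ∈ S k) ∧ (Matrix.of fun k l => g l (y k)).det ≠ 0 := by
  have key : ∀ j, j ≤ N → ∃ y : Fin j → X, (∀ k : Fin j, y k ∈ S k) ∧
      LinearIndependent ℝ (fun k : Fin j => (fun l => g l (y k) : Fin N → ℝ)) := by
    intro j
    induction j with
    | zero => intro _; exact ⟨Fin.elim0, fun k => k.elim0, linearIndependent_empty_type⟩
    | succ j ih =>
      intro hj
      obtain ⟨y, hy, hli⟩ := ih (by omega)
      have hlt : Submodule.span ℝ (Set.range (fun k : Fin j => (fun l => g l (y k) : Fin N → ℝ))) < ⊤ := by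
        rw [lt_top_iff_ne_top]
        intro ht
        have h1 := finrank_span_eq_card hli
        rw [ht, finrank_top] at h1
        simp at h1
        omega
      obtain ⟨φ, hφ, hker⟩ := Submodule.exists_le_ker_of_lt_top _ hlt
      have hφe : ∀ v : Fin N → ℝ, φ v = ∑ l, φ (Pi.single l 1) * v l := by
        intro v
        conv_lhs => rw [LinearMap.pi_apply_eq_sum_univ φ v]
        apply Finset.sum_congr rfl
        intro l _
        rw [smul_eq_mul, mul_comm]
        congr 2
        ext l'
        simp [Pi.single_apply, eq_comm]
      obtain ⟨x, hx, hne⟩ : ∃ x ∈ S j, ∑ l, φ (Pi.single l 1) * g l x ≠ 0 := by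
        by_contra hc
        push Not at hc
        have h0 := h j _ hc
        apply hφ
        ext v
        simpa using congrFun h0 v
      refine ⟨Fin.snoc y x, ?_, ?_⟩
      · intro k
        refine Fin.lastCases ?_ (fun k => ?_) k
        · simpa using hx
        · simpa using hy k
      · have e : (fun k : Fin (j+1) => (fun l => g l ((Fin.snoc y x : Fin (j+1) → X) k) : Fin N → ℝ)) =
            Fin.snoc (α := fun _ => Fin N → ℝ) (fun k : Fin j => (fun l => g l (y k) : Fin N → ℝ)) (fun l => g l x) := by
          ext k l
          refine Fin.lastCases ?_ (fun k => ?_) k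
          · simp
          · simp
        rw [e, linearIndependent_finSnoc]
        refine ⟨hli, fun hmem => hne ?_⟩
        rw [← hφe (fun l => g l x)]
        exact hker hmem
  obtain ⟨y, hy, hli⟩ := key N le_rfl
  refine ⟨y, hy, ?_⟩
  have := (Matrix.linearIndependent_rows_iff_isUnit (A := Matrix.of fun k l => g l (y k))).1 hli
  exact ((Matrix.isUnit_iff_isUnit_det _).1 this).ne_zero
end scaled
end Part15

section Part16
open MeasureTheory Set

section crvex

lemma nd_bound {N : ℕ} (g : Fin N → ℝ → ℝ) (S : Set ℝ)
    (h : ∀ c : Fin N → ℝ, (∀ x ∈ S, ∑ l, c l * g l x = 0) → c = 0) :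
    ∃ K ≥ (1:ℝ), ∀ (c : Fin N → ℝ) (M : ℝ), (∀ x ∈ S, |∑ l, c l * g l x| ≤ M) → 0 ≤ M →
      ∀ k, |c k| ≤ K * M := by
  obtain ⟨y, hy, hdet⟩ := exists_pts g (fun _ => S) (fun _ => h)
  set E := Matrix.of fun k l => g l (y k) with hE
  obtain ⟨K, hK1, hK⟩ := exists_sup (fun k : Fin N => ∑ l, |E⁻¹ k l|)
  refine ⟨K, hK1, fun c M hc hM k => ?_⟩
  have h1 : c = E⁻¹.mulVec (E.mulVec c) := by
    rw [Matrix.mulVec_mulVec, Matrix.nonsing_inv_mul _ (isUnit_iff_ne_zero.2 hdet), Matrix.one_mulVec]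
  have h2 : ∀ l, |E.mulVec c l| ≤ M := by
    intro l
    have : E.mulVec c l = ∑ i, c i * g i (y l) := by
      simp [hE, Matrix.mulVec, dotProduct, mul_comm]
    rw [this]
    exact hc _ (hy l)
  rw [h1, Matrix.mulVec, dotProduct]
  refine (Finset.abs_sum_le_sum_abs _ _).trans ?_
  calc ∑ l, |E⁻¹ k l * E.mulVec c l| ≤ ∑ l, |E⁻¹ k l| * M := by
        apply Finset.sum_le_sum
        intro l _
        rw [abs_mul]
        exact mul_le_mul_of_nonneg_left (h2 l) (abs_nonneg _)
    _ = (∑ l, |E⁻¹ k l|) * M := by rw [Finset.sum_mul]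
    _ ≤ K * M := mul_le_mul_of_nonneg_right (hK k) hM

lemma crv_exists {n : ℕ} (f : Fin n → ℝ → ℝ) (xs : ℝ) (han : ∀ i, AnalyticAt ℝ (f i) xs)
    (hd : ∀ i, deriv (f i) xs ≠ 0)
    (hnd : ∀ r > (0:ℝ), ∀ (c0 : ℝ) (c : Fin n → ℝ), (∀ x ∈ Ioo xs (xs + r), c0 + ∑ i, c i * f i x = 0) →
      c0 = 0 ∧ c = 0) :
    ∃ r > (0:ℝ), ∀ ρ, 0 < ρ → ρ ≤ r → ∀ s : Finset (Fin n),
      ∃ (f1 f2 : {i // i ∈ s} → ℝ → ℝ) (K C α : ℝ),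
        Crv (fun (i : {i // i ∈ s}) y => f i (xs + ρ * y)) f1 f2 K C α := by
  have han1 : ∀ i, AnalyticAt ℝ (deriv (f i)) xs := fun i => (han i).deriv
  have han2 : ∀ i, AnalyticAt ℝ (deriv (deriv (f i))) xs := fun i => (han1 i).deriv
  have key : ∀ s : Finset (Fin n), _ := fun s =>
    good_Mx (fun i : {i // i ∈ s} => f i) (fun i => deriv (f i)) xs (fun i => han i) (fun i => han1 i)
  choose r0 hr0 C hC α hα hgood using key
  obtain ⟨r1, hr1, hr1le⟩ := pos_inf r0 hr0
  have hev : ∀ᶠ x in nhds xs, ∀ i, AnalyticAt ℝ (f i) x ∧ |f i x| < |f i xs| + 1 ∧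
      |deriv (f i) x| < |deriv (f i) xs| + 1 ∧ |deriv (deriv (f i)) x| < |deriv (deriv (f i)) xs| + 1 ∧
      |deriv (f i) xs| / 2 < |deriv (f i) x| := by
    rw [Filter.eventually_all]
    intro i
    refine (han i).eventually_analyticAt.and (Filter.Eventually.and ?_ (Filter.Eventually.and ?_
      (Filter.Eventually.and ?_ ?_)))
    · exact (han i).continuousAt.abs.eventually_lt_const (by linarith)
    · exact (han1 i).continuousAt.abs.eventually_lt_const (by linarith)
    · exact (han2 i).continuousAt.abs.eventually_lt_const (by linarith)
    · exact (han1 i).continuousAt.abs.eventually_const_lt (by have := abs_pos.2 (hd i); linarith)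
  obtain ⟨e, he, hball⟩ := Metric.eventually_nhds_iff.1 hev
  refine ⟨min r1 (e / 2), lt_min hr1 (by linarith), fun ρ hρ hρr s => ?_⟩
  have hρ1 : ρ ≤ r1 := hρr.trans (min_le_left _ _)
  have hρ2 : ρ ≤ e / 2 := hρr.trans (min_le_right _ _)
  have hb : ∀ y ∈ Icc (0:ℝ) 1, ∀ i, AnalyticAt ℝ (f i) (xs + ρ * y) ∧ |f i (xs + ρ * y)| < |f i xs| + 1 ∧
      |deriv (f i) (xs + ρ * y)| < |deriv (f i) xs| + 1 ∧
      |deriv (deriv (f i)) (xs + ρ * y)| < |deriv (deriv (f i)) xs| + 1 ∧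
      |deriv (f i) xs| / 2 < |deriv (f i) (xs + ρ * y)| := by
    intro y hy
    apply hball
    rw [Real.dist_eq, add_sub_cancel_left, abs_of_nonneg (mul_nonneg hρ.le hy.1)]
    have := mul_le_mul_of_nonneg_left hy.2 hρ.le
    linarith
  obtain ⟨K0, hK0, hK0'⟩ := exists_sup (fun i => |f i xs| + 1)
  obtain ⟨K1, hK1, hK1'⟩ := exists_sup (fun i => ρ * (|deriv (f i) xs| + 1))
  obtain ⟨K2, hK2, hK2'⟩ := exists_sup (fun i => ρ * (ρ * (|deriv (deriv (f i)) xs| + 1)))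
  obtain ⟨K3, hK3, hK3'⟩ := exists_sup (fun i => (ρ * (|deriv (f i) xs| / 2))⁻¹)
  obtain ⟨K4, hK4, hK4'⟩ := nd_bound (N := n + 1)
    (fun l y => Fin.cases (motive := fun _ => ℝ) 1 (fun i => f i (xs + ρ * y)) l) (Ico 0 1) (by
      intro c hc
      have h1 := hnd ρ hρ (c 0) (fun i => c i.succ) (by
        intro x hx
        have := hc ((x - xs) / ρ) ⟨div_nonneg (by linarith [hx.1]) hρ.le, by
          rw [div_lt_one hρ]; linarith [hx.2]⟩
        rw [Fin.sum_univ_succ] at this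
        have e : xs + ρ * ((x - xs) / ρ) = x := by field_simp; ring
        simpa [e] using this)
      ext k
      refine Fin.cases ?_ (fun i => ?_) k
      · exact h1.1
      · exact congrFun h1.2 i)
  have hKK : ∀ a b c d : ℝ, 1 ≤ a → 1 ≤ b → 1 ≤ c → 1 ≤ d → a ≤ a + b + c + d := by intros; linarith
  refine ⟨fun i y => ρ * deriv (f i) (xs + ρ * y), fun i y => ρ * (ρ * deriv (deriv (f i)) (xs + ρ * y)),
    K0 + K1 + K2 + K3 + K4, C s, α s, ?_, hC s, hα s, ?_, ?_, ?_, ?_, ?_, ?_, ?_, ?_⟩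
  · linarith
  · intro i y hy
    have h1 := (hb y hy i).1.differentiableAt.hasDerivAt
    have h2 : HasDerivAt (fun y => xs + ρ * y) ρ y := by
      simpa using ((hasDerivAt_id y).const_mul ρ).const_add xs
    have := h1.comp y h2
    rw [mul_comm] at this
    exact this
  · intro i y hy
    have h1 := (hb y hy i).1.deriv.differentiableAt.hasDerivAt
    have h2 : HasDerivAt (fun y => xs + ρ * y) ρ y := by
      simpa using ((hasDerivAt_id y).const_mul ρ).const_add xs
    have := (h1.comp y h2).const_mul ρ
    rw [mul_comm _ ρ] at this
    exact this
  · intro i y hy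
    have := (hb y hy i).2.1
    have := hK0' i
    linarith
  · intro i y hy
    have h1 := (hb y hy i).2.2.1
    rw [abs_mul, abs_of_pos hρ]
    have h2 := mul_le_mul_of_nonneg_left h1.le hρ.le
    have := hK1' i
    linarith
  · intro i y hy
    have h1 := (hb y hy i).2.2.2.1
    rw [abs_mul, abs_mul, abs_of_pos hρ]
    have h2 := mul_le_mul_of_nonneg_left (mul_le_mul_of_nonneg_left h1.le hρ.le) hρ.le
    have := hK2' i
    linarith
  · intro i y hy
    have h1 := (hb y hy i).2.2.2.2
    have h3 := abs_pos.2 (hd i)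
    have h4 : 0 < ρ * (|deriv (f i) xs| / 2) := by positivity
    rw [abs_mul, abs_of_pos hρ]
    have h5 := hK3' i
    have h6 : (ρ * (|deriv (f i) xs| / 2))⁻¹ ≤ K0 + K1 + K2 + K3 + K4 := by linarith
    have h7 := mul_le_mul_of_nonneg_left h1.le hρ.le
    calc (1:ℝ) = (ρ * (|deriv (f i) xs| / 2))⁻¹ * (ρ * (|deriv (f i) xs| / 2)) :=
          (inv_mul_cancel₀ h4.ne').symm
      _ ≤ _ := mul_le_mul h6 h7 h4.le (by linarith)
  · exact hgood s ρ hρ (hρ1.trans (hr1le s))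
  · intro c M hM k
    have hM0 : 0 ≤ M := (abs_nonneg _).trans (hM 0 ⟨le_rfl, one_pos⟩)
    have h1 := hK4' (fun l => Fin.cases (motive := fun _ => ℝ) (c none)
      (fun i => if h : i ∈ s then c (some ⟨i, h⟩) else 0) l) M (by
        intro x hx
        have := hM x hx
        rw [Fin.sum_univ_succ]
        simp only [Fin.cases_zero, Fin.cases_succ, mul_one]
        have e : ∑ i : Fin n, (if h : i ∈ s then c (some ⟨i, h⟩) else 0) * f i (xs + ρ * x) =
            ∑ i : {i // i ∈ s}, f i (xs + ρ * x) * c (some i) := by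
          rw [← Finset.sum_subset (Finset.subset_univ s)]
          · rw [← Finset.sum_coe_sort s]
            apply Finset.sum_congr rfl
            intro i _
            simp [mul_comm]
          · intro i _ hi
            simp [hi]
        rw [e]
        exact this) hM0
    have h2 : |c k| ≤ K4 * M := by
      cases k with
      | none => simpa using h1 0
      | some i => simpa using h1 (Fin.succ i.1)
    refine h2.trans (mul_le_mul_of_nonneg_right (by linarith) hM0)
end crvex
end Part16

section Part17
open MeasureTheory Set

section curve1

theorem curve1 {n : ℕ} {P : Type} [Finite P] (f : P → Fin n → ℝ → ℝ) (a b : ℝ) (hab : a < b)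
    (han : ∀ p i, AnalyticOnNhd ℝ (f p i) (Ioo a b))
    (hnd : ∀ p, ∀ (c0 : ℝ) (c : Fin n → ℝ), (∀ x ∈ Ioo a b, c0 + ∑ i, c i * f p i x = 0) → c0 = 0 ∧ c = 0)
    (W : Set (Fin n → ℝ)) (hW : W.Countable) (hWs : W ⊆ Weights n)
    (hτ : ∃ ε > 0, ∀ r ∈ W, ε ≤ tauW r) (s : ℝ) (hs0 : 0 < s) (hs1 : s < 1) :
    ∃ η0 > (0:ℝ), ∀ (J : Type) (U : J → Set ℝ) (δ : J → ℝ), (∀ j, 0 < δ j) →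
      (∀ j, ∀ x ∈ U j, ∀ y ∈ U j, |x - y| ≤ δ j) → (∀ T : Finset J, ∑ j ∈ T, δ j ^ s ≤ η0) →
      ∃ x ∈ Ioo a b, (∀ j, x ∉ U j) ∧
        ∀ p, ∀ r ∈ W, WithLp.toLp 2 (fun i => f p i x) ∈ BadSet r := by
  have hx0 : (a + b) / 2 ∈ Ioo a b := ⟨by linarith, by linarith⟩
  have hpc : IsPreconnected (Ioo a b) := isPreconnected_Ioo
  have hev : ∀ᶠ x in nhdsWithin ((a + b) / 2) {(a + b) / 2}ᶜ, x ∈ Ioo a b ∧ ∀ z : P × Fin n, deriv (f z.1 z.2) x ≠ 0 := by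
    refine Filter.Eventually.and ?_ ?_
    · exact mem_nhdsWithin_of_mem_nhds (isOpen_Ioo.mem_nhds hx0)
    rw [Filter.eventually_all]
    rintro ⟨p, i⟩
    have h1 : AnalyticOnNhd ℝ (deriv (f p i)) (Ioo a b) := (han p i).deriv
    rcases (h1 _ hx0).eventually_eq_zero_or_eventually_ne_zero with h | h
    · exfalso
      have h2 := h1.eqOn_zero_of_preconnected_of_eventuallyEq_zero hpc hx0 h
      have h3 : ∀ x ∈ Ioo a b, f p i x = f p i ((a + b) / 2) := by
        intro x hx
        refine isOpen_Ioo.is_const_of_deriv_eq_zero hpc ?_ h2 hx hx0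
        exact (han p i).differentiableOn
      have h4 := hnd p (- f p i ((a + b) / 2)) (Pi.single i 1) (by
        intro x hx
        rw [Finset.sum_eq_single i]
        · rw [h3 x hx]; simp
        · intro j _ hj; simp [hj]
        · simp)
      have := congrFun h4.2 i
      simp at this
    · exact h
  obtain ⟨xs, hxs, hder⟩ := hev.exists
  have key : ∀ p, _ := fun p => crv_exists (f p) xs (fun i => han p i xs hxs) (fun i => hder (p, i)) (by
    intro r hr c0 c hc
    apply hnd p
    have hF : AnalyticOnNhd ℝ (fun x => c0 + ∑ i, c i * f p i x) (Ioo a b) := by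
      intro x hx
      apply AnalyticAt.add analyticAt_const
      apply Finset.analyticAt_fun_sum
      intro i _
      exact analyticAt_const.mul (han p i x hx)
    have hfr : ∃ᶠ x in nhdsWithin xs {xs}ᶜ, (fun x => c0 + ∑ i, c i * f p i x) x = 0 := by
      have h1 : ∀ᶠ x in nhdsWithin xs (Ioi xs), (fun x => c0 + ∑ i, c i * f p i x) x = 0 := by
        filter_upwards [Ioo_mem_nhdsGT (show xs < xs + r by linarith)] with x hx
        exact hc x hx
      exact h1.frequently.filter_mono (nhdsWithin_mono _ (fun x hx => ne_of_gt hx))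
    exact hF.eqOn_zero_of_preconnected_of_frequently_eq_zero hpc hxs hfr)
  choose r hr hcrv using key
  obtain ⟨r', hr', hrle⟩ := pos_inf r hr
  obtain ⟨ρ, hρdef⟩ : ∃ ρ : ℝ, ρ = min r' ((b - xs) / 2) := ⟨_, rfl⟩
  have hρ0 : 0 < ρ := by rw [hρdef]; exact lt_min hr' (by linarith [hxs.2])
  have hρ1 : ρ ≤ r' := by rw [hρdef]; exact min_le_left _ _
  have hρ2 : ρ ≤ (b - xs) / 2 := by rw [hρdef]; exact min_le_right _ _
  obtain ⟨η, hη, h⟩ := oneD (fun p i y => f p i (xs + ρ * y))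
    (fun p s => hcrv p ρ hρ0 (hρ1.trans (hrle p)) s) W hW hWs hτ s hs0 hs1
  have hρs : 0 < ρ ^ s := Real.rpow_pos_of_pos hρ0 _
  refine ⟨ρ ^ s * η, mul_pos hρs hη, fun J U δ h1 h2 h3 => ?_⟩
  obtain ⟨y, hy, hyU, hyB⟩ := h J (fun j => {y | xs + ρ * y ∈ U j}) (fun j => δ j / ρ)
    (fun j => div_pos (h1 j) hρ0) (by
      intro j x hx y hy
      have := h2 j _ hx _ hy
      rw [le_div_iff₀ hρ0]
      have e : xs + ρ * x - (xs + ρ * y) = (x - y) * ρ := by ring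
      rwa [e, abs_mul, abs_of_pos hρ0] at this) (by
      intro T
      have : ∀ j, (δ j / ρ) ^ s = δ j ^ s / ρ ^ s := fun j => Real.div_rpow (h1 j).le hρ0.le _
      simp only [this]
      rw [← Finset.sum_div, div_le_iff₀ hρs, mul_comm]
      exact h3 T)
  refine ⟨xs + ρ * y, ⟨?_, ?_⟩, hyU, hyB⟩
  · have := mul_nonneg hρ0.le hy.1; linarith [hxs.1]
  · have := mul_le_mul_of_nonneg_left hy.2 hρ0.le; linarith [hxs.2]
end curve1
end Part17

section Part18
open MeasureTheory Set ENNReal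

section slice

lemma covers {X : Type} [MetricSpace X] [MeasurableSpace X] [BorelSpace X] (G : Set X) (d : ℝ) (hd : 0 < d)
    (h : Measure.hausdorffMeasure d G = 0) (ε : ℝ≥0∞) (hε : ε ≠ 0) :
    ∃ (U : ℕ → Set X) (δ : ℕ → ℝ), (∀ j, 0 < δ j) ∧ (∀ j, ∀ x ∈ U j, ∀ y ∈ U j, dist x y ≤ δ j) ∧
      G ⊆ ⋃ j, U j ∧ ∑' j, ENNReal.ofReal (δ j ^ d) ≤ ε := by
  rw [Measure.hausdorffMeasure_apply] at h
  have h1 := (iSup_eq_bot.1 ((iSup_eq_bot.1 h) 1)) one_pos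
  have hε2 : ε / 2 ≠ 0 := by simpa using hε
  have h2 := lt_of_eq_of_lt h1 (pos_iff_ne_zero.2 hε2)
  simp only [iInf_lt_iff] at h2
  obtain ⟨U, hU, hdiam, hsum⟩ := h2
  have hsum' : ∑' j, (Metric.ediam (U j)) ^ d < ε / 2 := by
    refine lt_of_le_of_lt (ENNReal.tsum_le_tsum fun j => ?_) hsum
    by_cases hne : (U j).Nonempty
    · simp [hne]
    · rw [not_nonempty_iff_eq_empty] at hne
      simp [hne, hd]
  obtain ⟨e, he, hesum⟩ := ENNReal.exists_pos_sum_of_countable hε2 ℕ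
  have hfin : ∀ j, Metric.ediam (U j) ≠ ∞ := fun j => ((hdiam j).trans_lt one_lt_top).ne
  have hpos : ∀ j, 0 < (Metric.ediam (U j)).toReal ^ d + e j := fun j =>
    add_pos_of_nonneg_of_pos (Real.rpow_nonneg toReal_nonneg _) (NNReal.coe_pos.2 (he j))
  refine ⟨U, fun j => ((Metric.ediam (U j)).toReal ^ d + e j) ^ (1 / d), ?_, ?_, hU, ?_⟩
  · intro j; exact Real.rpow_pos_of_pos (hpos j) _
  · intro j x hx y hy
    have h3 : dist x y ≤ (Metric.ediam (U j)).toReal := by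
      rw [dist_edist]
      exact toReal_mono (hfin j) (Metric.edist_le_ediam_of_mem hx hy)
    refine h3.trans ?_
    calc (Metric.ediam (U j)).toReal = ((Metric.ediam (U j)).toReal ^ d) ^ (1 / d) := by
          rw [← Real.rpow_mul toReal_nonneg, mul_one_div_cancel hd.ne', Real.rpow_one]
      _ ≤ _ := Real.rpow_le_rpow (Real.rpow_nonneg toReal_nonneg _)
            (le_add_of_nonneg_right (e j).2) (by positivity)
  · have h4 : ∀ j, ENNReal.ofReal ((((Metric.ediam (U j)).toReal ^ d + e j) ^ (1 / d)) ^ d) =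
        Metric.ediam (U j) ^ d + e j := by
      intro j
      rw [← Real.rpow_mul (hpos j).le, one_div_mul_cancel hd.ne', Real.rpow_one,
        ENNReal.ofReal_add (Real.rpow_nonneg toReal_nonneg _) (NNReal.coe_nonneg (e j)),
        ← ENNReal.ofReal_rpow_of_nonneg toReal_nonneg hd.le, ofReal_toReal (hfin j)]
      simp
    simp only [h4]
    rw [ENNReal.tsum_add]
    calc _ ≤ ε / 2 + ε / 2 := add_le_add hsum'.le hesum.le
      _ = ε := ENNReal.add_halves ε

theorem slice {k : ℕ} {X : Type} [MetricSpace X] [MeasurableSpace X] [BorelSpace X] (G : Set X)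
    (Γ : (Fin k → ℝ) → ℝ → X) (a b Λ : ℝ) (hb : 0 < b) (hΛ : 0 < Λ)
    (h0 : ∀ u t t', |t - t'| ≤ dist (Γ u t) (Γ u t'))
    (hu : ∀ u u', ∀ t ∈ Ioo (-a) a, ∀ t' ∈ Ioo (-a) a, ∀ i, |u i - u' i| ≤ Λ * dist (Γ u t) (Γ u' t'))
    (s : ℝ) (hs : 0 < s)
    (h1d : ∀ u, (∀ i, |u i| < b) → ∃ η0 > (0:ℝ), ∀ (J : Type) (U : J → Set ℝ) (δ : J → ℝ), (∀ j, 0 < δ j) →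
      (∀ j, ∀ x ∈ U j, ∀ y ∈ U j, |x - y| ≤ δ j) → (∀ T : Finset J, ∑ j ∈ T, δ j ^ s ≤ η0) →
      ∃ t ∈ Ioo (-a) a, (∀ j, t ∉ U j) ∧ Γ u t ∈ G) :
    Measure.hausdorffMeasure (s + k) G ≠ 0 := by
  intro hzero
  have hsk : 0 < s + k := by positivity
  have hcov := fun N : ℕ => covers G (s + k) hsk hzero (2⁻¹ ^ N) (by simp)
  choose U δ hδ hdist hcover hsum using hcov
  -- the boxes
  let A : ℕ → ℕ → Set (Fin k → ℝ) := fun N j => {u | ∃ t ∈ Ioo (-a) a, Γ u t ∈ U N j}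
  have hbox : ∀ N j, ∃ A' : Set (Fin k → ℝ), MeasurableSet A' ∧ A N j ⊆ A' ∧
      volume A' ≤ ENNReal.ofReal ((2 * Λ * δ N j) ^ k) := by
    intro N j
    rcases (A N j).eq_empty_or_nonempty with h | ⟨u, t, ht, hut⟩
    · exact ⟨∅, MeasurableSet.empty, by rw [h], by simp⟩
    · have hr : 0 ≤ Λ * δ N j := mul_nonneg hΛ.le (hδ N j).le
      refine ⟨Metric.closedBall u (Λ * δ N j), measurableSet_closedBall, ?_, ?_⟩
      · rintro u' ⟨t', ht', hut'⟩
        rw [Metric.mem_closedBall, dist_pi_le_iff hr]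
        intro i
        rw [Real.dist_eq]
        exact (hu u' u t' ht' t ht i).trans
          (mul_le_mul_of_nonneg_left (hdist N j _ hut' _ hut) hΛ.le)
      · rw [Real.volume_pi_closedBall u hr]
        simp [mul_assoc]
  choose A' hAm hAsub hAvol using hbox
  let φ : ℕ → (Fin k → ℝ) → ℝ≥0∞ := fun N u =>
    ∑' j, (A' N j).indicator (fun _ => ENNReal.ofReal (δ N j ^ s)) u
  have hφm : ∀ N, Measurable (φ N) := fun N =>
    Measurable.tsum fun j => measurable_const.indicator (hAm N j)
  have hφi : ∀ N, ∫⁻ u, φ N u ≤ ENNReal.ofReal ((2 * Λ) ^ k) * 2⁻¹ ^ N := by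
    intro N
    have hm : ∀ j, Measurable ((A' N j).indicator (fun _ => ENNReal.ofReal (δ N j ^ s))) :=
      fun j => measurable_const.indicator (hAm N j)
    calc ∫⁻ u, φ N u = ∑' j, ∫⁻ u, (A' N j).indicator (fun _ => ENNReal.ofReal (δ N j ^ s)) u :=
          lintegral_tsum fun j => (hm j).aemeasurable
      _ ≤ ∑' j, ENNReal.ofReal ((2 * Λ) ^ k) * ENNReal.ofReal (δ N j ^ (s + k)) := by
          apply ENNReal.tsum_le_tsum
          intro j
          rw [lintegral_indicator (hAm N j), setLIntegral_const]
          refine (mul_le_mul_right (hAvol N j) _).trans ?_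
          rw [← ENNReal.ofReal_mul (Real.rpow_nonneg (hδ N j).le _), ← ENNReal.ofReal_mul (by positivity)]
          apply le_of_eq
          congr 1
          rw [Real.rpow_add (hδ N j), Real.rpow_natCast, mul_pow]
          ring
      _ = ENNReal.ofReal ((2 * Λ) ^ k) * ∑' j, ENNReal.ofReal (δ N j ^ (s + k)) := ENNReal.tsum_mul_left
      _ ≤ _ := by gcongr; exact hsum N
  have htot : ∫⁻ u, ∑' N, φ N u ≠ ∞ := by
    rw [lintegral_tsum fun N => (hφm N).aemeasurable]
    refine ne_top_of_le_ne_top ?_ (ENNReal.tsum_le_tsum hφi)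
    rw [ENNReal.tsum_mul_left, ENNReal.tsum_geometric]
    refine ENNReal.mul_ne_top ENNReal.ofReal_ne_top ?_
    simp
  have hae := ae_lt_top (Measurable.tsum hφm) htot
  have hball : volume (Metric.ball (0 : Fin k → ℝ) b) ≠ 0 := (Metric.measure_ball_pos _ _ hb).ne'
  obtain ⟨u, hub, hfin⟩ : ∃ u ∈ Metric.ball (0 : Fin k → ℝ) b, ∑' N, φ N u < ∞ := by
    by_contra hc
    push Not at hc
    apply hball
    refine measure_mono_null (fun u hu => ?_) hae
    simpa using hc u hu
  have hub' : ∀ i, |u i| < b := by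
    intro i
    rw [Metric.mem_ball, dist_pi_lt_iff hb] at hub
    simpa [Real.dist_eq] using hub i
  obtain ⟨η0, hη0, h1⟩ := h1d u hub'
  have htend := ENNReal.tendsto_atTop_zero_of_tsum_ne_top hfin.ne
  obtain ⟨N, hN⟩ := (htend.eventually_le_const (ENNReal.ofReal_pos.2 hη0)).exists
  obtain ⟨t, ht, htU, htG⟩ := h1 {j // u ∈ A' N j} (fun j => {t | Γ u t ∈ U N j}) (fun j => δ N j)
    (fun j => hδ N j) (fun j x hx y hy => (h0 u x y).trans (hdist N j _ hx _ hy)) (by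
      intro T
      rw [← ENNReal.ofReal_le_ofReal_iff hη0.le]
      refine le_trans ?_ hN
      rw [ENNReal.ofReal_sum_of_nonneg (f := fun j : {j // u ∈ A' N j} => δ N j ^ s)
        (fun j _ => Real.rpow_nonneg (hδ N j).le _)]
      calc ∑ j ∈ T, ENNReal.ofReal (δ N j ^ s)
          = ∑ j ∈ T, (A' N j).indicator (fun _ => ENNReal.ofReal (δ N j ^ s)) u := by
            apply Finset.sum_congr rfl
            intro j _
            rw [indicator_of_mem j.2]
        _ = ∑ j ∈ T.map (Function.Embedding.subtype _), (A' N j).indicator (fun _ => ENNReal.ofReal (δ N j ^ s)) u := by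
            rw [Finset.sum_map]; rfl
        _ ≤ φ N u := ENNReal.sum_le_tsum _)
  obtain ⟨j, hj⟩ := mem_iUnion.1 (hcover N htG)
  exact htU ⟨j, hAsub N j ⟨t, ht, hj⟩⟩ hj
end slice
end Part18

section Part19
open MeasureTheory Set

section curves

/-- translate -/
noncomputable def embE {k : ℕ} (x₀ : EuclideanSpace ℝ (Fin k)) (v : Fin k → ℝ) : EuclideanSpace ℝ (Fin k) :=
  x₀ + WithLp.toLp 2 v

@[simp] lemma embE_apply {k : ℕ} (x₀ : EuclideanSpace ℝ (Fin k)) (v : Fin k → ℝ) (j : Fin k) :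
    embE x₀ v j = x₀ j + v j := by simp [embE]

lemma embE_cont {k : ℕ} (x₀ : EuclideanSpace ℝ (Fin k)) : Continuous (embE x₀) := by
  unfold embE; fun_prop

/-- polynomial curves -/
noncomputable def Gm {k : ℕ} (x₀ : EuclideanSpace ℝ (Fin (k+1))) (g : Fin k → Polynomial ℝ) (u : Fin k → ℝ)
    (t : ℝ) : EuclideanSpace ℝ (Fin (k+1)) :=
  embE x₀ (Fin.cons t fun i => u i + (g i).eval t)

lemma box_in {k : ℕ} (x₀ : EuclideanSpace ℝ (Fin k)) (ρ : ℝ) (hρ : 0 < ρ) :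
    ∃ a > (0:ℝ), ∀ v : Fin k → ℝ, (∀ j, |v j| < a) → embE x₀ v ∈ Metric.ball x₀ ρ := by
  have h1 : ∀ᶠ v in nhds (0 : Fin k → ℝ), embE x₀ v ∈ Metric.ball x₀ ρ := by
    apply (embE_cont x₀).continuousAt.eventually_mem
    apply Metric.isOpen_ball.mem_nhds
    have : embE x₀ 0 = x₀ := by ext j; simp
    rw [this]; exact Metric.mem_ball_self hρ
  obtain ⟨a, ha, h⟩ := Metric.eventually_nhds_iff.1 h1
  refine ⟨a, ha, fun v hv => h ?_⟩
  rw [dist_pi_lt_iff ha]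
  intro j
  simpa [Real.dist_eq] using hv j

/-- the functions 1, f1, ..., fn -/
noncomputable def Ff {m n : ℕ} (f : EuclideanSpace ℝ (Fin m) → EuclideanSpace ℝ (Fin n))
    (x : EuclideanSpace ℝ (Fin m)) (l : Fin (n+1)) : ℝ := Fin.cases (motive := fun _ => ℝ) 1 (fun i => f x i) l

lemma Ff_sum {m n : ℕ} (f : EuclideanSpace ℝ (Fin m) → EuclideanSpace ℝ (Fin n))
    (x : EuclideanSpace ℝ (Fin m)) (c : Fin (n+1) → ℝ) :
    ∑ l, c l * Ff f x l = c 0 + ∑ i : Fin n, c i.succ * f x i := by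
  rw [Fin.sum_univ_succ]; simp [Ff]

lemma coord_analytic {m n : ℕ} (f : EuclideanSpace ℝ (Fin m) → EuclideanSpace ℝ (Fin n))
    (x : EuclideanSpace ℝ (Fin m)) (h : AnalyticAt ℝ f x) (i : Fin n) : AnalyticAt ℝ (fun x => f x i) x :=
  ((EuclideanSpace.proj (𝕜 := ℝ) i).analyticAt _).comp h

/-- node set -/
def Snode (k : ℕ) (h ε : ℝ) (q : ℕ) : Set (Fin (k+1) → ℝ) :=
  {v | v 0 ∈ Ioo (2 * q * h) ((2 * q + 1) * h) ∧ ∀ i : Fin k, |v i.succ| < ε}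

lemma node_nd {k n : ℕ} (x₀ : EuclideanSpace ℝ (Fin (k+1))) (ρ a : ℝ)
    (hbox : ∀ v : Fin (k+1) → ℝ, (∀ j, |v j| < a) → embE x₀ v ∈ Metric.ball x₀ ρ)
    (f : EuclideanSpace ℝ (Fin (k+1)) → EuclideanSpace ℝ (Fin n))
    (han : AnalyticOnNhd ℝ f (Metric.ball x₀ ρ)) (hnd : NondegOn f (Metric.ball x₀ ρ))
    (h ε : ℝ) (hh : 0 < h) (hε : 0 < ε) (q : ℕ) (hqa : (2 * q + 1) * h < a) (ha : 0 < a)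
    (c : Fin (n+1) → ℝ) (hc : ∀ v ∈ Snode k h ε q, ∑ l, c l * Ff f (embE x₀ v) l = 0) : c = 0 := by
  obtain ⟨v0, hv0⟩ : ∃ v0 : Fin (k+1) → ℝ, v0 = Fin.cons ((2 * q + 1/2) * h) (fun _ => 0) := ⟨_, rfl⟩
  have hv00 : v0 0 = (2 * q + 1/2) * h := by rw [hv0]; simp
  have hv0s : ∀ i : Fin k, v0 i.succ = 0 := by intro i; rw [hv0]; simp
  have hq0 : (0:ℝ) ≤ q := Nat.cast_nonneg q
  have hx0 : embE x₀ v0 ∈ Metric.ball x₀ ρ := by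
    apply hbox
    intro j
    refine Fin.cases ?_ (fun i => ?_) j
    · rw [hv00, abs_of_nonneg (by positivity)]
      nlinarith
    · rw [hv0s]; simpa using ha
  have hF : AnalyticOnNhd ℝ (fun x => ∑ l, c l * Ff f x l) (Metric.ball x₀ ρ) := by
    intro x hx
    simp only [Ff_sum]
    apply AnalyticAt.add analyticAt_const
    apply Finset.analyticAt_fun_sum
    intro i _
    exact analyticAt_const.mul (coord_analytic f x (han x hx) i)
  have hev : ∀ᶠ x in nhds (embE x₀ v0), (fun x => ∑ l, c l * Ff f x l) x = 0 := by
    have h1 : ∀ᶠ x in nhds (embE x₀ v0), (fun j => x j - x₀ j) ∈ Snode k h ε q := by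
      refine Filter.Eventually.and ?_ ?_
      · have hcont : Continuous (fun x : EuclideanSpace ℝ (Fin (k+1)) => x 0 - x₀ 0) := by fun_prop
        apply hcont.continuousAt.eventually_mem
        apply isOpen_Ioo.mem_nhds
        simp only [embE_apply, hv00, add_sub_cancel_left]
        constructor <;> nlinarith
      · rw [Filter.eventually_all]
        intro i
        have hcont : Continuous (fun x : EuclideanSpace ℝ (Fin (k+1)) => |x i.succ - x₀ i.succ|) := by fun_prop
        apply hcont.continuousAt.eventually_lt_const
        simpa [hv0s] using hε
    filter_upwards [h1] with x hx
    have := hc _ hx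
    have e : embE x₀ (fun j => x j - x₀ j) = x := by ext j; simp
    rwa [e] at this
  have hz := hF.eqOn_zero_of_preconnected_of_eventuallyEq_zero (convex_ball x₀ ρ).isPreconnected hx0 hev
  have := hnd (c 0) (fun i => c i.succ) (by
    intro x hx
    have := hz hx
    simp only [Ff_sum] at this
    exact this)
  ext l
  refine Fin.cases ?_ (fun i => ?_) l
  · exact this.1
  · exact this.2 i

lemma lag_bound {Z : Type} [Fintype Z] [DecidableEq Z] (T : Z → ℝ) (a h : ℝ) (ha : 0 < a) (hh : 0 < h)
    (hha : h ≤ 2 * a)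
    (hT : ∀ z, |T z| ≤ a) (hsep : ∀ z z', z ≠ z' → h ≤ |T z - T z'|) (y : Z → ℝ) (ε : ℝ)
    (hy : ∀ z, |y z| ≤ ε) (hε : 0 ≤ ε) (t : ℝ) (ht : |t| ≤ a) :
    |(Lagrange.interpolate Finset.univ T y).eval t| ≤
      Fintype.card Z * (ε * (2 * a / h) ^ Fintype.card Z) := by
  rw [Lagrange.interpolate_apply, Polynomial.eval_finsetSum]
  refine (Finset.abs_sum_le_sum_abs _ _).trans ?_
  have key : ∀ z ∈ (Finset.univ : Finset Z), |(Polynomial.C (y z) * Lagrange.basis Finset.univ T z).eval t| ≤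
      ε * (2 * a / h) ^ Fintype.card Z := by
    intro z _
    rw [Polynomial.eval_mul, Polynomial.eval_C, abs_mul]
    apply mul_le_mul (hy z) _ (abs_nonneg _) hε
    rw [Lagrange.basis, Polynomial.eval_prod, Finset.abs_prod]
    have h1 : 1 ≤ 2 * a / h := by rw [le_div_iff₀ hh]; linarith
    refine le_trans (Finset.prod_le_prod (g := fun _ => 2 * a / h) (fun _ _ => abs_nonneg _) ?_) ?_
    · intro j hj
      have hne : z ≠ j := (Finset.ne_of_mem_erase hj).symm
      simp only [Lagrange.basisDivisor, Polynomial.eval_mul, Polynomial.eval_C, Polynomial.eval_sub,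
        Polynomial.eval_X]
      rw [abs_mul, abs_inv, ← div_eq_inv_mul]
      apply div_le_div₀ (by linarith) _ hh (hsep z j hne)
      have := abs_sub t (T j)
      linarith [hT j]
    · rw [Finset.prod_const]
      apply pow_le_pow_right₀ h1
      exact (Finset.card_le_card (Finset.erase_subset _ _)).trans (le_of_eq (Finset.card_univ))
  simpa using Finset.sum_le_card_nsmul _ _ _ key

theorem curve_exists {k n : ℕ} {P : Type} [Fintype P] (x₀ : EuclideanSpace ℝ (Fin (k+1))) (ρ : ℝ) (hρ : 0 < ρ)
    (f : P → EuclideanSpace ℝ (Fin (k+1)) → EuclideanSpace ℝ (Fin n))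
    (han : ∀ p, AnalyticOnNhd ℝ (f p) (Metric.ball x₀ ρ)) (hnd : ∀ p, NondegOn (f p) (Metric.ball x₀ ρ)) :
    ∃ a > (0:ℝ), ∃ b > (0:ℝ), ∃ g : Fin k → Polynomial ℝ, ∀ u : Fin k → ℝ, (∀ i, |u i| < b) →
      (∀ t ∈ Ioo (-a) a, Gm x₀ g u t ∈ Metric.ball x₀ ρ) ∧
      ∀ p, ∀ (c0 : ℝ) (c : Fin n → ℝ), (∀ t ∈ Ioo (-a) a, c0 + ∑ i, c i * f p (Gm x₀ g u t) i = 0) →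
        c0 = 0 ∧ c = 0 := by
  classical
  obtain ⟨a, ha, hbox⟩ := box_in x₀ ρ hρ
  obtain ⟨N, hN⟩ : ∃ N : ℕ, N = Fintype.card (P × Fin (n+1)) := ⟨_, rfl⟩
  obtain ⟨h, hh⟩ : ∃ h : ℝ, h = a / (2 * N + 2) := ⟨_, rfl⟩
  have hN0 : (0:ℝ) ≤ N := Nat.cast_nonneg N
  have hh0 : 0 < h := by rw [hh]; positivity
  have hha : h * (2 * N + 2) = a := by rw [hh]; field_simp
  obtain ⟨ε, hε⟩ : ∃ ε : ℝ, ε = a / (4 * (N + 1) * (2 * a / h) ^ N) := ⟨_, rfl⟩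
  have hε0 : 0 < ε := by rw [hε]; positivity
  have hεN : N * (ε * (2 * a / h) ^ N) < a / 2 := by
    have h1 : 0 < (2 * a / h) ^ N := by positivity
    have : ε * (2 * a / h) ^ N = a / (4 * (N + 1)) := by
      rw [hε]; field_simp
    rw [this, mul_div_assoc', div_lt_div_iff₀ (by positivity) (by norm_num)]
    nlinarith
  let e := Fintype.equivFin (P × Fin (n+1))
  have heN : ∀ z, ((e z : ℕ) : ℝ) + 1 ≤ N := by
    intro z
    have h1 := (e z).2
    have h2 : (e z : ℕ) + 1 ≤ N := by
      rw [hN]; exact h1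
    exact_mod_cast h2
  have hq : ∀ z, (2 * ((e z : ℕ) : ℝ) + 1) * h < a := by
    intro z
    rw [← hha, mul_comm]
    apply mul_lt_mul_of_pos_left _ hh0
    linarith [heN z]
  have hpts : ∀ p, _ := fun p => exists_pts (N := n + 1) (fun l v => Ff (f p) (embE x₀ v) l)
    (fun j => Snode k h ε (e (p, (Fin.ofNat (n+1) j)))) (fun j c hc =>
      node_nd x₀ ρ a hbox (f p) (han p) (hnd p) h ε hh0 hε0 _ (hq _) ha c hc)
  choose y hyS hydet using hpts
  have hyS' : ∀ z : P × Fin (n+1), y z.1 z.2 ∈ Snode k h ε (e z) := by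
    rintro ⟨p, l⟩
    have := hyS p l
    simpa using this
  let T : P × Fin (n+1) → ℝ := fun z => y z.1 z.2 0
  have hT0 : ∀ z, 0 < T z := fun z => lt_of_le_of_lt (by positivity) (hyS' z).1.1
  have hTa : ∀ z, T z < a := fun z => (hyS' z).1.2.trans (hq z)
  have hsep' : ∀ z z', (e z : ℕ) < e z' → h ≤ T z' - T z := by
    intro z z' hlt
    have h1 := (hyS' z).1.2
    have h2 := (hyS' z').1.1
    have h3 : ((e z : ℕ) : ℝ) + 1 ≤ (e z' : ℕ) := by exact_mod_cast hlt
    have h4 := mul_le_mul_of_nonneg_right h3 hh0.le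
    have h5 : (2 * ((e z : ℕ) : ℝ) + 1) * h + h ≤ 2 * ((e z' : ℕ) : ℝ) * h := by nlinarith
    simp only [T]
    linarith
  have hsep : ∀ z z', z ≠ z' → h ≤ |T z - T z'| := by
    intro z z' hne
    rcases lt_trichotomy (e z : ℕ) (e z') with hl | hl | hl
    · have := hsep' z z' hl
      rw [abs_sub_comm]; exact this.trans (le_abs_self _)
    · exact absurd (e.injective (Fin.ext hl)) hne
    · exact (hsep' z' z hl).trans (le_abs_self _)
  have hinj : Set.InjOn T (Finset.univ : Finset (P × Fin (n+1))) := by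
    intro z _ z' _ hzz
    by_contra hne
    have := hsep z z' hne
    rw [hzz, sub_self, abs_zero] at this
    linarith
  let g : Fin k → Polynomial ℝ := fun i => Lagrange.interpolate Finset.univ T (fun z => y z.1 z.2 i.succ)
  have hgT : ∀ i z, (g i).eval (T z) = y z.1 z.2 i.succ := fun i z =>
    Lagrange.eval_interpolate_at_node _ hinj (Finset.mem_univ z)
  have hgb : ∀ i, ∀ t ∈ Ioo (-a) a, |(g i).eval t| < a / 2 := by
    intro i t ht
    refine lt_of_le_of_lt (lag_bound T a h ha hh0 ?_ ?_ hsep _ ε ?_ hε0.le t ?_) ?_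
    · nlinarith
    · intro z; rw [abs_of_pos (hT0 z)]; exact (hTa z).le
    · intro z; exact ((hyS' z).2 i).le
    · exact abs_le.2 ⟨ht.1.le, ht.2.le⟩
    · rw [← hN]; exact hεN
  have hin : ∀ u : Fin k → ℝ, (∀ i, |u i| < a / 2) → ∀ t ∈ Ioo (-a) a, Gm x₀ g u t ∈ Metric.ball x₀ ρ := by
    intro u hu t ht
    apply hbox
    intro j
    refine Fin.cases ?_ (fun i => ?_) j
    · simp only [Fin.cons_zero]; exact abs_lt.2 ht
    · simp only [Fin.cons_succ]
      have := abs_add_le (u i) ((g i).eval t)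
      linarith [hu i, hgb i t ht]
  have hTI : ∀ z, T z ∈ Ioo (-a) a := fun z => ⟨by linarith [hT0 z], hTa z⟩
  have hG0 : ∀ z, Gm x₀ g 0 (T z) = embE x₀ (y z.1 z.2) := by
    intro z
    rw [Gm]
    congr 1
    ext j
    refine Fin.cases ?_ (fun i => ?_) j
    · simp [T]
    · simp [hgT]
  have hev : ∀ᶠ u in nhds (0 : Fin k → ℝ), ∀ p, (Matrix.of fun l l' => Ff (f p) (Gm x₀ g u (T (p, l))) l').det ≠ 0 := by
    rw [Filter.eventually_all]
    intro p
    have hcont : ContinuousAt (fun u : Fin k → ℝ => (Matrix.of fun l l' => Ff (f p) (Gm x₀ g u (T (p, l))) l')) 0 := by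
      refine continuousAt_pi.2 fun l => continuousAt_pi.2 fun l' => ?_
      simp only [Matrix.of_apply]
      refine Fin.cases ?_ (fun i => ?_) l'
      · simp only [Ff, Fin.cases_zero]; exact continuousAt_const
      · simp only [Ff, Fin.cases_succ]
        have h1 : Continuous (fun u : Fin k → ℝ => Gm x₀ g u (T (p, l))) := by
          apply (embE_cont x₀).comp
          refine continuous_pi fun j => ?_
          refine Fin.cases ?_ (fun i => ?_) j
          · simp only [Fin.cons_zero]; exact continuous_const
          · simp only [Fin.cons_succ]; fun_prop
        have h2 : ContinuousAt (fun x => f p x i) (Gm x₀ g 0 (T (p, l))) :=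
          (coord_analytic (f p) _ (han p _ (hin 0 (by intro i; simpa using ha) _ (hTI _))) i).continuousAt
        exact ContinuousAt.comp (f := fun u : Fin k → ℝ => Gm x₀ g u (T (p, l))) h2 h1.continuousAt
    have hdet : ContinuousAt (fun u : Fin k → ℝ => (Matrix.of fun l l' => Ff (f p) (Gm x₀ g u (T (p, l))) l').det) 0 :=
      (Continuous.matrix_det continuous_id).continuousAt.comp hcont
    apply hdet.eventually_ne
    simp only [hG0]
    exact hydet p
  obtain ⟨b, hb, hball⟩ := Metric.eventually_nhds_iff.1 hev
  refine ⟨a, ha, min b (a / 2), lt_min hb (by linarith), g, fun u hu => ⟨?_, ?_⟩⟩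
  · exact hin u fun i => (hu i).trans_le (min_le_right _ _)
  · intro p c0 c hc
    have hd := hball (y := u) (by
      rw [dist_pi_lt_iff hb]
      intro i
      simpa [Real.dist_eq] using (hu i).trans_le (min_le_left _ _)) p
    have := Matrix.eq_zero_of_mulVec_eq_zero hd (v := Fin.cons c0 c) (by
      ext l
      have h1 := hc _ (hTI (p, l))
      simp only [Matrix.mulVec, dotProduct, Matrix.of_apply, Pi.zero_apply]
      have h2 := Ff_sum (f p) (Gm x₀ g u (T (p, l))) (Fin.cons c0 c)
      simp only [Fin.cons_zero, Fin.cons_succ] at h2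
      rw [h1] at h2
      rw [← h2]
      exact Finset.sum_congr rfl fun _ _ => mul_comm _ _)
    refine ⟨?_, ?_⟩
    · simpa using congrFun this 0
    · ext i; simpa using congrFun this i.succ
end curves
end Part19

section Part20
open MeasureTheory Set ENNReal

section final

lemma coord_le_dist {k : ℕ} (x y : EuclideanSpace ℝ (Fin k)) (i : Fin k) : |x i - y i| ≤ dist x y := by
  rw [dist_eq_norm]
  have := PiLp.norm_apply_le (x - y) i
  simpa [Real.norm_eq_abs] using this

lemma Gm_zero {k : ℕ} (x₀ : EuclideanSpace ℝ (Fin (k+1))) (g : Fin k → Polynomial ℝ) (u : Fin k → ℝ) (t : ℝ) :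
    Gm x₀ g u t 0 = x₀ 0 + t := by simp [Gm]

lemma Gm_succ {k : ℕ} (x₀ : EuclideanSpace ℝ (Fin (k+1))) (g : Fin k → Polynomial ℝ) (u : Fin k → ℝ) (t : ℝ)
    (i : Fin k) : Gm x₀ g u t i.succ = x₀ i.succ + (u i + (g i).eval t) := by simp [Gm]

lemma Gm_h0 {k : ℕ} (x₀ : EuclideanSpace ℝ (Fin (k+1))) (g : Fin k → Polynomial ℝ) (u u' : Fin k → ℝ) (t t' : ℝ) :
    |t - t'| ≤ dist (Gm x₀ g u t) (Gm x₀ g u' t') := by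
  have := coord_le_dist (Gm x₀ g u t) (Gm x₀ g u' t') 0
  rw [Gm_zero, Gm_zero] at this
  convert this using 2
  ring

lemma poly_lip (g : Polynomial ℝ) (a : ℝ) : ∃ L : ℝ, ∀ t ∈ Ioo (-a) a, ∀ t' ∈ Ioo (-a) a,
    |g.eval t - g.eval t'| ≤ L * |t - t'| := by
  obtain ⟨L, hL⟩ := (isCompact_Icc (a := -a) (b := a)).exists_bound_of_continuousOn
    (f := fun t => g.derivative.eval t) (by fun_prop)
  refine ⟨L, fun t ht t' ht' => ?_⟩
  have := (convex_Ioo (-a) a).norm_image_sub_le_of_norm_hasDerivWithin_le (f := fun t => g.eval t)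
    (f' := fun t => g.derivative.eval t) (C := L)
    (fun x _ => (g.hasDerivAt x).hasDerivWithinAt) (fun x hx => hL x ⟨hx.1.le, hx.2.le⟩) ht' ht
  simpa [Real.norm_eq_abs] using this

lemma Gm_hu {k : ℕ} (x₀ : EuclideanSpace ℝ (Fin (k+1))) (g : Fin k → Polynomial ℝ) (a : ℝ) :
    ∃ Λ > (0:ℝ), ∀ u u' : Fin k → ℝ, ∀ t ∈ Ioo (-a) a, ∀ t' ∈ Ioo (-a) a, ∀ i,
      |u i - u' i| ≤ Λ * dist (Gm x₀ g u t) (Gm x₀ g u' t') := by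
  choose L hL using fun i => poly_lip (g i) a
  obtain ⟨M, hM1, hM⟩ := exists_sup L
  refine ⟨1 + M, by linarith, fun u u' t ht t' ht' i => ?_⟩
  have h1 := coord_le_dist (Gm x₀ g u t) (Gm x₀ g u' t') i.succ
  have h0 := Gm_h0 x₀ g u u' t t'
  rw [Gm_succ, Gm_succ] at h1
  have h2 := hL i t ht t' ht'
  have h3 : L i * |t - t'| ≤ M * |t - t'| := mul_le_mul_of_nonneg_right (hM i) (abs_nonneg _)
  have h4 : M * |t - t'| ≤ M * dist (Gm x₀ g u t) (Gm x₀ g u' t') :=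
    mul_le_mul_of_nonneg_left h0 (by linarith)
  have h5 : u i - u' i = (x₀ i.succ + (u i + (g i).eval t) - (x₀ i.succ + (u' i + (g i).eval t')))
      - ((g i).eval t - (g i).eval t') := by ring
  rw [h5]
  refine (abs_sub _ _).trans ?_
  linarith

lemma Gm_analytic {k : ℕ} (x₀ : EuclideanSpace ℝ (Fin (k+1))) (g : Fin k → Polynomial ℝ) (u : Fin k → ℝ) (t : ℝ) :
    AnalyticAt ℝ (Gm x₀ g u) t := by
  have h1 : AnalyticAt ℝ (fun t : ℝ => (Fin.cons t (fun i => u i + (g i).eval t) : Fin (k+1) → ℝ)) t := by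
    rw [analyticAt_pi_iff]
    intro j
    refine Fin.cases ?_ (fun i => ?_) j
    · simp only [Fin.cons_zero]
      exact analyticAt_id
    · simp only [Fin.cons_succ]
      exact analyticAt_const.add (AnalyticOnNhd.eval_polynomial (g i) t (mem_univ _))
  have h2 := AnalyticAt.fun_comp (((PiLp.continuousLinearEquiv 2 ℝ (fun _ : Fin (k+1) => ℝ)).symm :
    (Fin (k+1) → ℝ) →L[ℝ] EuclideanSpace ℝ (Fin (k+1))).analyticAt _) h1
  exact analyticAt_const.add h2

theorem lower {k n : ℕ} (x₀ : EuclideanSpace ℝ (Fin (k+1))) (ρ : ℝ) (hρ : 0 < ρ)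
    (F : Set (EuclideanSpace ℝ (Fin (k+1)) → EuclideanSpace ℝ (Fin n))) (hFfin : F.Finite)
    (hFanal : ∀ f ∈ F, AnalyticOnNhd ℝ f (Metric.ball x₀ ρ))
    (hFnd : ∀ f ∈ F, NondegOn f (Metric.ball x₀ ρ))
    (W : Set (Fin n → ℝ)) (hWcnt : W.Countable) (hWsub : W ⊆ Weights n)
    (hτ : ∃ ε > 0, ∀ r ∈ W, ε ≤ tauW r) (s : ℝ) (hs0 : 0 < s) (hs1 : s < 1) :
    Measure.hausdorffMeasure (s + k) (Metric.ball x₀ ρ ∩ ⋂ f ∈ F, ⋂ r ∈ W, f ⁻¹' BadSet r) ≠ 0 := by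
  have := hFfin.fintype
  obtain ⟨a, ha, b, hb, g, hg⟩ := curve_exists (P := F) x₀ ρ hρ (fun p => p.1)
    (fun p => hFanal p.1 p.2) (fun p => hFnd p.1 p.2)
  obtain ⟨Λ, hΛ, hu⟩ := Gm_hu x₀ g a
  refine slice _ (Gm x₀ g) a b Λ hb hΛ (fun u t t' => Gm_h0 x₀ g u u t t') hu s hs0 (fun u hub => ?_)
  obtain ⟨hg1, hg2⟩ := hg u hub
  obtain ⟨η, hη, h⟩ := curve1 (P := F) (fun p i t => p.1 (Gm x₀ g u t) i) (-a) a (by linarith)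
    (fun p i t ht => (coord_analytic p.1 _ (hFanal p.1 p.2 _ (hg1 t ht)) i).comp (Gm_analytic x₀ g u t))
    (fun p c0 c hc => hg2 p c0 c hc) W hWcnt hWsub hτ s hs0 hs1
  refine ⟨η, hη, fun J U δ h1 h2 h3 => ?_⟩
  obtain ⟨t, ht, h4, h5⟩ := h J U δ h1 h2 h3
  refine ⟨t, ht, h4, hg1 t ht, ?_⟩
  simp only [mem_iInter, mem_preimage]
  intro f hf r hr
  exact h5 ⟨f, hf⟩ r hr

end final
end Part20

theorem stmt0 (m n : ℕ) (hm : 1 ≤ m) (hmn : m ≤ n)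
    (x₀ : EuclideanSpace ℝ (Fin m)) (ρ : ℝ) (hρ : 0 < ρ)
    (B : Set (EuclideanSpace ℝ (Fin m))) (hB : B = Metric.ball x₀ ρ)
    (F : Set (EuclideanSpace ℝ (Fin m) → EuclideanSpace ℝ (Fin n))) (hFfin : F.Finite)
    (hFanal : ∀ f ∈ F, AnalyticOnNhd ℝ f B)
    (hFnd : ∀ f ∈ F, NondegOn f B)
    (W : Set (Fin n → ℝ)) (hWcnt : W.Countable) (hWsub : W ⊆ Weights n)
    (hτ : ∃ ε > 0, ∀ r ∈ W, ε ≤ tauW r) :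
    dimH (B ∩ ⋂ f ∈ F, ⋂ r ∈ W, f ⁻¹' BadSet r) = (m : ℝ≥0∞) := by
  subst hB
  obtain ⟨k, rfl⟩ : ∃ k, m = k + 1 := ⟨m - 1, by omega⟩
  apply le_antisymm
  · refine (dimH_mono (Set.subset_univ _)).trans ?_
    rw [Real.dimH_univ_eq_finrank, finrank_euclideanSpace_fin]
  · have key : ∀ s : NNReal, 0 < s → s < 1 → ((s + k : NNReal) : ℝ≥0∞) ≤
        dimH (Metric.ball x₀ ρ ∩ ⋂ f ∈ F, ⋂ r ∈ W, f ⁻¹' BadSet r) := by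
      intro s h0 h1
      apply le_dimH_of_hausdorffMeasure_ne_zero
      have := lower x₀ ρ hρ F hFfin hFanal hFnd W hWcnt hWsub hτ s (by exact_mod_cast h0) (by exact_mod_cast h1)
      simpa using this
    refine le_of_forall_lt fun c hc => ?_
    obtain ⟨c, rfl⟩ : ∃ d : NNReal, c = d := ⟨c.toNNReal, (ENNReal.coe_toNNReal hc.ne_top).symm⟩
    have hc' : c < 1 + k := by
      have h : (c : ℝ≥0∞) < ((1 + k : NNReal) : ℝ≥0∞) := by
        push_cast at hc ⊢; rwa [add_comm]
      exact_mod_cast h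
    obtain ⟨s, hs0, hs1, hs⟩ : ∃ s : NNReal, 0 < s ∧ s < 1 ∧ c < s + k := by
      have h1 : c - k < 1 := by
        rcases le_total (k : NNReal) c with h | h
        · exact (tsub_lt_iff_right h).2 hc'
        · rw [tsub_eq_zero_of_le h]; exact zero_lt_one
      obtain ⟨s, hs, hs1⟩ := exists_between h1
      refine ⟨s, lt_of_le_of_lt zero_le hs, hs1, ?_⟩
      exact lt_add_of_tsub_lt_right hs
    exact lt_of_lt_of_le (by exact_mod_cast hs) (key s hs0 hs1)
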